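/- arXiv:2511.14885 — 3 statements merged into one kernel-verified Lean document; each statement's English description precedes it below -/
import Mathlib

section
/- Let n ≥ 2 and s ∈ (0,1). There exists ε₁ > 0 such that for every ε < ε₁ the only minimizer (up to translation and sets of measure zero) of min{ P_s(E) + ε V_s(E) : E ⊂ ℝⁿ measurable, |E| = ω_n } is the unit ball B₁. -/
open MeasureTheory Metric Set Filter
open scoped ENNReal NNReal symmDiff Topology

noncomputable section

/-- The ambient Euclidean space `ℝⁿ`. -/
abbrev Rn (n : ℕ) := EuclideanSpace ℝ (Fin n)

/-- The fractional `s`-perimeter `P_s(E) = ∫_E ∫_{Eᶜ} |x-y|^{-(n+s)} dx dy`. -/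
def fracPer (n : ℕ) (s : ℝ) (E : Set (Rn n)) : ℝ≥0∞ :=
  ∫⁻ x in E, ∫⁻ y in Eᶜ, ENNReal.ofReal (‖x - y‖ ^ (-((n : ℝ) + s)))

/-- The Riesz-type potential `∫_E |x-y|^{-s} dx` of `E` evaluated at `y`. -/
def rieszAt (n : ℕ) (s : ℝ) (E : Set (Rn n)) (y : Rn n) : ℝ≥0∞ :=
  ∫⁻ x in E, ENNReal.ofReal (‖x - y‖ ^ (-s))

/-- `V_s(E) = max_{y ∈ ℝⁿ} ∫_E |x-y|^{-s} dx`. -/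
def Vs (n : ℕ) (s : ℝ) (E : Set (Rn n)) : ℝ≥0∞ := ⨆ y : Rn n, rieszAt n s E y

/-- `ω_n`, the volume of the unit ball of `ℝⁿ`. -/
def unitBallVol (n : ℕ) : ℝ := (volume (ball (0 : Rn n) 1)).toReal

/-- The radius `r` such that `|B_r| = |E|`. -/
def ballRad (n : ℕ) (E : Set (Rn n)) : ℝ :=
  ((volume E).toReal / unitBallVol n) ^ ((1 : ℝ) / n)

/-- The fractional isoperimetric deficit `δ_s(E) = (P_s(E) - P_s(B_r))/P_s(B_r)`,
where `|B_r| = |E|`. -/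
def fracDeficit (n : ℕ) (s : ℝ) (E : Set (Rn n)) : ℝ :=
  ((fracPer n s E).toReal - (fracPer n s (ball (0 : Rn n) (ballRad n E))).toReal) /
    (fracPer n s (ball (0 : Rn n) (ballRad n E))).toReal

/-- The normalization constant `c_{n,s} = P_s(B₁)(n-s)/(n ω_n)`. -/
def cns (n : ℕ) (s : ℝ) : ℝ :=
  (fracPer n s (ball (0 : Rn n) 1)).toReal * ((n : ℝ) - s) / (n * unitBallVol n)

/-- The strong asymmetry index
`A_s(E) = min_y { |E Δ B_r(y)|/|B_r| + ((P_s(E) - c_{n,s} ∫_E |x-y|^{-s} dx)/P_s(B_r))^{1/2} }`,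
with `|B_r| = |E|`. -/
def asymA (n : ℕ) (s : ℝ) (E : Set (Rn n)) : ℝ :=
  ⨅ y : Rn n,
    ((volume (E ∆ ball y (ballRad n E))).toReal /
        (volume (ball (0 : Rn n) (ballRad n E))).toReal +
      Real.sqrt (((fracPer n s E).toReal - cns n s * (rieszAt n s E y).toReal) /
        (fracPer n s (ball (0 : Rn n) (ballRad n E))).toReal))

/-- The oscillation index `β_s(E) = ((P_s(E) - c_{n,s} V_s(E))/P_s(B_r))^{1/2}`,
with `|B_r| = |E|`. -/
def betaS (n : ℕ) (s : ℝ) (E : Set (Rn n)) : ℝ :=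
  Real.sqrt (((fracPer n s E).toReal - cns n s * (Vs n s E).toReal) /
    (fracPer n s (ball (0 : Rn n) (ballRad n E))).toReal)

/-- The asymmetry index `ζ_s(E) = (V_s(B_r) - V_s(E))/V_s(B_r)`, with `|B_r| = |E|`. -/
def zetaS (n : ℕ) (s : ℝ) (E : Set (Rn n)) : ℝ :=
  ((Vs n s (ball (0 : Rn n) (ballRad n E))).toReal - (Vs n s E).toReal) /
    (Vs n s (ball (0 : Rn n) (ballRad n E))).toReal

/-- The Fraenkel asymmetry `α(E) = min_y |E Δ B_r(y)|/|B_r|`, with `|B_r| = |E|`. -/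
def fraenkel (n : ℕ) (E : Set (Rn n)) : ℝ :=
  ⨅ y : Rn n, (volume (E ∆ ball y (ballRad n E))).toReal /
    (volume (ball (0 : Rn n) (ballRad n E))).toReal

/-- The fractional Cheeger constant `h_{m,s}(Ω) = inf { P_s(E)/|E|^m : E ⊆ Ω }`. -/
def cheeger (n : ℕ) (m s : ℝ) (Ω : Set (Rn n)) : ℝ :=
  sInf {x : ℝ | ∃ E : Set (Rn n), E ⊆ Ω ∧ MeasurableSet E ∧ 0 < volume E ∧
    x = (fracPer n s E).toReal / (volume E).toReal ^ m}

/-- The energy functional `E_s(E) = P_s(E) + ε V_s(E)`. -/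
def energy (n : ℕ) (s ε : ℝ) (E : Set (Rn n)) : ℝ≥0∞ :=
  fracPer n s E + ENNReal.ofReal ε * Vs n s E

/-- The generalized energy functional `Ẽ_s({E^k}) = Σ_k E_s(E^k)`. -/
def genEnergy (n : ℕ) (s ε : ℝ) (F : ℕ → Set (Rn n)) : ℝ≥0∞ :=
  ∑' k : ℕ, energy n s ε (F k)

/-- Absolute difference in `ℝ≥0∞` (equal to `|a - b|` for finite values). -/
def ennAbsDiff (a b : ℝ≥0∞) : ℝ≥0∞ := (a - b) + (b - a)

/-- The penalized generalized functional `Ẽ_{s,Λ}({E^k}) = Ẽ_s({E^k}) + Λ |Σ_k |E^k| - ω_n|`. -/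
def penEnergy (n : ℕ) (s ε Λ : ℝ) (F : ℕ → Set (Rn n)) : ℝ≥0∞ :=
  genEnergy n s ε F +
    ENNReal.ofReal Λ * ennAbsDiff (∑' k : ℕ, volume (F k)) (volume (ball (0 : Rn n) 1))

/-- `E` is a minimizer of `min { P_s(E) + ε V_s(E) : E ⊆ ℝⁿ measurable, |E| = ω_n }`. -/
def IsEnergyMin (n : ℕ) (s ε : ℝ) (E : Set (Rn n)) : Prop :=
  MeasurableSet E ∧ volume E = volume (ball (0 : Rn n) 1) ∧
    ∀ F : Set (Rn n), MeasurableSet F → volume F = volume (ball (0 : Rn n) 1) →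
      energy n s ε E ≤ energy n s ε F

/-! ### Singular integrals and interaction energies -/

/-- The kernel `r ↦ r ^ (-p)`, with value `∞` for `r ≤ 0`. -/
def powKer (p r : ℝ) : ℝ≥0∞ := ENNReal.ofReal r ^ (-p)

/-- The interaction energy `∫_A ∫_C k(|x-y|) dy dx`. -/
def inter {n : ℕ} (k : ℝ → ℝ≥0∞) (A C : Set (Rn n)) : ℝ≥0∞ :=
  ∫⁻ x in A, ∫⁻ y in C, k ‖x - y‖

lemma measurable_powKer (p : ℝ) : Measurable (powKer p) := by
  unfold powKer; fun_prop

lemma powKer_of_pos (p : ℝ) {r : ℝ} (hr : 0 < r) : powKer p r = ENNReal.ofReal (r ^ (-p)) := by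
  rw [powKer, ENNReal.ofReal_rpow_of_pos hr]

lemma powKer_anti {p : ℝ} (hp : 0 ≤ p) {r t : ℝ} (h : r ≤ t) : powKer p t ≤ powKer p r := by
  unfold powKer
  rw [ENNReal.rpow_neg, ENNReal.rpow_neg]
  gcongr

lemma lintegral_ball_rpow_lt_top {n : ℕ} (hn : 1 ≤ n) {q : ℝ} (hq : q < n) (r : ℝ) :
    ∫⁻ x in ball (0 : Rn n) r, ENNReal.ofReal (‖x‖ ^ (-q)) < ⊤ := by
  have h := integrableOn_ball_of_norm_le_rpow (E := Rn n) (μ := volume) (by simpa using hn)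
    (f := fun x => ‖x‖ ^ (-q)) (C := 1) (α := q) (r := r) (by simpa using hq)
    (by
      filter_upwards with x
      rw [one_mul, Real.norm_of_nonneg (by positivity)])
    (by
      refine Measurable.aestronglyMeasurable ?_
      fun_prop)
  have := h.2
  rw [hasFiniteIntegral_iff_ofReal (by filter_upwards with x; positivity)] at this
  exact this

lemma lintegral_min_norm_mul_powKer_lt_top {n : ℕ} (hn : 1 ≤ n) {s : ℝ} (hs : s ∈ Ioo (0 : ℝ) 1) :
    ∫⁻ z : Rn n, ENNReal.ofReal (min ‖z‖ 1) * powKer (n + s) ‖z‖ < ⊤ := by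
  obtain ⟨h0, h1⟩ := hs
  have hb : ∀ z : Rn n, ENNReal.ofReal (min ‖z‖ 1) * powKer (n + s) ‖z‖ ≤
      (ball (0 : Rn n) 1).indicator (fun z => ENNReal.ofReal (‖z‖ ^ (-((n : ℝ) + s - 1)))) z +
      ENNReal.ofReal (2 ^ ((n : ℝ) + s)) * ENNReal.ofReal ((1 + ‖z‖) ^ (-((n : ℝ) + s))) := by
    intro z
    rcases eq_or_lt_of_le (norm_nonneg z) with hz | hz
    · rw [← hz]; simp
    rw [powKer_of_pos _ hz]
    by_cases hz1 : ‖z‖ < 1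
    · refine le_trans ?_ le_self_add
      rw [indicator_of_mem (by simpa using hz1), min_eq_left hz1.le,
        ← ENNReal.ofReal_mul hz.le]
      refine ENNReal.ofReal_le_ofReal (le_of_eq ?_)
      rw [← Real.rpow_one_add' hz.le (by have : (1 : ℝ) ≤ n := by exact_mod_cast hn
                                         linarith)]
      congr 1; ring
    · push Not at hz1
      refine le_trans ?_ le_add_self
      rw [min_eq_right hz1, ENNReal.ofReal_one, one_mul,
        ← ENNReal.ofReal_mul (by positivity)]
      refine ENNReal.ofReal_le_ofReal ?_
      rw [Real.rpow_neg hz.le, Real.rpow_neg (by positivity), ← div_eq_mul_inv,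
        ← Real.div_rpow (by norm_num) (by positivity), ← Real.inv_rpow hz.le]
      refine Real.rpow_le_rpow (by positivity) ?_ (by positivity)
      rw [inv_eq_one_div, div_le_div_iff₀ hz (by positivity)]
      linarith
  refine (lintegral_mono hb).trans_lt ?_
  rw [lintegral_add_left (by
    refine Measurable.indicator ?_ measurableSet_ball
    fun_prop), lintegral_indicator measurableSet_ball,
    lintegral_const_mul' _ _ ENNReal.ofReal_ne_top]
  refine ENNReal.add_lt_top.2 ⟨lintegral_ball_rpow_lt_top hn (by linarith) 1, ?_⟩
  refine ENNReal.mul_lt_top ENNReal.ofReal_lt_top ?_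
  exact finite_integral_one_add_norm (by simpa using h0)

lemma fracPer_eq_inter (n : ℕ) (s : ℝ) {E : Set (Rn n)} (hE : MeasurableSet E) :
    fracPer n s E = inter (powKer (n + s)) E Eᶜ := by
  unfold fracPer inter
  refine setLIntegral_congr_fun hE fun x hx => ?_
  refine setLIntegral_congr_fun hE.compl fun y hy => ?_
  have : x ≠ y := fun h => hy (h ▸ hx)
  exact (powKer_of_pos _ (norm_pos_iff.2 (sub_ne_zero.2 this))).symm

section inter

variable {n : ℕ} {k : ℝ → ℝ≥0∞}

lemma measurable_inter_inner (hk : Measurable k) (C : Set (Rn n)) :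
    Measurable fun x : Rn n => ∫⁻ y in C, k ‖x - y‖ := by
  refine Measurable.lintegral_prod_right' (f := fun z : Rn n × Rn n => k ‖z.1 - z.2‖) ?_
  fun_prop

lemma inter_mono {A A' C C' : Set (Rn n)} (hA : A ⊆ A') (hC : C ⊆ C') :
    inter k A C ≤ inter k A' C' :=
  (lintegral_mono_set hA).trans (lintegral_mono fun _ => lintegral_mono_set hC)

lemma inter_union_left {A A' : Set (Rn n)} (hA' : MeasurableSet A') (h : Disjoint A A')
    (C : Set (Rn n)) : inter k (A ∪ A') C = inter k A C + inter k A' C := by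
  unfold inter; rw [lintegral_union hA' h]

lemma inter_union_right (hk : Measurable k) {C C' : Set (Rn n)} (hC' : MeasurableSet C')
    (h : Disjoint C C') (A : Set (Rn n)) :
    inter k A (C ∪ C') = inter k A C + inter k A C' := by
  unfold inter
  rw [← lintegral_add_left (measurable_inter_inner hk C)]
  exact lintegral_congr fun x => lintegral_union hC' h

lemma inter_swap (hk : Measurable k) (A C : Set (Rn n)) : inter k A C = inter k C A := by
  unfold inter
  rw [lintegral_lintegral_swap]
  · simp_rw [norm_sub_rev]
  · refine Measurable.aemeasurable ?_
    simp only [Function.uncurry_def]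
    fun_prop

lemma inter_add {k' : ℝ → ℝ≥0∞} (hk : Measurable k) (A C : Set (Rn n)) :
    inter (fun r => k r + k' r) A C = inter k A C + inter k' A C := by
  unfold inter
  rw [← lintegral_add_left (measurable_inter_inner hk C)]
  refine lintegral_congr fun x => ?_
  rw [lintegral_add_left (by fun_prop)]

lemma inter_univ_right (k : ℝ → ℝ≥0∞) (A : Set (Rn n)) :
    inter k A univ = (∫⁻ z : Rn n, k ‖z‖) * volume A := by
  unfold inter
  have : ∀ x : Rn n, ∫⁻ y in univ, k ‖x - y‖ = ∫⁻ z : Rn n, k ‖z‖ := fun x => by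
    rw [Measure.restrict_univ]
    exact lintegral_sub_left_eq_self (fun z : Rn n => k ‖z‖) x
  simp_rw [this]
  simp

lemma inter_compl_add_self (hk : Measurable k) {A : Set (Rn n)} (hA : MeasurableSet A) :
    inter k A Aᶜ + inter k A A = (∫⁻ z : Rn n, k ‖z‖) * volume A := by
  rw [add_comm, ← inter_union_right hk hA.compl disjoint_compl_right, union_compl_self,
    inter_univ_right]

lemma inter_eq_lintegral_prod (hk : Measurable k) {A C : Set (Rn n)} (hA : MeasurableSet A)
    (hC : MeasurableSet C) :
    inter k A C = ∫⁻ z : Rn n × Rn n, (A ×ˢ C).indicator (fun z => k ‖z.1 - z.2‖) z := by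
  rw [lintegral_indicator (hA.prod hC), Measure.volume_eq_prod, ← Measure.prod_restrict,
    lintegral_prod]
  · rfl
  · refine Measurable.aemeasurable ?_
    fun_prop

end inter

/-! ### Polarization -/

lemma lintegral_le_of_add_comp_le {α : Type*} [MeasurableSpace α] {μ : Measure α} {τ : α → α}
    (hτ : MeasurePreserving τ μ μ) {f g : α → ℝ≥0∞} (hf : Measurable f) (hg : Measurable g)
    (h : ∀ x, f x + f (τ x) ≤ g x + g (τ x)) : ∫⁻ x, f x ∂μ ≤ ∫⁻ x, g x ∂μ := by
  have key : ∀ f : α → ℝ≥0∞, Measurable f →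
      ∫⁻ x, (f x + f (τ x)) ∂μ = 2 * ∫⁻ x, f x ∂μ := fun f hf => by
    rw [lintegral_add_left hf, hτ.lintegral_comp hf, two_mul]
  have := lintegral_mono (μ := μ) h
  rw [key f hf, key g hg] at this
  exact (ENNReal.mul_le_mul_iff_right (by norm_num) (by norm_num)).1 this

/-- `σ` behaves like the reflection across the boundary of a half-space `H` containing `0`. -/
structure IsHalfSpaceReflection {n : ℕ} (σ : Rn n → Rn n) (H : Set (Rn n)) : Prop where
  measurableSet : MeasurableSet H
  measurePreserving : MeasurePreserving σ volume volume
  involutive : ∀ x, σ (σ x) = x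
  norm_sub : ∀ x y, ‖σ x - σ y‖ = ‖x - y‖
  mem_of_notMem : ∀ x, x ∉ H → σ x ∈ H
  fixed : ∀ x, x ∈ H → σ x ∈ H → σ x = x
  norm_sub_le : ∀ x y, x ∈ H → y ∈ H → ‖x - y‖ ≤ ‖x - σ y‖
  norm_le : ∀ x, x ∈ H → ‖x‖ ≤ ‖σ x‖

/-- The polarization of `E` with respect to the reflection `σ` and the half-space `H`. -/
def polarize {n : ℕ} (σ : Rn n → Rn n) (H E : Set (Rn n)) : Set (Rn n) :=
  {x | (x ∈ H ∧ (x ∈ E ∨ σ x ∈ E)) ∨ (x ∉ H ∧ x ∈ E ∧ σ x ∈ E)}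

namespace IsHalfSpaceReflection

variable {n : ℕ} {σ : Rn n → Rn n} {H E : Set (Rn n)}

lemma mem_polarize {x : Rn n} (hx : x ∈ H) : x ∈ polarize σ H E ↔ x ∈ E ∨ σ x ∈ E := by
  simp [polarize, hx]

lemma map_mem_polarize (h : IsHalfSpaceReflection σ H) {x : Rn n} (hx : x ∈ H) :
    σ x ∈ polarize σ H E ↔ x ∈ E ∧ σ x ∈ E := by
  by_cases hσ : σ x ∈ H
  · rw [h.fixed x hx hσ, mem_polarize hx, h.fixed x hx hσ]; simp
  · simp [polarize, hσ, h.involutive, and_comm]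

lemma measurableSet_polarize (h : IsHalfSpaceReflection σ H) (hE : MeasurableSet E) :
    MeasurableSet (polarize σ H E) := by
  have h1 := h.measurableSet
  have h2 : MeasurableSet (σ ⁻¹' E) := h.measurePreserving.measurable hE
  exact (h1.inter (hE.union h2)).union (h1.compl.inter (hE.inter h2))

lemma inter_polarize_le (h : IsHalfSpaceReflection σ H) (hE : MeasurableSet E)
    {k : ℝ → ℝ≥0∞} (hk : Measurable k) (hanti : ∀ r t, 0 ≤ r → r ≤ t → k t ≤ k r) :
    inter k (polarize σ H E) (polarize σ H E)ᶜ ≤ inter k E Eᶜ := by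
  set F := polarize σ H E with hF
  have hFm : MeasurableSet F := h.measurableSet_polarize hE
  let g : Set (Rn n) → Rn n × Rn n → ℝ≥0∞ := fun A =>
    (A ×ˢ Aᶜ).indicator (fun z => k ‖z.1 - z.2‖)
  have hg : ∀ A, MeasurableSet A → Measurable (g A) := fun A hA =>
    Measurable.indicator (by fun_prop) (hA.prod hA.compl)
  rw [inter_eq_lintegral_prod hk hFm hFm.compl, inter_eq_lintegral_prod hk hE hE.compl]
  have hσ := h.measurePreserving
  have τ1 : MeasurePreserving (Prod.map σ id) (volume : Measure (Rn n × Rn n)) volume :=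
    hσ.prod (MeasurePreserving.id _)
  have τ2 : MeasurePreserving (Prod.map id σ) (volume : Measure (Rn n × Rn n)) volume :=
    (MeasurePreserving.id _).prod hσ
  change ∫⁻ z, g F z ≤ ∫⁻ z, g E z
  let S : Set (Rn n) → Rn n → Rn n → ℝ≥0∞ := fun A x y =>
    (g A (x, y) + g A (σ x, y)) + (g A (x, σ y) + g A (σ x, σ y))
  have hS1 : ∀ A x y, S A (σ x) y = S A x y := fun A x y => by
    simp only [S, h.involutive]; ring
  have hS2 : ∀ A x y, S A x (σ y) = S A x y := fun A x y => by
    simp only [S, h.involutive]; ring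
  have hS0 : ∀ x y, x ∈ H → y ∈ H → S F x y ≤ S E x y := by
    intro x y hx hy
    have e1 : ‖σ x - σ y‖ = ‖x - y‖ := h.norm_sub x y
    have e2 : ‖σ x - y‖ = ‖x - σ y‖ := by rw [← h.norm_sub x, h.involutive]
    have hle : k ‖x - σ y‖ ≤ k ‖x - y‖ := hanti _ _ (norm_nonneg _) (h.norm_sub_le x y hx hy)
    classical
    simp only [S, g, indicator_apply, mem_prod, mem_compl_iff, e1, e2, hF,
      mem_polarize (E := E) (σ := σ) hx, mem_polarize (E := E) (σ := σ) hy,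
      h.map_mem_polarize (E := E) hx, h.map_mem_polarize (E := E) hy]
    generalize k ‖x - y‖ = a at *
    generalize k ‖x - σ y‖ = b at *
    have hab : a + b ≤ b + a := (add_comm a b).le
    have hba : b + a ≤ a + b := (add_comm b a).le
    by_cases a1 : x ∈ E <;> by_cases a2 : σ x ∈ E <;> by_cases a3 : y ∈ E <;>
      by_cases a4 : σ y ∈ E <;> simp [a1, a2, a3, a4, hle, hab, hba]
  have hS : ∀ x y, S F x y ≤ S E x y := by
    intro x y
    by_cases hx : x ∈ H <;> by_cases hy : y ∈ H
    · exact hS0 x y hx hy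
    · rw [← hS2 F, ← hS2 E]; exact hS0 _ _ hx (h.mem_of_notMem y hy)
    · rw [← hS1 F, ← hS1 E]; exact hS0 _ _ (h.mem_of_notMem x hx) hy
    · rw [← hS1 F, ← hS1 E, ← hS2 F, ← hS2 E]
      exact hS0 _ _ (h.mem_of_notMem x hx) (h.mem_of_notMem y hy)
  have h2 : ∫⁻ z, (g F z + g F (Prod.map σ id z)) ≤ ∫⁻ z, (g E z + g E (Prod.map σ id z)) := by
    refine lintegral_le_of_add_comp_le τ2 ?_ ?_ fun z => hS z.1 z.2
    · exact (hg F hFm).add ((hg F hFm).comp τ1.measurable)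
    · exact (hg E hE).add ((hg E hE).comp τ1.measurable)
  rw [lintegral_add_left (hg F hFm), lintegral_add_left (hg E hE), τ1.lintegral_comp (hg F hFm),
    τ1.lintegral_comp (hg E hE), ← two_mul, ← two_mul] at h2
  exact (ENNReal.mul_le_mul_iff_right (by norm_num) (by norm_num)).1 h2

lemma volume_polarize (h : IsHalfSpaceReflection σ H) (hE : MeasurableSet E) :
    volume (polarize σ H E) = volume E := by
  have hFm := h.measurableSet_polarize hE
  rw [← lintegral_indicator_one hE, ← lintegral_indicator_one hFm]
  have hm : ∀ A : Set (Rn n), MeasurableSet A → Measurable (A.indicator (1 : Rn n → ℝ≥0∞)) :=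
    fun A hA => measurable_one.indicator hA
  have key : ∀ x, (polarize σ H E).indicator (1 : Rn n → ℝ≥0∞) x +
      (polarize σ H E).indicator 1 (σ x) = E.indicator 1 x + E.indicator 1 (σ x) := by
    have h0 : ∀ x ∈ H, (polarize σ H E).indicator (1 : Rn n → ℝ≥0∞) x +
        (polarize σ H E).indicator 1 (σ x) = E.indicator 1 x + E.indicator 1 (σ x) := by
      intro x hx
      classical
      simp only [indicator_apply, mem_polarize (E := E) (σ := σ) hx,
        h.map_mem_polarize (E := E) hx]
      by_cases a1 : x ∈ E <;> by_cases a2 : σ x ∈ E <;> simp [a1, a2]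
    intro x
    by_cases hx : x ∈ H
    · exact h0 x hx
    · have := h0 _ (h.mem_of_notMem x hx)
      rw [h.involutive] at this
      rw [add_comm, this, add_comm]
  exact le_antisymm
    (lintegral_le_of_add_comp_le h.measurePreserving (hm _ hFm) (hm _ hE) fun x => (key x).le)
    (lintegral_le_of_add_comp_le h.measurePreserving (hm _ hE) (hm _ hFm) fun x => (key x).ge)

lemma volume_polarize_diff_ball_add_le (h : IsHalfSpaceReflection σ H) (hE : MeasurableSet E)
    (r : ℝ) :
    volume (polarize σ H E \ ball 0 r) + volume ((E \ ball 0 r) ∩ σ ⁻¹' (ball 0 r \ E)) ≤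
      volume (E \ ball 0 r) := by
  have hFm := h.measurableSet_polarize hE
  have hA := hE.diff (measurableSet_ball (x := (0 : Rn n)) (ε := r))
  have hA' := hFm.diff (measurableSet_ball (x := (0 : Rn n)) (ε := r))
  have hG : MeasurableSet ((E \ ball 0 r) ∩ σ ⁻¹' (ball 0 r \ E)) :=
    hA.inter (h.measurePreserving.measurable (measurableSet_ball.diff hE))
  have hm : ∀ A : Set (Rn n), MeasurableSet A → Measurable (A.indicator (1 : Rn n → ℝ≥0∞)) :=
    fun A hA => measurable_one.indicator hA
  rw [← lintegral_indicator_one hA, ← lintegral_indicator_one hA', ← lintegral_indicator_one hG,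
    ← lintegral_add_left (hm _ hA')]
  refine lintegral_le_of_add_comp_le h.measurePreserving ((hm _ hA').add (hm _ hG)) (hm _ hA) ?_
  have h0 : ∀ x ∈ H, ((polarize σ H E \ ball 0 r).indicator (1 : Rn n → ℝ≥0∞) x +
      ((E \ ball 0 r) ∩ σ ⁻¹' (ball 0 r \ E)).indicator 1 x) +
      ((polarize σ H E \ ball 0 r).indicator (1 : Rn n → ℝ≥0∞) (σ x) +
      ((E \ ball 0 r) ∩ σ ⁻¹' (ball 0 r \ E)).indicator 1 (σ x)) ≤
      (E \ ball 0 r).indicator 1 x + (E \ ball 0 r).indicator 1 (σ x) := by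
    intro x hx
    have hn : ‖σ x‖ < r → ‖x‖ < r := (h.norm_le x hx).trans_lt
    classical
    simp only [indicator_apply, Set.mem_sdiff, mem_inter_iff, mem_preimage,
      mem_polarize (E := E) (σ := σ) hx, h.map_mem_polarize (E := E) hx, h.involutive,
      mem_ball_zero_iff]
    by_cases b2 : ‖σ x‖ < r
    · simp [b2, hn b2]
    · by_cases b1 : ‖x‖ < r <;> by_cases a1 : x ∈ E <;> by_cases a2 : σ x ∈ E <;>
        simp [a1, a2, b1, b2]
  intro x
  by_cases hx : x ∈ H
  · exact h0 x hx
  · have := h0 _ (h.mem_of_notMem x hx)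
    rw [h.involutive] at this
    rw [add_comm, add_comm ((E \ ball 0 r).indicator 1 x)]
    exact this

end IsHalfSpaceReflection

/-- The reflection `x ↦ x + (u - 2⟨x,v⟩/|v|²) v` across a hyperplane orthogonal to `v`. -/
def hyperRefl {n : ℕ} (v : Rn n) (u : ℝ) (x : Rn n) : Rn n :=
  x + (u - 2 * inner ℝ x v / ‖v‖ ^ 2) • v

lemma measurePreserving_hyperRefl {n : ℕ} (v : Rn n) (u : ℝ) :
    MeasurePreserving (hyperRefl v u) (volume : Measure (Rn n)) volume := by
  have h1 : hyperRefl v u = (fun x => x + u • v) ∘ (Submodule.reflection (ℝ ∙ v)ᗮ) := by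
    ext1 x
    simp only [hyperRefl, Function.comp, Submodule.reflection_orthogonal_apply,
      Submodule.reflection_singleton_apply, RCLike.ofReal_real_eq_id, id, two_smul, sub_smul,
      real_inner_comm x v, mul_div_assoc, mul_smul]
    module
  rw [h1]
  exact (measurePreserving_add_right volume (u • v)).comp
    (LinearIsometryEquiv.measurePreserving _)

lemma isHalfSpaceReflection_hyperRefl_of_nonpos {n : ℕ} {v : Rn n} (hv : v ≠ 0) {u : ℝ}
    (hu : u ≤ 0) :
    IsHalfSpaceReflection (hyperRefl v u) {x | u - 2 * inner ℝ x v / ‖v‖ ^ 2 ≤ 0} := by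
  have hv2 : 0 < ‖v‖ ^ 2 := by have := norm_pos_iff.2 hv; positivity
  set c : Rn n → ℝ := fun x => u - 2 * inner ℝ x v / ‖v‖ ^ 2 with hc
  have hσ : ∀ x, hyperRefl v u x = x + c x • v := fun x => rfl
  have hc' : ∀ x, 2 * inner ℝ x v = (u - c x) * ‖v‖ ^ 2 := fun x => by
    simp only [hc]; field_simp; ring
  have hcσ : ∀ x, c (x + c x • v) = - c x := fun x => by
    have h := hc' (x + c x • v)
    have h2 := hc' x
    rw [inner_add_left, inner_smul_left, real_inner_self_eq_norm_sq] at h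
    simp only [conj_trivial] at h
    have : (c (x + c x • v) + c x) * ‖v‖ ^ 2 = 0 := by linarith
    rcases mul_eq_zero.1 this with h | h
    · linarith
    · exact absurd h hv2.ne'
  have hexp : ∀ (d : Rn n) (a : ℝ), ‖d + a • v‖ ^ 2 = ‖d‖ ^ 2 + a * (2 * inner ℝ d v) +
      a ^ 2 * ‖v‖ ^ 2 := fun d a => by
    rw [norm_add_sq_real, inner_smul_right, norm_smul, mul_pow, Real.norm_eq_abs, sq_abs]; ring
  refine ⟨?_, measurePreserving_hyperRefl v u, ?_, ?_, ?_, ?_, ?_, ?_⟩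
  · exact measurableSet_le (by fun_prop) measurable_const
  · intro x
    rw [hσ, hσ, hcσ]; module
  · intro x y
    rw [hσ, hσ]
    have e : x + c x • v - (y + c y • v) = (x - y) + (c x - c y) • v := by module
    rw [e, ← sq_eq_sq₀ (norm_nonneg _) (norm_nonneg _), hexp, inner_sub_left, mul_sub, hc', hc']
    ring
  · intro x hx
    simp only [mem_ofPred_eq, not_le] at hx ⊢
    change c _ ≤ 0
    change 0 < c x at hx
    rw [hσ, hcσ]; linarith
  · intro x hx hx'
    change c x ≤ 0 at hx
    change c _ ≤ 0 at hx'
    rw [hσ, hcσ] at hx'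
    rw [hσ, show c x = 0 by linarith]; simp
  · intro x y hx hy
    change c x ≤ 0 at hx
    change c y ≤ 0 at hy
    rw [hσ, ← sq_le_sq₀ (norm_nonneg _) (norm_nonneg _)]
    have e : x - (y + c y • v) = (x - y) + (- c y) • v := by module
    rw [e, hexp, inner_sub_left, mul_sub, hc', hc']
    nlinarith [mul_nonneg (mul_nonneg_of_nonpos_of_nonpos hx hy) hv2.le]
  · intro x hx
    change c x ≤ 0 at hx
    rw [hσ, ← sq_le_sq₀ (norm_nonneg _) (norm_nonneg _), hexp, hc']
    nlinarith [mul_nonneg (mul_nonneg_of_nonpos_of_nonpos hx hu) hv2.le]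

lemma exists_isHalfSpaceReflection_hyperRefl {n : ℕ} {v : Rn n} (hv : v ≠ 0) (u : ℝ) :
    ∃ H, IsHalfSpaceReflection (hyperRefl v u) H := by
  rcases le_total u 0 with hu | hu
  · exact ⟨_, isHalfSpaceReflection_hyperRefl_of_nonpos hv hu⟩
  · have h := isHalfSpaceReflection_hyperRefl_of_nonpos (neg_ne_zero.2 hv) (neg_nonpos.2 hu)
    have e : hyperRefl (-v) (-u) = hyperRefl v u := by
      ext1 x
      simp only [hyperRefl, inner_neg_right, norm_neg, mul_neg, neg_div]
      module
    rw [e] at h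
    exact ⟨_, h⟩

lemma volume_ball_inter_preimage_smul {n : ℕ} {R t : ℝ} (hR : 0 < R) (ht : 2 * R ≤ t)
    (ht' : t ≤ 4 * R) {x : Rn n} (hx : x ∈ ball (0 : Rn n) R) {C : Set (Rn n)}
    (hC : C ⊆ ball 0 R) :
    ENNReal.ofReal (((4 * R) ^ n)⁻¹) * volume C ≤
      volume (ball (0 : Rn n) 1 ∩ {v | x + t • v ∈ C}) := by
  have ht0 : 0 < t := by linarith
  have hsub : {v | x + t • v ∈ C} ⊆ ball (0 : Rn n) 1 := by
    intro v hv
    have h1 := hC hv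
    rw [mem_ball_zero_iff] at h1 hx ⊢
    have h2 : ‖t • v‖ < 2 * R := by
      calc ‖t • v‖ = ‖(x + t • v) - x‖ := by congr 1; abel
        _ ≤ ‖x + t • v‖ + ‖x‖ := norm_sub_le _ _
        _ < 2 * R := by linarith
    rw [norm_smul, Real.norm_of_nonneg ht0.le] at h2
    by_contra! h3
    nlinarith
  rw [inter_eq_self_of_subset_right hsub]
  have h1 : {v | x + t • v ∈ C} = (fun v : Rn n => t • v) ⁻¹' ((fun w => x + w) ⁻¹' C) := rfl
  rw [h1, Measure.addHaar_preimage_smul _ ht0.ne', measure_preimage_add,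
    finrank_euclideanSpace_fin, abs_of_pos (by positivity)]
  gcongr

lemma exists_hyperRefl_gain {n : ℕ} (hn : 2 ≤ n) {R : ℝ} (hR : 0 < R) :
    ∃ c : ℝ, 0 < c ∧ ∀ A C : Set (Rn n), MeasurableSet A → MeasurableSet C → A ⊆ ball 0 R →
      C ⊆ ball 0 R → ∃ v : Rn n, v ≠ 0 ∧ ∃ u : ℝ,
        ENNReal.ofReal c * (volume A * volume C) ≤ volume (A ∩ hyperRefl v u ⁻¹' C) := by
  have hW := lintegral_ball_rpow_lt_top (n := n) (by omega) (q := 1) (by exact_mod_cast hn) 1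
  set W := ∫⁻ v in ball (0 : Rn n) 1, ENNReal.ofReal (‖v‖ ^ (-1 : ℝ)) with hWdef
  set w := W.toReal with hw
  have hw0 : 0 ≤ w := ENNReal.toReal_nonneg
  have hWw : W = ENNReal.ofReal w := (ENNReal.ofReal_toReal hW.ne).symm
  refine ⟨((4 * R) ^ n)⁻¹ / (8 * (w + 1)), by positivity, fun A C hA hC hAR hCR => ?_⟩
  set c := ((4 * R) ^ n)⁻¹ / (8 * (w + 1)) with hcdef
  by_contra! hcon
  set g := ENNReal.ofReal c * (volume A * volume C) with hg
  have hAfin : volume A ≠ ⊤ := ((measure_mono hAR).trans_lt measure_ball_lt_top).ne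
  have hCfin : volume C ≠ ⊤ := ((measure_mono hCR).trans_lt measure_ball_lt_top).ne
  let f : Rn n → Rn n → ℝ → ℝ≥0∞ := fun x v t => C.indicator 1 (x + t • v)
  have hf : Measurable fun z : (Rn n × Rn n) × ℝ => f z.1.1 z.1.2 z.2 := by
    refine (measurable_one.indicator hC).comp ?_
    fun_prop
  have hup : ∀ v : Rn n, v ≠ 0 →
      ∫⁻ x in A, ∫⁻ t, f x v t ≤
        g * (ENNReal.ofReal (8 * R) * ENNReal.ofReal (‖v‖ ^ (-1 : ℝ))) := by
    intro v hv
    have hv0 : 0 < ‖v‖ := norm_pos_iff.2 hv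
    have e1 : ∀ x, ∫⁻ t, f x v t = ∫⁻ u, C.indicator (1 : Rn n → ℝ≥0∞) (hyperRefl v u x) := fun x =>
      (lintegral_sub_right_eq_self (fun t => f x v t) (2 * inner ℝ x v / ‖v‖ ^ 2)).symm
    simp_rw [e1]
    have hm : Measurable fun z : Rn n × ℝ =>
        C.indicator (1 : Rn n → ℝ≥0∞) (hyperRefl v z.2 z.1) := by
      refine (measurable_one.indicator hC).comp ?_
      unfold hyperRefl
      fun_prop
    rw [lintegral_lintegral_swap hm.aemeasurable]
    have e2 : ∀ u, ∫⁻ x in A, C.indicator (1 : Rn n → ℝ≥0∞) (hyperRefl v u x) =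
        volume (A ∩ hyperRefl v u ⁻¹' C) := fun u => by
      have hp : MeasurableSet (hyperRefl v u ⁻¹' C) :=
        (measurePreserving_hyperRefl v u).measurable hC
      rw [inter_comm A, ← Measure.restrict_apply hp, ← lintegral_indicator_one hp]
      rfl
    simp_rw [e2]
    have e3 : ∀ u, volume (A ∩ hyperRefl v u ⁻¹' C) ≤
        (Icc (-(4 * R / ‖v‖)) (4 * R / ‖v‖)).indicator (fun _ => g) u := by
      intro u
      by_cases hu : u ∈ Icc (-(4 * R / ‖v‖)) (4 * R / ‖v‖)
      · rw [indicator_of_mem hu]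
        exact (hcon v hv u).le
      · suffices A ∩ hyperRefl v u ⁻¹' C = ∅ by simp [this]
        refine eq_empty_iff_forall_notMem.2 fun x hx => hu ?_
        have hxA := mem_ball_zero_iff.1 (hAR hx.1)
        have hxC := mem_ball_zero_iff.1 (hCR hx.2)
        rw [mem_Icc, ← abs_le, le_div_iff₀ hv0]
        have h1 : |2 * inner ℝ x v / ‖v‖ ^ 2| * ‖v‖ ≤ 2 * ‖x‖ := by
          rw [abs_div, abs_mul, abs_two, abs_of_pos (by positivity : 0 < ‖v‖ ^ 2),
            div_mul_eq_mul_div,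
            div_le_iff₀ (by positivity)]
          have := abs_real_inner_le_norm x v
          nlinarith
        have h2 : |u - 2 * inner ℝ x v / ‖v‖ ^ 2| * ‖v‖ ≤ ‖hyperRefl v u x‖ + ‖x‖ := by
          rw [← Real.norm_eq_abs, ← norm_smul]
          calc _ = ‖hyperRefl v u x - x‖ := by simp [hyperRefl]
            _ ≤ _ := norm_sub_le _ _
        have h3 : |u| ≤ |u - 2 * inner ℝ x v / ‖v‖ ^ 2| + |2 * inner ℝ x v / ‖v‖ ^ 2| := by
          have := abs_add_le (u - 2 * inner ℝ x v / ‖v‖ ^ 2) (2 * inner ℝ x v / ‖v‖ ^ 2)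
          rwa [sub_add_cancel] at this
        nlinarith
    refine (lintegral_mono e3).trans ?_
    rw [lintegral_indicator measurableSet_Icc, setLIntegral_const, Real.volume_Icc,
      ← ENNReal.ofReal_mul (by positivity), Real.rpow_neg_one]
    refine le_of_eq ?_
    congr 2
    field_simp; ring
  have hmid : ∫⁻ v in ball (0 : Rn n) 1, ∫⁻ x in A, ∫⁻ t, f x v t ≤
      g * (ENNReal.ofReal (8 * R) * W) := by
    rw [hWdef, ← lintegral_const_mul' _ _ ENNReal.ofReal_ne_top, ← lintegral_const_mul' _ _ (by
      rw [hg]; finiteness)]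
    refine lintegral_mono_ae (ae_restrict_of_ae ?_)
    have : Nontrivial (Rn n) := by
      refine Module.nontrivial_of_finrank_pos (R := ℝ) ?_
      rw [finrank_euclideanSpace_fin]; omega
    have h0 : ∀ᵐ v : Rn n, v ≠ 0 := by
      simp [ae_iff]
    filter_upwards [h0] with v hv using hup v hv
  have hlow : ENNReal.ofReal (2 * R) * (ENNReal.ofReal (((4 * R) ^ n)⁻¹) * volume C) * volume A ≤
      ∫⁻ v in ball (0 : Rn n) 1, ∫⁻ x in A, ∫⁻ t, f x v t := by
    rw [lintegral_lintegral_swap (by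
      refine Measurable.aemeasurable ?_
      refine Measurable.lintegral_prod_right'
        (f := fun z : (Rn n × Rn n) × ℝ => f z.1.2 z.1.1 z.2) ?_
      exact hf.comp (by fun_prop : Measurable fun z : (Rn n × Rn n) × ℝ => ((z.1.2, z.1.1), z.2))),
      ← setLIntegral_const]
    refine setLIntegral_mono' hA fun x hx => ?_
    rw [lintegral_lintegral_swap (by
      refine Measurable.aemeasurable ?_
      exact hf.comp (by fun_prop : Measurable fun z : Rn n × ℝ => ((x, z.1), z.2)))]
    refine le_trans ?_ (setLIntegral_le_lintegral (Icc (2 * R) (4 * R)) _)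
    have e : ENNReal.ofReal (2 * R) = volume (Icc (2 * R) (4 * R)) := by
      rw [Real.volume_Icc]; congr 1; ring
    rw [e, mul_comm, ← setLIntegral_const]
    refine setLIntegral_mono' measurableSet_Icc fun t ht => ?_
    refine (volume_ball_inter_preimage_smul hR ht.1 ht.2 (hAR hx) hCR).trans (le_of_eq ?_)
    have hp : MeasurableSet {v : Rn n | x + t • v ∈ C} :=
      (by fun_prop : Measurable fun v : Rn n => x + t • v) hC
    rw [inter_comm, ← Measure.restrict_apply hp, ← lintegral_indicator_one hp]
    rfl
  have hgpos : g ≠ 0 := by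
    have : Nontrivial (Rn n) := by
      refine Module.nontrivial_of_finrank_pos (R := ℝ) ?_
      rw [finrank_euclideanSpace_fin]; omega
    obtain ⟨v, hv⟩ := exists_ne (0 : Rn n)
    exact (zero_le.trans_lt (hcon v hv 0)).ne'
  have hAC : volume A * volume C ≠ 0 := fun h => hgpos (by rw [hg, h, mul_zero])
  have hfin := hlow.trans hmid
  rw [hg, hWw] at hfin
  have hAC' : volume A * volume C ≠ ⊤ := ENNReal.mul_ne_top hAfin hCfin
  have e1 : ENNReal.ofReal (2 * R) * (ENNReal.ofReal (((4 * R) ^ n)⁻¹) * volume C) * volume A =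
      ENNReal.ofReal (2 * R * ((4 * R) ^ n)⁻¹) * (volume A * volume C) := by
    rw [ENNReal.ofReal_mul (p := 2 * R) (q := ((4 * R) ^ n)⁻¹) (by positivity)]; ring
  have e2 : ENNReal.ofReal c * (volume A * volume C) *
      (ENNReal.ofReal (8 * R) * ENNReal.ofReal w) =
      ENNReal.ofReal (c * (8 * R) * w) * (volume A * volume C) := by
    rw [ENNReal.ofReal_mul (p := c * (8 * R)) (q := w) (by positivity),
      ENNReal.ofReal_mul (p := c) (q := 8 * R) (by positivity)]; ring
  rw [e1, e2, ENNReal.mul_le_mul_iff_left hAC hAC',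
    ENNReal.ofReal_le_ofReal_iff (by positivity)] at hfin
  have hq : 0 < ((4 * R) ^ n)⁻¹ := by positivity
  have : c * (8 * R) * w ≤ R * ((4 * R) ^ n)⁻¹ := by
    have : c * (8 * R) * w = R * ((4 * R) ^ n)⁻¹ * (w / (w + 1)) := by
      rw [hcdef]; field_simp
    rw [this]
    refine mul_le_of_le_one_right (by positivity) ?_
    rw [div_le_one (by positivity)]; linarith
  nlinarith

lemma volume_sdiff_eq_sdiff {α : Type*} [MeasurableSpace α] {μ : Measure α} {A C : Set α}
    (hA : MeasurableSet A) (hC : MeasurableSet C) (h : μ A = μ C) (hfin : μ C ≠ ⊤) :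
    μ (A \ C) = μ (C \ A) := by
  have h1 := measure_inter_add_sdiff A hC (μ := μ)
  have h2 := measure_inter_add_sdiff C hA (μ := μ)
  rw [Set.inter_comm C A] at h2
  have h3 : μ (A ∩ C) ≠ ⊤ := ((measure_mono inter_subset_right).trans_lt hfin.lt_top).ne
  exact (ENNReal.add_right_inj h3).1 (by rw [h1, h2, h])

lemma exists_volume_diff_ball_le {n : ℕ} {E : Set (Rn n)} (hE : MeasurableSet E)
    (hfin : volume E ≠ ⊤) {δ : ℝ≥0∞} (hδ : 0 < δ) (r : ℝ) :
    ∃ R, r ≤ R ∧ volume (E \ ball 0 R) ≤ δ := by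
  have h := tendsto_measure_iInter_atTop (μ := (volume : Measure (Rn n)))
    (s := fun N : ℕ => E \ ball 0 (N : ℝ)) (fun N => (hE.diff measurableSet_ball).nullMeasurableSet)
    (fun a b hab => sdiff_subset_sdiff_right (ball_subset_ball (by exact_mod_cast hab)))
    ⟨0, ((measure_mono sdiff_subset).trans_lt hfin.lt_top).ne⟩
  have h0 : ⋂ N : ℕ, E \ ball (0 : Rn n) (N : ℝ) = ∅ := by
    refine eq_empty_iff_forall_notMem.2 fun x hx => ?_
    obtain ⟨N, hN⟩ := exists_nat_gt ‖x‖
    exact (mem_iInter.1 hx N).2 (mem_ball_zero_iff.2 hN)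
  rw [h0, measure_empty] at h
  obtain ⟨N, h1, h2⟩ := ((h.eventually_le_const hδ).and
    (tendsto_natCast_atTop_atTop.eventually_ge_atTop r)).exists
  exact ⟨N, h2, h1⟩

lemma exists_volume_diff_ball_le_of_inter_le {n : ℕ} (hn : 2 ≤ n) {k : ℝ → ℝ≥0∞}
    (hk : Measurable k) (hanti : ∀ r t, 0 ≤ r → r ≤ t → k t ≤ k r) {r : ℝ} (hr : 0 < r)
    {E : Set (Rn n)} (hE : MeasurableSet E) (hvol : volume E = volume (ball (0 : Rn n) r))
    {δ : ℝ≥0∞} (hδ : 0 < δ) (hδ' : δ ≠ ⊤) :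
    ∃ F : Set (Rn n), MeasurableSet F ∧ volume F = volume (ball (0 : Rn n) r) ∧
      inter k F Fᶜ ≤ inter k E Eᶜ ∧ volume (F \ ball 0 r) ≤ δ := by
  have hbfin : volume (ball (0 : Rn n) r) ≠ ⊤ := measure_ball_lt_top.ne
  have hδ2 : δ / 2 ≠ 0 := (ENNReal.half_pos hδ.ne').ne'
  obtain ⟨R, hrR, hR⟩ := exists_volume_diff_ball_le hE (hvol ▸ hbfin) (ENNReal.half_pos hδ.ne') r
  obtain ⟨c, hc, hgain⟩ := exists_hyperRefl_gain hn (hr.trans_le hrR)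
  set g := ENNReal.ofReal c * (δ / 2 * δ) with hg
  have hg0 : g ≠ 0 := by
    simp only [hg, ne_eq, mul_eq_zero, not_or]
    exact ⟨by simpa using hc, hδ2, hδ.ne'⟩
  have key : ∀ N : ℕ, ∃ F : Set (Rn n), MeasurableSet F ∧ volume F = volume (ball (0 : Rn n) r) ∧
      inter k F Fᶜ ≤ inter k E Eᶜ ∧ volume (F \ ball 0 R) ≤ δ / 2 ∧
      (volume (F \ ball 0 r) ≤ δ ∨ volume (F \ ball 0 r) + N * g ≤ volume (E \ ball 0 r)) := by
    intro N
    induction N with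
    | zero => exact ⟨E, hE, hvol, le_rfl, hR, Or.inr (by simp)⟩
    | succ N ih =>
      obtain ⟨F, hF, hFv, hFk, hFR, hFN⟩ := ih
      by_cases hFδ : volume (F \ ball 0 r) ≤ δ
      · exact ⟨F, hF, hFv, hFk, hFR, Or.inl hFδ⟩
      replace hFN := hFN.resolve_left hFδ
      push Not at hFδ
      have hsub : ball (0 : Rn n) r ⊆ ball 0 R := ball_subset_ball hrR
      obtain ⟨v, hv, u, huv⟩ := hgain ((F \ ball 0 r) ∩ ball 0 R) (ball 0 r \ F)
        ((hF.diff measurableSet_ball).inter measurableSet_ball) (measurableSet_ball.diff hF)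
        inter_subset_right (sdiff_subset.trans hsub)
      obtain ⟨H, hH⟩ := exists_isHalfSpaceReflection_hyperRefl hv u
      have hA : δ / 2 ≤ volume ((F \ ball 0 r) ∩ ball 0 R) := by
        have h1 := measure_inter_add_sdiff (μ := volume) (F \ ball 0 r)
          (measurableSet_ball (x := (0 : Rn n)) (ε := R))
        have h2 : volume ((F \ ball 0 r) \ ball 0 R) ≤ δ / 2 :=
          (measure_mono (sdiff_subset_sdiff_left sdiff_subset)).trans hFR
        have h3 : δ / 2 + δ / 2 ≤ volume ((F \ ball 0 r) ∩ ball 0 R) + δ / 2 := by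
          rw [ENNReal.add_halves]
          exact hFδ.le.trans (h1 ▸ by gcongr)
        exact (ENNReal.add_le_add_iff_right (ENNReal.div_ne_top hδ' (by simp))).1 h3
      have hC : δ ≤ volume (ball 0 r \ F) := by
        rw [← volume_sdiff_eq_sdiff hF measurableSet_ball hFv hbfin]; exact hFδ.le
      have hgg : g ≤ volume ((F \ ball 0 r) ∩ hyperRefl v u ⁻¹' (ball 0 r \ F)) := by
        refine le_trans ?_ (huv.trans (measure_mono (inter_subset_inter_left _ inter_subset_left)))
        rw [hg]; gcongr
      have hr' := hH.volume_polarize_diff_ball_add_le hF r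
      have hR' := hH.volume_polarize_diff_ball_add_le hF R
      refine ⟨polarize (hyperRefl v u) H F, hH.measurableSet_polarize hF,
        (hH.volume_polarize hF).trans hFv, (hH.inter_polarize_le hF hk hanti).trans hFk,
        (le_self_add.trans hR').trans hFR, Or.inr ?_⟩
      calc _ = volume (polarize (hyperRefl v u) H F \ ball 0 r) + g + N * g := by push_cast; ring
        _ ≤ volume (F \ ball 0 r) + N * g := by
          gcongr
          exact le_trans (by gcongr) hr'
        _ ≤ _ := hFN
  have hEfin : volume (E \ ball 0 r) ≠ ⊤ :=
    ((measure_mono sdiff_subset).trans_lt (hvol ▸ hbfin.lt_top)).ne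
  obtain ⟨N, hN⟩ := ENNReal.exists_nat_mul_gt hg0 hEfin
  obtain ⟨F, hF, hFv, hFk, -, hFN⟩ := key N
  refine ⟨F, hF, hFv, hFk, hFN.resolve_right fun h => ?_⟩
  exact absurd (le_add_self.trans h) (not_le.2 hN)

/-- Riesz rearrangement: balls minimize nonlocal perimeters among sets of the same volume. -/
lemma inter_ball_le {n : ℕ} (hn : 2 ≤ n) {k : ℝ → ℝ≥0∞}
    (hk : Measurable k) (hanti : ∀ r t, 0 ≤ r → r ≤ t → k t ≤ k r) {r : ℝ} (hr : 0 < r)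
    {E : Set (Rn n)} (hE : MeasurableSet E) (hvol : volume E = volume (ball (0 : Rn n) r)) :
    inter k (ball (0 : Rn n) r) (ball 0 r)ᶜ ≤ inter k E Eᶜ := by
  choose F hF hFv hFk hFδ using fun j : ℕ =>
    exists_volume_diff_ball_le_of_inter_le hn hk hanti hr hE hvol (δ := 2⁻¹ ^ j)
      (by simp [pos_iff_ne_zero]) (by finiteness)
  have hsum : ∑' j, volume (F j ∆ ball (0 : Rn n) r) ≠ ⊤ := by
    refine ne_top_of_le_ne_top (b := ∑' j : ℕ, 2 * 2⁻¹ ^ j) ?_ (ENNReal.tsum_le_tsum fun j => ?_)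
    · rw [ENNReal.tsum_mul_left, ENNReal.tsum_geometric]
      simp [ENNReal.mul_eq_top, ENNReal.one_sub_inv_two]
    · refine (measure_union_le _ _).trans ?_
      rw [← volume_sdiff_eq_sdiff (hF j) measurableSet_ball (hFv j) measure_ball_lt_top.ne, two_mul]
      gcongr <;> exact hFδ j
  have hae := ae_eventually_notMem hsum
  have hae1 := (Measure.quasiMeasurePreserving_fst (μ := (volume : Measure (Rn n)))
    (ν := (volume : Measure (Rn n)))).ae hae
  have hae2 := (Measure.quasiMeasurePreserving_snd (μ := (volume : Measure (Rn n)))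
    (ν := (volume : Measure (Rn n)))).ae hae
  let g : Set (Rn n) → Rn n × Rn n → ℝ≥0∞ := fun A =>
    (A ×ˢ Aᶜ).indicator (fun z => k ‖z.1 - z.2‖)
  have hgm : ∀ j, Measurable (g (F j)) := fun j =>
    (by fun_prop : Measurable fun z : Rn n × Rn n => k ‖z.1 - z.2‖).indicator
      ((hF j).prod (hF j).compl)
  have hle : ∀ᵐ z : Rn n × Rn n, g (ball 0 r) z ≤ liminf (fun j => g (F j) z) atTop := by
    rw [Measure.volume_eq_prod]
    filter_upwards [hae1, hae2] with z h1 h2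
    have : ∀ᶠ j in atTop, g (F j) z = g (ball 0 r) z := by
      filter_upwards [h1, h2] with j h1 h2
      rw [mem_symmDiff] at h1 h2
      have e1 : z.1 ∈ F j ↔ z.1 ∈ ball (0 : Rn n) r := by tauto
      have e2 : z.2 ∈ F j ↔ z.2 ∈ ball (0 : Rn n) r := by tauto
      classical
      simp only [g, indicator_apply, mem_prod, mem_compl_iff, e1, e2]
    rw [liminf_congr this, liminf_const]
  rw [inter_eq_lintegral_prod hk measurableSet_ball measurableSet_ball.compl]
  refine (lintegral_mono_ae hle).trans ((lintegral_liminf_le hgm).trans ?_)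
  refine liminf_le_of_le (by isBoundedDefault) fun b hb => ?_
  obtain ⟨j, hj⟩ := hb.exists
  refine (hj.trans (le_of_eq ?_)).trans (hFk j)
  exact (inter_eq_lintegral_prod hk (hF j) (hF j).compl).symm

/-- A truncated quadratic kernel, constant near the origin and supported in `[0, 6]`. -/
def quadKer (p a r : ℝ) : ℝ := 6 ^ (-p - 2) * max 0 (36 - max r a ^ 2)

lemma continuous_quadKer (p a : ℝ) : Continuous (quadKer p a) := by
  unfold quadKer; fun_prop

@[fun_prop]
lemma measurable_quadKer (p a : ℝ) : Measurable (quadKer p a) :=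
  (continuous_quadKer p a).measurable

lemma quadKer_nonneg (p a r : ℝ) : 0 ≤ quadKer p a r :=
  mul_nonneg (by positivity) (le_max_left _ _)

lemma mul_sq_sub_sq_le_rpow_sub_rpow {p r t : ℝ} (hp : 2 ≤ p) (hr : 0 < r) (hrt : r ≤ t)
    (ht : t ≤ 6) : 6 ^ (-p - 2) * (t ^ 2 - r ^ 2) ≤ r ^ (-p) - t ^ (-p) := by
  have ht0 : 0 < t := hr.trans_le hrt
  have h1 : (6 : ℝ) ^ (-p - 2) ≤ r ^ (-p) * (t ^ 2)⁻¹ := by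
    rw [sub_eq_add_neg, Real.rpow_add (by norm_num), Real.rpow_neg (by norm_num : (0 : ℝ) ≤ 6) 2]
    norm_num
    refine mul_le_mul ?_ ?_ (by norm_num) (by positivity)
    · exact Real.rpow_le_rpow_of_nonpos hr (hrt.trans ht) (by linarith)
    · rw [one_div, inv_le_inv₀ (by norm_num) (by positivity)]
      nlinarith
  have h2 : t ^ (-p) ≤ r ^ (-p) * (r / t) ^ 2 := by
    have e : t ^ (-p) = r ^ (-p) * (r / t) ^ p := by
      rw [Real.div_rpow hr.le ht0.le, Real.rpow_neg hr.le, Real.rpow_neg ht0.le]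
      have := (Real.rpow_pos_of_pos hr p).ne'
      have := (Real.rpow_pos_of_pos ht0 p).ne'
      field_simp
    rw [e]
    gcongr
    rw [← Real.rpow_natCast]
    exact Real.rpow_le_rpow_of_exponent_ge (by positivity) ((div_le_one ht0).2 hrt) (by simpa)
  calc _ ≤ r ^ (-p) * (t ^ 2)⁻¹ * (t ^ 2 - r ^ 2) := by
        gcongr
        have : r ^ 2 ≤ t ^ 2 := by gcongr
        linarith
    _ = r ^ (-p) - r ^ (-p) * (r / t) ^ 2 := by field_simp
    _ ≤ _ := by linarith

lemma quadKer_sub_le {p a r t : ℝ} (hp : 2 ≤ p) (ha : a ≤ 6) (hr : 0 < r)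
    (hrt : r ≤ t) : quadKer p a r - quadKer p a t ≤ r ^ (-p) - t ^ (-p) := by
  have hz : ∀ t : ℝ, 6 ≤ t → quadKer p a t = 0 := fun t ht => by
    rw [quadKer, max_eq_left, mul_zero]
    have := ht.trans (le_max_left t a)
    nlinarith
  have key : ∀ t, r ≤ t → t ≤ 6 → quadKer p a r - quadKer p a t ≤ r ^ (-p) - t ^ (-p) := by
    intro t hrt ht
    refine le_trans ?_ (mul_sq_sub_sq_le_rpow_sub_rpow hp hr hrt ht)
    have h36 : ∀ t : ℝ, 0 < t → t ≤ 6 → max 0 (36 - max t a ^ 2) = 36 - max t a ^ 2 := by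
      intro t ht0 ht
      refine max_eq_right ?_
      have : max t a ≤ 6 := max_le ht ha
      have := ht0.trans_le (le_max_left t a)
      nlinarith
    rw [quadKer, quadKer, h36 r hr (hrt.trans ht), h36 t (hr.trans_le hrt) ht, ← mul_sub]
    refine mul_le_mul_of_nonneg_left ?_ (by positivity)
    rcases le_total t a with h1 | h1
    · rw [max_eq_right h1, max_eq_right (hrt.trans h1)]; nlinarith
    · rw [max_eq_left h1]
      have := le_max_left r a
      nlinarith
  have hanti : ∀ u t : ℝ, 0 < u → u ≤ t → t ^ (-p) ≤ u ^ (-p) := fun u t hu hut =>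
    Real.rpow_le_rpow_of_nonpos hu hut (by linarith)
  rcases le_total t 6 with ht | ht
  · exact key t hrt ht
  · rw [hz t ht]
    rcases le_total r 6 with h6 | h6
    · have h1 := key 6 h6 le_rfl
      rw [hz 6 le_rfl] at h1
      have := hanti 6 t (by norm_num) ht
      linarith
    · rw [hz r h6]
      have := hanti r t hr hrt
      linarith

lemma quadKer_le_rpow {p a r : ℝ} (hp : 2 ≤ p) (ha : a ≤ 6) (hr : 0 < r) :
    quadKer p a r ≤ r ^ (-p) := by
  have h := quadKer_sub_le hp ha hr (le_max_left r 6)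
  have hz : quadKer p a (max r 6) = 0 := by
    rw [quadKer, max_eq_left, mul_zero]
    have := (le_max_right r 6).trans (le_max_left (max r 6) a)
    nlinarith
  have : 0 ≤ max r 6 ^ (-p) := by positivity
  linarith

/-- The isoperimetric inequality for the kernel `|z|^{-p} - q(|z|)`, rewritten as a comparison
of `P_s` plus the attractive quadratic interaction. -/
lemma inter_ball_add_quadKer_le {n : ℕ} (hn : 2 ≤ n) {p : ℝ} (hp : 2 ≤ p) {a : ℝ} (ha : a ≤ 6)
    {E : Set (Rn n)} (hE : MeasurableSet E)
    (hvol : volume E = volume (ball (0 : Rn n) 1)) :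
    inter (powKer p) (ball (0 : Rn n) 1) (ball 0 1)ᶜ +
        inter (fun r => ENNReal.ofReal (quadKer p a r)) (ball (0 : Rn n) 1) (ball 0 1) ≤
      inter (powKer p) E Eᶜ + inter (fun r => ENNReal.ofReal (quadKer p a r)) E E := by
  set q : ℝ → ℝ≥0∞ := fun r => ENNReal.ofReal (quadKer p a r) with hq
  set h : ℝ → ℝ≥0∞ := fun r => powKer p r - q r with hh
  have hqm : Measurable q := (measurable_quadKer p a).ennreal_ofReal
  have hhm : Measurable h := (measurable_powKer p).sub hqm
  have h0 : powKer p 0 = ⊤ := by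
    rw [powKer, ENNReal.ofReal_zero, ENNReal.zero_rpow_of_neg (by linarith)]
  have hpos : ∀ r, 0 < r → h r = ENNReal.ofReal (r ^ (-p) - quadKer p a r) := fun r hr => by
    rw [hh, hq]
    simp only
    rw [powKer_of_pos p hr, ENNReal.ofReal_sub _ (quadKer_nonneg p a r)]
  have hanti : ∀ r t, 0 ≤ r → r ≤ t → h t ≤ h r := by
    intro r t hr hrt
    rcases hr.eq_or_lt with rfl | hr
    · have : h 0 = ⊤ := by
        rw [hh]; simp only; rw [h0, ENNReal.top_sub (by finiteness)]
      rw [this]; exact le_top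
    · rw [hpos r hr, hpos t (hr.trans_le hrt)]
      refine ENNReal.ofReal_le_ofReal ?_
      have := quadKer_sub_le hp ha hr hrt
      linarith
  have hadd : ∀ r, 0 ≤ r → powKer p r = h r + q r := by
    intro r hr
    refine (tsub_add_cancel_of_le ?_).symm
    rcases hr.eq_or_lt with rfl | hr
    · rw [h0]; exact le_top
    · rw [powKer_of_pos p hr]
      exact ENNReal.ofReal_le_ofReal (quadKer_le_rpow hp ha hr)
  have hsplit : ∀ A C : Set (Rn n), inter (powKer p) A C = inter h A C + inter q A C := by
    intro A C
    rw [← inter_add hhm]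
    unfold inter
    exact lintegral_congr fun x => lintegral_congr fun y => hadd _ (norm_nonneg _)
  rw [hsplit, hsplit, add_assoc, add_assoc, inter_compl_add_self hqm hE,
    inter_compl_add_self hqm measurableSet_ball, hvol]
  gcongr
  exact inter_ball_le hn hhm hanti one_pos hE hvol

lemma setLIntegral_preimage_smul {n : ℕ} {r : ℝ} (hr : 0 < r) {A : Set (Rn n)}
    (hA : MeasurableSet A) {f : Rn n → ℝ≥0∞} (hf : Measurable f) :
    ∫⁻ x in A, f x = ENNReal.ofReal (r ^ n) * ∫⁻ x in (fun x => r • x) ⁻¹' A, f (r • x) := by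
  rw [← setLIntegral_map hA hf (measurable_const_smul r), Measure.map_addHaar_smul _ hr.ne',
    Measure.restrict_smul, lintegral_smul_measure, smul_eq_mul, ← mul_assoc,
    ← ENNReal.ofReal_mul (by positivity), finrank_euclideanSpace_fin,
    abs_of_pos (by positivity), mul_inv_cancel₀ (by positivity), ENNReal.ofReal_one, one_mul]

lemma preimage_smul_ball_zero {n : ℕ} {r : ℝ} (hr : 0 < r) :
    (fun x : Rn n => r • x) ⁻¹' ball 0 r = ball 0 1 := by
  ext x
  simp only [mem_preimage, mem_ball_zero_iff, norm_smul, Real.norm_of_nonneg hr.le]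
  exact mul_lt_iff_lt_one_right hr

lemma lintegral_ball_rpow_eq {n : ℕ} {r : ℝ} (hr : 0 < r) (s : ℝ) :
    ∫⁻ x in ball (0 : Rn n) r, ENNReal.ofReal (‖x‖ ^ (-s)) =
      ENNReal.ofReal (r ^ n * r ^ (-s)) *
        ∫⁻ x in ball (0 : Rn n) 1, ENNReal.ofReal (‖x‖ ^ (-s)) := by
  rw [setLIntegral_preimage_smul hr measurableSet_ball (by fun_prop), preimage_smul_ball_zero hr,
    ENNReal.ofReal_mul (by positivity), mul_assoc]
  congr 1
  rw [← lintegral_const_mul' _ _ ENNReal.ofReal_ne_top]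
  refine lintegral_congr fun x => ?_
  rw [← ENNReal.ofReal_mul (by positivity), norm_smul, Real.norm_of_nonneg hr.le,
    Real.mul_rpow hr.le (norm_nonneg _)]

lemma inter_powKer_ball_eq {n : ℕ} {r : ℝ} (hr : 0 < r) (p : ℝ) :
    inter (powKer p) (ball (0 : Rn n) r) (ball 0 r)ᶜ =
      ENNReal.ofReal (r ^ n * r ^ n * r ^ (-p)) *
        inter (powKer p) (ball (0 : Rn n) 1) (ball 0 1)ᶜ := by
  have hk := measurable_powKer p
  have hK : ∀ t, powKer p (r * t) = ENNReal.ofReal (r ^ (-p)) * powKer p t := fun t => by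
    rw [powKer, powKer, ENNReal.ofReal_mul hr.le, ENNReal.mul_rpow_of_ne_top (by finiteness)
      (by finiteness), ENNReal.ofReal_rpow_of_pos hr]
  unfold inter
  rw [setLIntegral_preimage_smul hr measurableSet_ball (measurable_inter_inner hk _),
    preimage_smul_ball_zero hr, mul_assoc, ENNReal.ofReal_mul (by positivity), mul_assoc]
  congr 1
  rw [← lintegral_const_mul' _ _ ENNReal.ofReal_ne_top]
  refine lintegral_congr fun x => ?_
  rw [setLIntegral_preimage_smul hr measurableSet_ball.compl (by fun_prop), preimage_compl,
    preimage_smul_ball_zero hr, ENNReal.ofReal_mul (by positivity), mul_assoc]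
  congr 1
  rw [← lintegral_const_mul' _ _ ENNReal.ofReal_ne_top]
  refine lintegral_congr fun y => ?_
  rw [← smul_sub, norm_smul, Real.norm_of_nonneg hr.le, hK]

/-- Averaging over radii: some ball cuts `A` with small interaction across its boundary. -/
lemma exists_inter_inter_ball_le {n : ℕ} {k : ℝ → ℝ≥0∞} (hk : Measurable k) (A : Set (Rn n))
    (b : Rn n) :
    ∃ ρ ∈ Ioo (1 / 4 : ℝ) (1 / 2), inter k (A ∩ ball b ρ) (ball b ρ)ᶜ ≤
      4 * ((∫⁻ z : Rn n, ENNReal.ofReal (min ‖z‖ 1) * k ‖z‖) * volume (A ∩ ball b (1 / 2))) := by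
  classical
  set A' := A ∩ ball b (1 / 2) with hA'
  let S : Set ((ℝ × Rn n) × Rn n) := {t | ‖t.1.2 - b‖ < t.1.1 ∧ t.1.1 ≤ ‖t.2 - b‖}
  have hS : MeasurableSet S :=
    (measurableSet_lt (f := fun t : (ℝ × Rn n) × Rn n => ‖t.1.2 - b‖) (g := fun t => t.1.1)
      (by fun_prop) (by fun_prop)).inter
    (measurableSet_le (f := fun t : (ℝ × Rn n) × Rn n => t.1.1) (g := fun t => ‖t.2 - b‖)
      (by fun_prop) (by fun_prop))
  let G : ℝ → Rn n → Rn n → ℝ≥0∞ := fun ρ x y =>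
    S.indicator (fun t => k ‖t.1.2 - t.2‖) ((ρ, x), y)
  have hG : Measurable fun t : (ℝ × Rn n) × Rn n => G t.1.1 t.1.2 t.2 :=
    (by fun_prop : Measurable fun t : (ℝ × Rn n) × Rn n => k ‖t.1.2 - t.2‖).indicator hS
  have hf : ∀ ρ ∈ Ioo (1 / 4 : ℝ) (1 / 2), inter k (A ∩ ball b ρ) (ball b ρ)ᶜ =
      ∫⁻ x in A', ∫⁻ y, G ρ x y := by
    intro ρ hρ
    have e : A ∩ ball b ρ = ball b ρ ∩ A' := by
      rw [hA', Set.inter_comm (ball b ρ), Set.inter_assoc,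
        inter_eq_self_of_subset_right (ball_subset_ball hρ.2.le)]
    rw [inter, e, ← setLIntegral_indicator measurableSet_ball]
    refine lintegral_congr fun x => ?_
    by_cases hx : x ∈ ball b ρ
    · rw [indicator_of_mem hx, ← lintegral_indicator measurableSet_ball.compl]
      refine lintegral_congr fun y => ?_
      have hx' : ‖x - b‖ < ρ := by rwa [← dist_eq_norm]
      simp [G, S, indicator_apply, hx', dist_eq_norm]
    · rw [indicator_of_notMem hx]
      have hx' : ¬ ‖x - b‖ < ρ := by rwa [← dist_eq_norm]
      simp [G, S, indicator_apply, hx']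
  have hfm : Measurable fun ρ => ∫⁻ x in A', ∫⁻ y, G ρ x y :=
    (hG.lintegral_prod_right' (ν := volume)).lintegral_prod_right' (ν := volume.restrict A')
  have hvol : volume (Ioo (1 / 4 : ℝ) (1 / 2)) = 4⁻¹ := by
    rw [Real.volume_Ioo, show (1 / 2 - 1 / 4 : ℝ) = 4⁻¹ by norm_num,
      ENNReal.ofReal_inv_of_pos (by norm_num)]
    norm_num
  obtain ⟨ρ, hρ, hle⟩ := exists_le_setLAverage (μ := (volume : Measure ℝ))
    (s := Ioo (1 / 4 : ℝ) (1 / 2)) (by rw [hvol]; simp) (by rw [hvol]; simp) hfm.aemeasurable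
  refine ⟨ρ, hρ, ?_⟩
  rw [hf ρ hρ]
  refine hle.trans ?_
  rw [setLAverage_eq, hvol, ENNReal.div_eq_inv_mul, inv_inv]
  gcongr
  rw [lintegral_lintegral_swap (by
    exact (hG.lintegral_prod_right' (ν := volume)).aemeasurable), ← setLIntegral_const]
  refine lintegral_mono fun x => ?_
  have hGx : Measurable (Function.uncurry fun ρ y => G ρ x y) :=
    hG.comp (f := fun z : ℝ × Rn n => ((z.1, x), z.2)) (by fun_prop)
  rw [lintegral_lintegral_swap hGx.aemeasurable,
    ← lintegral_sub_left_eq_self (fun z : Rn n => ENNReal.ofReal (min ‖z‖ 1) * k ‖z‖) x]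
  refine lintegral_mono fun y => ?_
  have e : ∀ ρ, G ρ x y = (Ioc ‖x - b‖ ‖y - b‖).indicator (fun _ => k ‖x - y‖) ρ := fun ρ => by
    simp [G, S, indicator_apply]
  simp_rw [e]
  rw [setLIntegral_indicator measurableSet_Ioc, setLIntegral_const, mul_comm]
  gcongr
  rw [ENNReal.ofReal_min]
  refine le_min ((measure_mono inter_subset_left).trans ?_)
    ((measure_mono inter_subset_right).trans ?_)
  · rw [Real.volume_Ioc]
    refine ENNReal.ofReal_le_ofReal ?_
    rw [← sub_sub_sub_cancel_right x y b, norm_sub_rev (x - b)]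
    exact norm_sub_norm_le _ _
  · rw [hvol]; simp

lemma inter_powKer_ball_lt_top {n : ℕ} (hn : 1 ≤ n) {s : ℝ} (hs : s ∈ Ioo (0 : ℝ) 1) :
    inter (powKer (n + s)) (ball (0 : Rn n) 1) (ball 0 1)ᶜ < ⊤ := by
  obtain ⟨ρ, hρ, h⟩ := exists_inter_inter_ball_le (measurable_powKer (n + s)) univ (0 : Rn n)
  have hρ0 : 0 < ρ := by linarith [hρ.1]
  rw [univ_inter, univ_inter, inter_powKer_ball_eq hρ0] at h
  have h1 := h.trans_lt (ENNReal.mul_lt_top (by simp) (ENNReal.mul_lt_top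
    (lintegral_min_norm_mul_powKer_lt_top hn hs) measure_ball_lt_top))
  rcases ENNReal.mul_lt_top_iff.1 h1 with h2 | h2 | h2
  · exact h2.2
  · rw [ENNReal.ofReal_eq_zero] at h2
    have : 0 < ρ ^ n * ρ ^ n * ρ ^ (-(n + s)) := by positivity
    linarith
  · rw [h2]; simp

lemma inter_powKer_ball_one_le {n : ℕ} {s : ℝ} (hs : s ≤ n) {r : ℝ} (hr : 1 ≤ r) :
    inter (powKer (n + s)) (ball (0 : Rn n) 1) (ball 0 1)ᶜ ≤
      inter (powKer (n + s)) (ball (0 : Rn n) r) (ball 0 r)ᶜ := by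
  have hr0 : 0 < r := by linarith
  rw [inter_powKer_ball_eq hr0]
  refine le_mul_of_one_le_left zero_le ?_
  rw [ENNReal.one_le_ofReal, ← Real.rpow_natCast, ← Real.rpow_add hr0, ← Real.rpow_add hr0]
  exact Real.one_le_rpow hr (by linarith)

lemma volume_ball_eq {n : ℕ} (x : Rn n) {r : ℝ} (hr : 0 ≤ r) (hn : 1 ≤ n) :
    volume (ball x r) = ENNReal.ofReal (r ^ n) * volume (ball (0 : Rn n) 1) := by
  have : Nontrivial (Rn n) := by
    refine Module.nontrivial_of_finrank_pos (R := ℝ) ?_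
    rw [finrank_euclideanSpace_fin]; omega
  rw [Measure.addHaar_ball volume x hr, finrank_euclideanSpace_fin]

lemma volume_ball_one_ne_zero (n : ℕ) : volume (ball (0 : Rn n) 1) ≠ 0 :=
  (measure_ball_pos _ _ one_pos).ne'

lemma exists_volume_ball_eq {n : ℕ} (hn : 1 ≤ n) {v : ℝ≥0∞} (hv : v ≠ ⊤) :
    ∃ r : ℝ, 0 ≤ r ∧ ENNReal.ofReal (r ^ n) * volume (ball (0 : Rn n) 1) = v := by
  have h0 := volume_ball_one_ne_zero n
  have ht : volume (ball (0 : Rn n) 1) ≠ ⊤ := measure_ball_lt_top.ne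
  refine ⟨((v / volume (ball (0 : Rn n) 1)).toReal) ^ ((n : ℝ)⁻¹), by positivity, ?_⟩
  rw [Real.rpow_inv_natCast_pow ENNReal.toReal_nonneg (by omega),
    ENNReal.ofReal_toReal (ENNReal.div_ne_top hv h0), ENNReal.div_mul_cancel h0 ht]

lemma lintegral_ball_comp_sub {n : ℕ} (f : Rn n → ℝ≥0∞) (b : Rn n) (r : ℝ) :
    ∫⁻ x in ball b r, f (x - b) = ∫⁻ x in ball 0 r, f x := by
  rw [← lintegral_indicator measurableSet_ball, ← lintegral_indicator measurableSet_ball,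
    ← lintegral_sub_right_eq_self ((ball (0 : Rn n) r).indicator f) b]
  refine lintegral_congr fun x => ?_
  classical
  simp [indicator_apply, dist_eq_norm]

lemma inter_ball_one_le_of_volume_le {n : ℕ} (hn : 2 ≤ n) {s : ℝ} (hs : s ∈ Ioo (0 : ℝ) 1)
    {F : Set (Rn n)} (hF : MeasurableSet F) (hv : volume (ball (0 : Rn n) 1) ≤ volume F)
    (hv' : volume F ≠ ⊤) :
    inter (powKer (n + s)) (ball (0 : Rn n) 1) (ball 0 1)ᶜ ≤ inter (powKer (n + s)) F Fᶜ := by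
  have h2 : (2 : ℝ) ≤ n := by exact_mod_cast hn
  obtain ⟨r, hr, hrv⟩ := exists_volume_ball_eq (n := n) (by omega) hv'
  have h1 : 1 ≤ r := by
    by_contra! h
    have h3 : ENNReal.ofReal (r ^ n) < 1 := by
      rw [ENNReal.ofReal_lt_one]; exact pow_lt_one₀ hr h (by omega)
    have h4 := ENNReal.mul_lt_mul_left (volume_ball_one_ne_zero n) measure_ball_lt_top.ne h3
    rw [hrv, one_mul] at h4
    exact absurd hv (not_le.2 h4)
  refine (inter_powKer_ball_one_le (by linarith [hs.2]) h1).trans ?_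
  refine inter_ball_le hn (measurable_powKer _)
    (fun r t _ h => powKer_anti (by linarith [hs.1]) h) (by linarith) hF ?_
  rw [volume_ball_eq _ hr (by omega), hrv]

lemma exists_lintegral_rpow_le_inter_compl {n : ℕ} (hn : 1 ≤ n) {s : ℝ} (hs : s ∈ Ioo (0 : ℝ) 1) :
    ∃ C : ℝ, 0 ≤ C ∧ ∀ h : Set (Rn n), MeasurableSet h → volume h ≠ ⊤ → ∀ b : Rn n,
      ∫⁻ x in h, ENNReal.ofReal (‖x - b‖ ^ (-s)) ≤
        ENNReal.ofReal C * inter (powKer (n + s)) h hᶜ := by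
  obtain ⟨hs0, hs1⟩ := hs
  have hn1 : (1 : ℝ) ≤ n := by exact_mod_cast hn
  have hU := lintegral_ball_rpow_lt_top hn (q := s) (by linarith) 1
  set U := ∫⁻ x in ball (0 : Rn n) 1, ENNReal.ofReal (‖x‖ ^ (-s)) with hUdef
  set u := U.toReal with hu
  have hUu : U = ENNReal.ofReal u := (ENNReal.ofReal_toReal hU.ne).symm
  have hu0 : 0 ≤ u := ENNReal.toReal_nonneg
  set w := (volume (ball (0 : Rn n) 1)).toReal with hw
  have hw0 : 0 < w := ENNReal.toReal_pos (volume_ball_one_ne_zero n) measure_ball_lt_top.ne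
  have hωw : volume (ball (0 : Rn n) 1) = ENNReal.ofReal w :=
    (ENNReal.ofReal_toReal measure_ball_lt_top.ne).symm
  refine ⟨2 / w * (2 * u / w + 1), by positivity, fun h hh hv b => ?_⟩
  rcases eq_or_ne (volume h) 0 with hv0 | hv0
  · rw [setLIntegral_measure_zero _ _ hv0]; exact zero_le
  obtain ⟨ρ, hρ, hρv⟩ := exists_volume_ball_eq (n := n) hn (v := 2 * volume h) (by finiteness)
  set v := (volume h).toReal with hvdef
  have hvv : volume h = ENNReal.ofReal v := (ENNReal.ofReal_toReal hv).symm
  have hvpos : 0 < v := ENNReal.toReal_pos hv0 hv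
  have hρw : ρ ^ n * w = 2 * v := by
    have := congrArg ENNReal.toReal hρv
    rwa [ENNReal.toReal_mul, ENNReal.toReal_ofReal (by positivity), ENNReal.toReal_mul] at this
  have hρ0 : 0 < ρ := by
    rcases hρ.eq_or_lt with h0 | h0
    · rw [← h0, zero_pow (by omega)] at hρw; linarith
    · exact h0
  have hlow : ENNReal.ofReal (ρ ^ (-(n + s))) * volume h * volume h ≤
      inter (powKer (n + s)) h hᶜ := by
    rw [← setLIntegral_const]
    refine setLIntegral_mono' hh fun x _ => ?_
    calc _ ≤ ENNReal.ofReal (ρ ^ (-(n + s))) * volume (ball x ρ \ h) := by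
          refine mul_le_mul_right (le_trans ?_ le_measure_sdiff) _
          rw [volume_ball_eq x hρ hn, hρv, two_mul, ENNReal.add_sub_cancel_right hv]
      _ = ∫⁻ y in ball x ρ \ h, ENNReal.ofReal (ρ ^ (-(n + s))) := (setLIntegral_const _ _).symm
      _ ≤ ∫⁻ y in ball x ρ \ h, powKer (n + s) ‖x - y‖ := by
          refine setLIntegral_mono' (measurableSet_ball.diff hh) fun y hy => ?_
          rw [← powKer_of_pos _ hρ0]
          refine powKer_anti (by linarith) ?_
          rw [norm_sub_rev, ← dist_eq_norm]
          exact (mem_ball.1 hy.1).le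
      _ ≤ _ := lintegral_mono_set fun y hy => hy.2
  have hup : ∫⁻ x in h, ENNReal.ofReal (‖x - b‖ ^ (-s)) ≤
      ENNReal.ofReal (ρ ^ n * ρ ^ (-s)) * U + ENNReal.ofReal (ρ ^ (-s)) * volume h := by
    rw [← lintegral_ball_rpow_eq hρ0 s,
      ← lintegral_ball_comp_sub (fun x => ENNReal.ofReal (‖x‖ ^ (-s))) b ρ]
    calc _ ≤ ∫⁻ x in ball b ρ ∪ h \ ball b ρ, ENNReal.ofReal (‖x - b‖ ^ (-s)) :=
          lintegral_mono_set (by rw [union_sdiff_self]; exact subset_union_right)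
      _ ≤ _ := lintegral_union_le _ _ _
      _ ≤ _ := by
        gcongr
        refine (setLIntegral_mono' (hh.diff measurableSet_ball)
          (g := fun _ => ENNReal.ofReal (ρ ^ (-s))) fun x hx => ?_).trans ?_
        · refine ENNReal.ofReal_le_ofReal
            (Real.rpow_le_rpow_of_nonpos hρ0 ?_ (by linarith))
          have := hx.2
          rwa [mem_ball, not_lt, dist_eq_norm] at this
        · rw [setLIntegral_const]
          gcongr
          exact sdiff_subset
  refine hup.trans (le_trans (le_of_eq ?_) (mul_le_mul_right hlow _))
  rw [hUu, hvv, ← ENNReal.ofReal_mul (by positivity), ← ENNReal.ofReal_mul (by positivity),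
    ← ENNReal.ofReal_add (by positivity) (by positivity), ← ENNReal.ofReal_mul (by positivity),
    ← ENNReal.ofReal_mul (by positivity), ← ENNReal.ofReal_mul (by positivity)]
  congr 1
  have hv2 : v = ρ ^ n * w / 2 := by linarith
  have e : ρ ^ (-((n : ℝ) + s)) = (ρ ^ n)⁻¹ * ρ ^ (-s) := by
    rw [neg_add, Real.rpow_add hρ0, Real.rpow_neg hρ0.le n, Real.rpow_natCast]
  rw [e, hv2]
  field_simp

/-- Near a point `b`, the missing part of an almost minimal set contributes little to the
Riesz potential. -/
lemma exists_lintegral_hole_le {n : ℕ} (hn : 2 ≤ n) {s : ℝ} (hs : s ∈ Ioo (0 : ℝ) 1) :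
    ∃ C : ℝ, 0 ≤ C ∧ ∀ E : Set (Rn n), MeasurableSet E →
      volume E = volume (ball (0 : Rn n) 1) → ∀ d : ℝ≥0∞,
      inter (powKer (n + s)) E Eᶜ ≤
        inter (powKer (n + s)) (ball (0 : Rn n) 1) (ball 0 1)ᶜ + d → ∀ b : Rn n,
      ∃ ρ ∈ Ioo (1 / 4 : ℝ) (1 / 2), ∫⁻ x in ball b ρ \ E, ENNReal.ofReal (‖x - b‖ ^ (-s)) ≤
        ENNReal.ofReal C * (d + volume (ball b (1 / 2) \ E)) := by
  obtain ⟨C, hC, hCh⟩ := exists_lintegral_rpow_le_inter_compl (n := n) (by omega) hs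
  have hC0 := lintegral_min_norm_mul_powKer_lt_top (n := n) (by omega) hs
  set C₀ := ∫⁻ z : Rn n, ENNReal.ofReal (min ‖z‖ 1) * powKer (n + s) ‖z‖ with hC₀
  set c := C₀.toReal with hc
  have hCc : C₀ = ENNReal.ofReal c := (ENNReal.ofReal_toReal hC0.ne).symm
  have hc0 : 0 ≤ c := ENNReal.toReal_nonneg
  have hk := measurable_powKer (n + s)
  refine ⟨C * (1 + 8 * c), by positivity, fun E hE hvol d hd b => ?_⟩
  obtain ⟨ρ, hρ, hle⟩ := exists_inter_inter_ball_le hk Eᶜ b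
  refine ⟨ρ, hρ, ?_⟩
  have e1 : ∀ r, Eᶜ ∩ ball b r = ball b r \ E := fun r => by
    rw [Set.inter_comm, sdiff_eq]
  rw [e1, e1] at hle
  set h := ball b ρ \ E with hh
  have hhm : MeasurableSet h := measurableSet_ball.diff hE
  have hhfin : volume h ≠ ⊤ := ((measure_mono sdiff_subset).trans_lt measure_ball_lt_top).ne
  set m := volume (ball b (1 / 2) \ E) with hm
  set F := E ∪ h with hF
  have hFm : MeasurableSet F := hE.union hhm
  have hdisj : Disjoint E h := disjoint_sdiff_right
  have hEc : Eᶜ = Fᶜ ∪ h := by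
    ext x
    have : x ∈ h → x ∉ E := fun hx => hx.2
    simp only [hF, mem_compl_iff, mem_union]; tauto
  have hhc : hᶜ = Fᶜ ∪ E := by
    ext x
    have : x ∈ h → x ∉ E := fun hx => hx.2
    simp only [hF, mem_compl_iff, mem_union]; tauto
  have d1 : Disjoint Fᶜ h := disjoint_compl_left.mono_right subset_union_right
  have d2 : Disjoint Fᶜ E := disjoint_compl_left.mono_right subset_union_left
  have hid : inter (powKer (n + s)) F Fᶜ + inter (powKer (n + s)) h hᶜ =
      inter (powKer (n + s)) E Eᶜ + 2 * inter (powKer (n + s)) h Fᶜ := by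
    rw [hEc, hhc, inter_union_right hk hhm d1, inter_union_right hk hE d2,
      inter_swap hk h E, hF, inter_union_left hhm hdisj]
    ring
  have hhF : inter (powKer (n + s)) h Fᶜ ≤ 4 * (C₀ * m) := by
    refine le_trans (inter_mono le_rfl (compl_subset_compl.2 ?_)) hle
    intro x hx
    by_cases hxE : x ∈ E
    · exact Or.inl hxE
    · exact Or.inr ⟨hx, hxE⟩
  have hPF := inter_ball_one_le_of_volume_le hn hs hFm
    (hvol.symm.le.trans (measure_mono subset_union_left))
    ((measure_union_lt_top (hvol ▸ measure_ball_lt_top) hhfin.lt_top).ne)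
  have hfin := inter_powKer_ball_lt_top (n := n) (by omega) hs
  have hPh : inter (powKer (n + s)) h hᶜ ≤ d + 8 * (C₀ * m) := by
    refine (ENNReal.add_le_add_iff_left hfin.ne).1 ((add_le_add_left hPF _).trans ?_)
    rw [hid, ← add_assoc]
    refine add_le_add hd ?_
    calc _ ≤ 2 * (4 * (C₀ * m)) := by gcongr
      _ = _ := by ring
  refine (hCh h hhm hhfin b).trans ?_
  rw [ENNReal.ofReal_mul hC, mul_assoc]
  gcongr
  refine hPh.trans ?_
  rw [ENNReal.ofReal_add (by positivity) (by positivity), ENNReal.ofReal_mul (by norm_num), ← hCc,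
    ENNReal.ofReal_one]
  norm_num
  calc d + 8 * (C₀ * m) ≤ (d + 8 * (C₀ * m)) + (m + 8 * (C₀ * d)) := le_self_add
    _ = _ := by ring

lemma integrableOn_of_subset_ball {n : ℕ} {F : Type*} [NormedAddCommGroup F] {A : Set (Rn n)}
    {x₀ : Rn n} {R : ℝ} (hA : A ⊆ ball x₀ R) {f : Rn n → F} (hf : Continuous f) :
    IntegrableOn f A :=
  (hf.continuousOn.integrableOn_compact (isCompact_closedBall x₀ R)).mono_set
    (hA.trans ball_subset_closedBall)

lemma exists_barycenter {n : ℕ} {A : Set (Rn n)} {x₀ : Rn n} {R : ℝ} (hA : A ⊆ ball x₀ R) :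
    ∃ b : Rn n, ∫ y in A, (y - b) = 0 := by
  refine ⟨(volume.real A)⁻¹ • ∫ y in A, y, ?_⟩
  have hfin : volume A ≠ ⊤ := ((measure_mono hA).trans_lt measure_ball_lt_top).ne
  rw [integral_sub (integrableOn_of_subset_ball hA (f := fun y => y) continuous_id)
      (integrableOn_const hfin),
    setIntegral_const, smul_smul]
  rcases eq_or_ne (volume A) 0 with h | h
  · simp [Measure.restrict_eq_zero.2 h]
  · rw [mul_inv_cancel₀ (by rw [measureReal_def]; exact (ENNReal.toReal_pos h hfin).ne'), one_smul]
    exact sub_self _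

lemma integral_ball_zero_eq_zero (n : ℕ) (r : ℝ) : ∫ y in ball (0 : Rn n) r, (y - 0) = 0 := by
  simp only [sub_zero]
  rw [← integral_indicator measurableSet_ball]
  have h := integral_neg_eq_self ((ball (0 : Rn n) r).indicator fun y => y) volume
  have e : (fun x => (ball (0 : Rn n) r).indicator (fun y => y) (-x)) =
      fun x => - (ball (0 : Rn n) r).indicator (fun y => y) x := by
    ext1 x
    classical
    simp only [indicator_apply, mem_ball_zero_iff, norm_neg]
    split_ifs <;> simp
  rw [e, integral_neg] at h
  set I := ∫ x, (ball (0 : Rn n) r).indicator (fun y => y) x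
  have h2 : (2 : ℝ) • I = 0 := by
    rw [two_smul]
    nth_rewrite 1 [← h]
    exact neg_add_cancel I
  simpa using h2

/-- The parallel axis identity for the double integral of the squared distance. -/
lemma inter_sq_self {n : ℕ} {A : Set (Rn n)} {x₀ : Rn n} {R : ℝ} (hA : A ⊆ ball x₀ R) {b : Rn n}
    (hb : ∫ y in A, (y - b) = 0) :
    inter (fun r => ENNReal.ofReal (r ^ 2)) A A =
      2 * (volume A * ∫⁻ x in A, ENNReal.ofReal (‖x - b‖ ^ 2)) := by
  have hfin : volume A ≠ ⊤ := ((measure_mono hA).trans_lt measure_ball_lt_top).ne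
  have hcont : ∀ {f : Rn n → ℝ}, Continuous f → IntegrableOn f A :=
    fun hf => integrableOn_of_subset_ball hA hf
  set M := ∫ y in A, ‖y - b‖ ^ 2 with hM
  have hM0 : 0 ≤ M := integral_nonneg fun y => by positivity
  have hMl : ∫⁻ x in A, ENNReal.ofReal (‖x - b‖ ^ 2) = ENNReal.ofReal M :=
    (ofReal_integral_eq_lintegral_ofReal (hcont (by fun_prop))
      (ae_of_all _ fun y => by positivity)).symm
  have hin : ∀ x, ∫⁻ y in A, ENNReal.ofReal (‖x - y‖ ^ 2) =
      volume A * ENNReal.ofReal (‖x - b‖ ^ 2) + ENNReal.ofReal M := by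
    intro x
    rw [← ofReal_integral_eq_lintegral_ofReal (hcont (by fun_prop))
      (ae_of_all _ fun y => by positivity), ← ENNReal.ofReal_toReal hfin,
      ← ENNReal.ofReal_mul ENNReal.toReal_nonneg, ← ENNReal.ofReal_add (by positivity) hM0]
    congr 1
    have e : ∀ y, ‖x - y‖ ^ 2 = ‖x - b‖ ^ 2 + (‖y - b‖ ^ 2 - 2 * inner ℝ (x - b) (y - b)) := by
      intro y
      rw [← sub_sub_sub_cancel_right x y b, norm_sub_sq_real]
      ring
    rw [integral_congr_ae (ae_of_all _ e), integral_add (hcont (by fun_prop)) (hcont (by fun_prop)),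
      integral_sub (hcont (by fun_prop)) (hcont (by fun_prop)), setIntegral_const,
      integral_const_mul, integral_inner (integrableOn_of_subset_ball hA (by fun_prop)), hb,
      inner_zero_right, smul_eq_mul, measureReal_def]
    ring
  unfold inter
  simp_rw [hin]
  rw [lintegral_add_right _ measurable_const, lintegral_const_mul' _ _ hfin, setLIntegral_const,
    hMl]
  ring

lemma inter_quadKer_add {n : ℕ} (p : ℝ) {A : Set (Rn n)} (hAm : MeasurableSet A) {x₀ : Rn n}
    (hA : A ⊆ ball x₀ 3) :
    inter (fun r => ENNReal.ofReal (quadKer p 0 r)) A A +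
        ENNReal.ofReal (6 ^ (-p - 2)) * inter (fun r => ENNReal.ofReal (r ^ 2)) A A =
      ENNReal.ofReal (36 * 6 ^ (-p - 2)) * (volume A * volume A) := by
  have hm := (measurable_quadKer p 0).ennreal_ofReal
  unfold inter
  rw [← lintegral_const_mul' _ _ ENNReal.ofReal_ne_top,
    ← lintegral_add_left (measurable_inter_inner hm A), ← mul_assoc, ← setLIntegral_const]
  refine setLIntegral_congr_fun hAm fun x hx => ?_
  rw [← lintegral_const_mul' _ _ ENNReal.ofReal_ne_top, ← lintegral_add_left (by fun_prop),
    ← setLIntegral_const]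
  refine setLIntegral_congr_fun hAm fun y hy => ?_
  rw [← ENNReal.ofReal_mul (by positivity), ← ENNReal.ofReal_add (quadKer_nonneg _ _ _)
    (by positivity)]
  congr 1
  have h6 : ‖x - y‖ < 6 := by
    rw [← dist_eq_norm]
    have h1 := mem_ball.1 (hA hx)
    have h2 := mem_ball'.1 (hA hy)
    linarith [dist_triangle x x₀ y]
  have h0 := norm_nonneg (x - y)
  rw [quadKer, max_eq_left h0, max_eq_right (by nlinarith)]
  ring

lemma quadKer_le (p : ℝ) {a r t : ℝ} (ht : 0 ≤ t) (h : t ≤ max r a) (h6 : t ≤ 6) :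
    quadKer p a r ≤ 6 ^ (-p - 2) * (36 - t ^ 2) := by
  rw [quadKer]
  gcongr
  exact max_le (by nlinarith) (by nlinarith)

/-- An almost minimal set is concentrated in a ball of radius `3`. -/
lemma exists_volume_diff_ball_three_le {n : ℕ} (hn : 2 ≤ n) {s : ℝ} (hs : s ∈ Ioo (0 : ℝ) 1)
    {E : Set (Rn n)} (hE : MeasurableSet E) (hvol : volume E = volume (ball (0 : Rn n) 1))
    {d : ℝ≥0∞} (hd : inter (powKer (n + s)) E Eᶜ ≤
        inter (powKer (n + s)) (ball (0 : Rn n) 1) (ball 0 1)ᶜ + d) :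
    ∃ x₀ : Rn n, ENNReal.ofReal (5 * 6 ^ (-((n : ℝ) + s) - 2)) *
      (volume (ball (0 : Rn n) 1) * volume (E \ ball x₀ 3)) ≤ d := by
  have hn2 : (2 : ℝ) ≤ n := by exact_mod_cast hn
  set p := (n : ℝ) + s with hp
  set c : ℝ := 6 ^ (-p - 2) with hc
  have hc0 : 0 < c := by positivity
  set ω := volume (ball (0 : Rn n) 1) with hω
  have hω0 : ω ≠ 0 := volume_ball_one_ne_zero n
  have hωt : ω ≠ ⊤ := measure_ball_lt_top.ne
  set q : ℝ → ℝ≥0∞ := fun r => ENNReal.ofReal (quadKer p 2 r) with hq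
  have hqm : Measurable q := (measurable_quadKer p 2).ennreal_ofReal
  set j : ℝ → ℝ≥0∞ := (Ici 3).indicator 1 with hj
  have hjm : Measurable j := measurable_one.indicator measurableSet_Ici
  have hcmp := inter_ball_add_quadKer_le hn (p := p) (by linarith [hs.1]) (a := 2) (by norm_num)
    hE hvol
  have hB : inter q (ball (0 : Rn n) 1) (ball 0 1) = ENNReal.ofReal (32 * c) * (ω * ω) := by
    unfold inter
    rw [← mul_assoc, hω, ← setLIntegral_const]
    refine setLIntegral_congr_fun measurableSet_ball fun x hx => ?_
    rw [← setLIntegral_const]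
    refine setLIntegral_congr_fun measurableSet_ball fun y hy => ?_
    simp only [hq]
    have h2 : ‖x - y‖ ≤ 2 := by
      have h1 := mem_ball_zero_iff.1 hx
      have h2 := mem_ball_zero_iff.1 hy
      linarith [norm_sub_le x y]
    rw [quadKer, max_eq_right h2, max_eq_right (by norm_num)]
    congr 1; ring
  have hEq : inter q E E + ENNReal.ofReal (5 * c) * inter j E E ≤
      ENNReal.ofReal (32 * c) * (ω * ω) := by
    unfold inter
    rw [← lintegral_const_mul' _ _ ENNReal.ofReal_ne_top,
      ← lintegral_add_left (measurable_inter_inner hqm E), ← mul_assoc, ← hvol,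
      ← setLIntegral_const]
    refine lintegral_mono fun x => ?_
    rw [← lintegral_const_mul' _ _ ENNReal.ofReal_ne_top, ← lintegral_add_left (by fun_prop),
      ← setLIntegral_const]
    refine lintegral_mono fun y => ?_
    by_cases h3 : ‖x - y‖ ∈ Ici (3 : ℝ)
    · simp only [hj, indicator_of_mem h3, hq, Pi.one_apply, mul_one]
      rw [← ENNReal.ofReal_add (quadKer_nonneg _ _ _) (by positivity)]
      refine ENNReal.ofReal_le_ofReal ?_
      have := quadKer_le p (a := 2) (r := ‖x - y‖) (t := 3) (by norm_num)
        ((mem_Ici.1 h3).trans (le_max_left _ _)) (by norm_num)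
      linarith
    · simp only [hj, indicator_of_notMem h3, hq, mul_zero, add_zero]
      refine ENNReal.ofReal_le_ofReal ?_
      have := quadKer_le p (a := 2) (r := ‖x - y‖) (t := 2) (by norm_num)
        (le_max_right _ _) (by norm_num)
      linarith
  have hfin := inter_powKer_ball_lt_top (n := n) (by omega) hs
  rw [← hp] at hfin
  have hj5 : ENNReal.ofReal (5 * c) * inter j E E ≤ d := by
    have hfin2 : inter (powKer p) (ball (0 : Rn n) 1) (ball 0 1)ᶜ +
        ENNReal.ofReal (32 * c) * (ω * ω) ≠ ⊤ := by
      have := hfin.ne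
      finiteness
    refine (ENNReal.add_le_add_iff_left hfin2).1 ?_
    calc _ ≤ inter (powKer p) E Eᶜ + inter q E E + ENNReal.ofReal (5 * c) * inter j E E := by
          rw [← hB]; gcongr
      _ ≤ inter (powKer p) (ball (0 : Rn n) 1) (ball 0 1)ᶜ + d +
          ENNReal.ofReal (32 * c) * (ω * ω) := by
          rw [add_assoc]; gcongr
      _ = _ := by ring
  obtain ⟨x₀, -, hx₀⟩ := exists_le_setLAverage (μ := volume) (s := E)
    (f := fun x => ∫⁻ y in E, j ‖x - y‖) (by rw [hvol]; exact hω0) (by rw [hvol]; exact hωt)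
    (measurable_inter_inner hjm E).aemeasurable
  refine ⟨x₀, le_trans ?_ hj5⟩
  gcongr
  rw [setLAverage_eq, hvol] at hx₀
  have e : ∫⁻ y in E, j ‖x₀ - y‖ = volume (E \ ball x₀ 3) := by
    have e1 : E \ ball x₀ 3 = (ball x₀ 3)ᶜ ∩ E := by rw [Set.sdiff_eq, Set.inter_comm]
    rw [e1, ← Measure.restrict_apply measurableSet_ball.compl,
      ← lintegral_indicator_one measurableSet_ball.compl]
    refine lintegral_congr fun y => ?_
    classical
    simp [hj, indicator_apply, dist_eq_norm, norm_sub_rev]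
  rw [e] at hx₀
  calc ω * volume (E \ ball x₀ 3) ≤ ω * (inter j E E / ω) := by gcongr; exact hx₀
    _ = inter j E E := ENNReal.mul_div_cancel hω0 hωt

/-- The excess of the second moment of `A` over that of the ball, as a sum of moments of the
symmetric difference. -/
lemma lintegral_excess_add {n : ℕ} {A : Set (Rn n)} (hA : MeasurableSet A) (b : Rn n) :
    (∫⁻ x in A \ ball b 1, ENNReal.ofReal (‖x - b‖ ^ 2 - 1)) +
        (∫⁻ x in ball b 1 \ A, ENNReal.ofReal (1 - ‖x - b‖ ^ 2)) +
        (∫⁻ x in ball (0 : Rn n) 1, ENNReal.ofReal (‖x‖ ^ 2)) + volume A =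
      (∫⁻ x in A, ENNReal.ofReal (‖x - b‖ ^ 2)) + volume (ball b 1) := by
  rw [← lintegral_ball_comp_sub (fun x => ENNReal.ofReal (‖x‖ ^ 2)) b 1]
  have hb : MeasurableSet (ball b 1) := measurableSet_ball
  have h1 : (∫⁻ x in A \ ball b 1, ENNReal.ofReal (‖x - b‖ ^ 2 - 1)) + volume (A \ ball b 1) =
      ∫⁻ x in A \ ball b 1, ENNReal.ofReal (‖x - b‖ ^ 2) := by
    rw [← setLIntegral_one, ← lintegral_add_left (by fun_prop)]
    refine setLIntegral_congr_fun (hA.diff hb) fun x hx => ?_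
    have h1 : 1 ≤ ‖x - b‖ := by
      have := hx.2; rwa [mem_ball, not_lt, dist_eq_norm] at this
    rw [← ENNReal.ofReal_one, ← ENNReal.ofReal_add (by nlinarith) (by norm_num), sub_add_cancel]
  have h2 : (∫⁻ x in ball b 1 \ A, ENNReal.ofReal (1 - ‖x - b‖ ^ 2)) +
      (∫⁻ x in ball b 1 \ A, ENNReal.ofReal (‖x - b‖ ^ 2)) = volume (ball b 1 \ A) := by
    rw [← setLIntegral_one, ← lintegral_add_left (by fun_prop)]
    refine setLIntegral_congr_fun (hb.diff hA) fun x hx => ?_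
    have h1 : ‖x - b‖ < 1 := by
      have := hx.1; rwa [mem_ball, dist_eq_norm] at this
    have h0 := norm_nonneg (x - b)
    rw [← ENNReal.ofReal_one, ← ENNReal.ofReal_add (by nlinarith) (by positivity), sub_add_cancel]
  rw [← lintegral_inter_add_sdiff _ A hb, ← lintegral_inter_add_sdiff _ (ball b 1) hA,
    ← measure_inter_add_sdiff A hb, ← measure_inter_add_sdiff (ball b 1) hA, ← h1, ← h2,
    Set.inter_comm (ball b 1) A]
  ring

lemma inter_le_mul {n : ℕ} {k : ℝ → ℝ≥0∞} {K : ℝ≥0∞} (hk : ∀ r, k r ≤ K) (A C : Set (Rn n)) :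
    inter k A C ≤ K * (volume A * volume C) := by
  unfold inter
  calc _ ≤ ∫⁻ _ in A, ∫⁻ _ in C, K := lintegral_mono fun x => lintegral_mono fun y => hk _
    _ = _ := by rw [setLIntegral_const, setLIntegral_const]; ring

lemma inter_self_le {n : ℕ} {k : ℝ → ℝ≥0∞} (hm : Measurable k) {K : ℝ≥0∞} (hk : ∀ r, k r ≤ K)
    {E D : Set (Rn n)} (hE : MeasurableSet E) (hD : MeasurableSet D) :
    inter k E E ≤ inter k (E ∩ D) (E ∩ D) + 2 * K * (volume E * volume (E \ D)) := by
  have hdisj : Disjoint (E ∩ D) (E \ D) := disjoint_sdiff_inter.symm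
  have hEu : E = E ∩ D ∪ E \ D := (inter_union_sdiff E D).symm
  have h1 : inter k E E = inter k (E ∩ D) (E ∩ D) + inter k (E ∩ D) (E \ D) +
      inter k (E \ D) E := by
    rw [← inter_union_right hm (hE.diff hD) hdisj, ← hEu, ← inter_union_left (hE.diff hD) hdisj,
      ← hEu]
  rw [h1]
  calc _ ≤ inter k (E ∩ D) (E ∩ D) + K * (volume (E ∩ D) * volume (E \ D)) +
        K * (volume (E \ D) * volume E) := by
        gcongr
        · exact inter_le_mul hk _ _
        · exact inter_le_mul hk _ _
    _ ≤ inter k (E ∩ D) (E ∩ D) + K * (volume E * volume (E \ D)) +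
        K * (volume (E \ D) * volume E) := by gcongr; exact inter_subset_left
    _ = _ := by ring

lemma excess_le_of_balance {c d ω τ a JB J SB S MB M N : ℝ≥0} (hc : 0 < c)
    (hd : d ≤ c * ω ^ 2) (hτ : 5 * c * (ω * τ) ≤ d) (ha : a + τ = ω)
    (hJ : JB ≤ J + 72 * c * (ω * τ) + d) (hJB : JB + c * SB = 36 * c * (ω * ω))
    (hJ' : J + c * S = 36 * c * (a * a)) (hSB : SB = 2 * (ω * MB)) (hS : S = 2 * (a * M))
    (hMB : MB ≤ ω) (hN : N + MB + a = M + ω) : c * ω * N ≤ 17 * d := by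
  subst hSB hS
  rw [← NNReal.coe_le_coe] at *
  rw [← NNReal.coe_inj] at ha hJB hJ' hN
  push_cast at *
  have hc' : (0 : ℝ) < c := hc
  have := a.2; have := τ.2; have := ω.2; have := MB.2; have := M.2; have := d.2
  have h1 : (2 * c * (a * M - ω * MB) : ℝ) ≤ d + 72 * c * (ω * τ) := by
    have : (c * (a * a) : ℝ) ≤ c * (ω * ω) := by gcongr <;> linarith
    nlinarith
  have h2 : (c * (τ * MB) : ℝ) ≤ c * (ω * τ) := by
    rw [mul_comm (τ : ℝ)]; gcongr
  have h3 : (2 * (c * a * (M - MB)) : ℝ) ≤ 16 * d := by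
    have : (ω : ℝ) = a + τ := ha.symm
    have e : (c * (a * M - ω * MB) : ℝ) = c * a * (M - MB) - c * (τ * MB) := by rw [this]; ring
    linarith
  have h4 : (N : ℝ) = M - MB + τ := by linarith
  rw [h4]
  have h5 : (c * ω * (M - MB) : ℝ) ≤ 16 * d := by
    rcases le_total (M : ℝ) MB with h | h
    · have : (c * ω * (M - MB) : ℝ) ≤ 0 :=
        mul_nonpos_of_nonneg_of_nonpos (by positivity) (by linarith)
      linarith
    · have hω2 : (ω : ℝ) ≤ 2 * a := by
        rcases eq_or_lt_of_le (show (0 : ℝ) ≤ ω from ω.2) with h0 | h0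
        · linarith
        · have : (c * ω * (5 * τ) : ℝ) ≤ c * ω * ω := by nlinarith
          have := le_of_mul_le_mul_left this (by positivity)
          linarith
      have : (c * ω * (M - MB) : ℝ) ≤ c * (2 * a) * (M - MB) := by
        have : (0 : ℝ) ≤ M - MB := by linarith
        gcongr
      linarith
  nlinarith

/-- The second moment of an almost minimal set exceeds that of the ball by at most a multiple
of the deficit. -/
lemma exists_excess_le {n : ℕ} (hn : 2 ≤ n) {s : ℝ} (hs : s ∈ Ioo (0 : ℝ) 1) :
    ∃ C d₀ : ℝ≥0∞, C ≠ ⊤ ∧ d₀ ≠ 0 ∧ d₀ ≠ ⊤ ∧ ∀ E : Set (Rn n), MeasurableSet E →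
      volume E = volume (ball (0 : Rn n) 1) → ∀ d ≤ d₀,
      inter (powKer (n + s)) E Eᶜ ≤
        inter (powKer (n + s)) (ball (0 : Rn n) 1) (ball 0 1)ᶜ + d →
      ∃ (b : Rn n) (D : Set (Rn n)), MeasurableSet D ∧ volume (E \ D) ≤ C * d ∧
        (∫⁻ x in (E ∩ D) \ ball b 1, ENNReal.ofReal (‖x - b‖ ^ 2 - 1)) +
          (∫⁻ x in ball b 1 \ (E ∩ D), ENNReal.ofReal (1 - ‖x - b‖ ^ 2)) ≤ C * d := by
  have hn2 : (2 : ℝ) ≤ n := by exact_mod_cast hn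
  set p := (n : ℝ) + s with hp
  obtain ⟨c, hc⟩ : ∃ c : ℝ≥0, (c : ℝ) = 6 ^ (-p - 2) := ⟨⟨_, by positivity⟩, rfl⟩
  have hc0 : 0 < c := by
    rw [← NNReal.coe_pos, hc]; positivity
  have hcE : ENNReal.ofReal (6 ^ (-p - 2)) = c := by rw [← hc, ENNReal.ofReal_coe_nnreal]
  have h5 : ENNReal.ofReal (5 * 6 ^ (-p - 2)) = 5 * c := by
    rw [ENNReal.ofReal_mul (by norm_num), hcE, ENNReal.ofReal_ofNat]
  have h36 : ENNReal.ofReal (36 * 6 ^ (-p - 2)) = 36 * c := by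
    rw [ENNReal.ofReal_mul (by norm_num), hcE, ENNReal.ofReal_ofNat]
  set ω := volume (ball (0 : Rn n) 1) with hω
  have hω0 : ω ≠ 0 := volume_ball_one_ne_zero n
  have hωt : ω ≠ ⊤ := measure_ball_lt_top.ne
  have hcω0 : c * ω ≠ 0 := mul_ne_zero (by simpa using hc0.ne') hω0
  have hcωt : c * ω ≠ ⊤ := by finiteness
  refine ⟨17 / (c * ω), c * ω ^ 2, ?_, ?_, by finiteness, fun E hE hvol d hd hPd => ?_⟩
  · exact ENNReal.div_ne_top (by simp) hcω0
  · exact mul_ne_zero (by simpa using hc0.ne') (pow_ne_zero _ hω0)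
  have hdt : d ≠ ⊤ := (hd.trans_lt (by finiteness)).ne
  obtain ⟨x₀, hx₀⟩ := exists_volume_diff_ball_three_le hn hs hE hvol hPd
  rw [← hp, h5] at hx₀
  set D := ball x₀ 3 with hD
  have hDm : MeasurableSet D := measurableSet_ball
  have hsub : E ∩ D ⊆ ball x₀ 3 := inter_subset_right
  obtain ⟨b, hb⟩ := exists_barycenter hsub
  set q : ℝ → ℝ≥0∞ := fun r => ENNReal.ofReal (quadKer p 0 r) with hq
  have hqm : Measurable q := (measurable_quadKer p 0).ennreal_ofReal
  have hq36 : ∀ r, q r ≤ 36 * c := fun r => by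
    rw [← h36]
    refine ENNReal.ofReal_le_ofReal ?_
    have := quadKer_le p (a := 0) (r := r) le_rfl (le_max_right _ _) (by norm_num)
    linarith
  have hfin := inter_powKer_ball_lt_top (n := n) (by omega) hs
  have hcmp := inter_ball_add_quadKer_le hn (p := p) (by linarith [hs.1]) (a := 0) (by norm_num)
    hE hvol
  have hself := inter_self_le hqm hq36 hE hDm
  have hJ : inter q (ball (0 : Rn n) 1) (ball 0 1) ≤
      inter q (E ∩ D) (E ∩ D) + 72 * c * (ω * volume (E \ D)) + d := by
    refine (ENNReal.add_le_add_iff_left hfin.ne).1 ?_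
    calc _ ≤ inter (powKer p) E Eᶜ + inter q E E := hcmp
      _ ≤ _ := add_le_add hPd hself
      _ = _ := by rw [hvol]; ring
  have hB3 : ball (0 : Rn n) 1 ⊆ ball 0 3 := ball_subset_ball (by norm_num)
  have hJB := inter_quadKer_add p measurableSet_ball hB3
  have hJ' := inter_quadKer_add p (hE.inter hDm) hsub
  have hSB := inter_sq_self hB3 (integral_ball_zero_eq_zero n 1)
  have hS := inter_sq_self hsub hb
  have hN := lintegral_excess_add (hE.inter hDm) b
  have ha := measure_inter_add_sdiff (μ := volume) E hDm
  rw [hcE, h36, ← hω] at hJB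
  rw [hcE, h36] at hJ'
  rw [hvol] at ha
  rw [volume_ball_eq b zero_le_one (by omega), one_pow, ENNReal.ofReal_one, one_mul] at hN
  simp only [sub_zero] at hSB
  have hMB : ∫⁻ x in ball (0 : Rn n) 1, ENNReal.ofReal (‖x‖ ^ 2) ≤ ω := by
    rw [hω, ← setLIntegral_one]
    refine setLIntegral_mono' measurableSet_ball fun x hx => ?_
    rw [← ENNReal.ofReal_one]
    refine ENNReal.ofReal_le_ofReal ?_
    have := mem_ball_zero_iff.1 hx
    have := norm_nonneg x
    nlinarith
  rw [← hω] at hN hSB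
  have key : ∀ N τ a JB J SB S MB M : ℝ≥0∞, 5 * c * (ω * τ) ≤ d → a + τ = ω →
      JB ≤ J + 72 * c * (ω * τ) + d → JB + c * SB = 36 * c * (ω * ω) →
      J + c * S = 36 * c * (a * a) → SB = 2 * (ω * MB) → S = 2 * (a * M) →
      MB ≤ ω → M ≠ ⊤ → N + MB + a = M + ω → c * ω * N ≤ 17 * d := by
    intro N τ a JB J SB S MB M hτ ha hJ hJB hJ' hSB hS hMB hM hN
    have t36 : (36 : ℝ≥0∞) * c * (ω * ω) ≠ ⊤ := by finiteness
    have hat : a ≠ ⊤ := by rintro rfl; simp at ha; exact hωt ha.symm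
    have hτt : τ ≠ ⊤ := by rintro rfl; simp at ha; exact hωt ha.symm
    have hMBt : MB ≠ ⊤ := (hMB.trans_lt hωt.lt_top).ne
    have hNt : N ≠ ⊤ := by
      rintro rfl
      simp only [top_add] at hN
      exact (ENNReal.add_ne_top.2 ⟨hM, hωt⟩) hN.symm
    have hJBt : JB ≠ ⊤ := by
      rintro rfl
      simp only [top_add] at hJB
      exact t36 hJB.symm
    have hJt : J ≠ ⊤ := by
      rintro rfl
      simp only [top_add] at hJ'
      have : (36 : ℝ≥0∞) * c * (a * a) ≠ ⊤ := by finiteness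
      exact this hJ'.symm
    subst hSB hS
    clear_value ω
    lift ω to ℝ≥0 using hωt
    lift d to ℝ≥0 using hdt
    lift a to ℝ≥0 using hat
    lift τ to ℝ≥0 using hτt
    lift MB to ℝ≥0 using hMBt
    lift N to ℝ≥0 using hNt
    lift JB to ℝ≥0 using hJBt
    lift J to ℝ≥0 using hJt
    lift M to ℝ≥0 using hM
    exact_mod_cast excess_le_of_balance (SB := 2 * (ω * MB)) (S := 2 * (a * M)) hc0
      (by exact_mod_cast hd) (by exact_mod_cast hτ) (by exact_mod_cast ha) (by exact_mod_cast hJ)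
      (by exact_mod_cast hJB) (by exact_mod_cast hJ') rfl rfl (by exact_mod_cast hMB)
      (by exact_mod_cast hN)
  have hM : ∫⁻ x in E ∩ D, ENNReal.ofReal (‖x - b‖ ^ 2) ≠ ⊤ := by
    rw [← ofReal_integral_eq_lintegral_ofReal
      (integrableOn_of_subset_ball hsub (f := fun x => ‖x - b‖ ^ 2) (by fun_prop))
      (ae_of_all _ fun y => by positivity)]
    exact ENNReal.ofReal_ne_top
  have hfinal := key _ _ _ _ _ _ _ _ _ hx₀ ha hJ hJB hJ' hSB hS hMB hM hN
  have hdiv : ∀ {N : ℝ≥0∞}, c * ω * N ≤ 17 * d → N ≤ 17 / (c * ω) * d := fun {N} h => by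
    rw [ENNReal.mul_div_right_comm.symm]
    rw [ENNReal.le_div_iff_mul_le (Or.inl hcω0) (Or.inl hcωt), mul_comm]
    exact h
  refine ⟨b, D, hDm, hdiv ?_, hdiv hfinal⟩
  calc c * ω * volume (E \ D) ≤ 5 * c * (ω * volume (E \ D)) := by
        rw [mul_assoc, mul_assoc]
        exact le_mul_of_one_le_left' (by norm_num)
    _ ≤ 1 * d := by rw [one_mul]; exact hx₀
    _ ≤ 17 * d := by gcongr; norm_num

lemma rieszAt_ball {n : ℕ} (s : ℝ) (b : Rn n) :
    rieszAt n s (ball b 1) b = rieszAt n s (ball 0 1) 0 := by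
  unfold rieszAt
  rw [lintegral_ball_comp_sub (fun x => ENNReal.ofReal (‖x‖ ^ (-s)))]
  simp only [sub_zero]

lemma norm_sub_lt_of_mem_ball {n : ℕ} {b x : Rn n} {r : ℝ} (h : x ∈ ball b r) : ‖x - b‖ < r := by
  rwa [mem_ball, dist_eq_norm] at h

lemma le_norm_sub_of_notMem_ball {n : ℕ} {b x : Rn n} {r : ℝ} (h : x ∉ ball b r) :
    r ≤ ‖x - b‖ := by
  rwa [mem_ball, not_lt, dist_eq_norm] at h

/-- The potential of the ball exceeds that of an almost minimal set by at most a multiple of the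
deficit. -/
lemma exists_rieszAt_ball_le {n : ℕ} (hn : 2 ≤ n) {s : ℝ} (hs : s ∈ Ioo (0 : ℝ) 1) :
    ∃ C d₀ : ℝ≥0∞, C ≠ ⊤ ∧ d₀ ≠ 0 ∧ ∀ E : Set (Rn n), MeasurableSet E →
      volume E = volume (ball (0 : Rn n) 1) → ∀ d ≤ d₀,
      inter (powKer (n + s)) E Eᶜ ≤
        inter (powKer (n + s)) (ball (0 : Rn n) 1) (ball 0 1)ᶜ + d →
      ∃ b : Rn n, (∫⁻ x in ball b 1 \ E, ENNReal.ofReal (1 - ‖x - b‖ ^ 2)) ≤ C * d ∧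
        rieszAt n s (ball 0 1) 0 ≤ rieszAt n s E b + C * d := by
  obtain ⟨C₁, d₀, hC₁, hd₀, -, hex⟩ := exists_excess_le hn hs
  obtain ⟨C₂, hC₂, hhole⟩ := exists_lintegral_hole_le hn hs
  set K := ENNReal.ofReal C₂ with hK
  refine ⟨K * (1 + 2 * C₁) + 6 * C₁, d₀, by finiteness, hd₀, fun E hE hvol d hd hPd => ?_⟩
  obtain ⟨b, D, hD, hτ, hN⟩ := hex E hE hvol d hd hPd
  obtain ⟨ρ, hρ, hh⟩ := hhole E hE hvol d hPd b
  set B := ball b 1 with hB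
  have hBm : MeasurableSet B := measurableSet_ball
  set f : Rn n → ℝ≥0∞ := fun x => ENNReal.ofReal (‖x - b‖ ^ (-s)) with hf
  set g : Rn n → ℝ≥0∞ := fun x => ENNReal.ofReal (1 - ‖x - b‖ ^ 2) with hg
  have hgm : Measurable g := by fun_prop
  have hfm : Measurable f := by fun_prop
  have hin : ∫⁻ x in B \ E, g x ≤ C₁ * d :=
    (lintegral_mono_set (sdiff_subset_sdiff_right inter_subset_left)).trans
      (le_add_self.trans hN)
  have hout : ∫⁻ x in (E ∩ D) \ B, ENNReal.ofReal (‖x - b‖ ^ 2 - 1) ≤ C₁ * d :=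
    le_self_add.trans hN
  have hm : volume (ball b (1 / 2) \ E) ≤ 2 * (C₁ * d) := by
    calc volume (ball b (1 / 2) \ E) = ∫⁻ x in ball b (1 / 2) \ E, 1 := setLIntegral_one _ |>.symm
      _ ≤ ∫⁻ x in ball b (1 / 2) \ E, 2 * g x := by
          refine setLIntegral_mono' (measurableSet_ball.diff hE) fun x hx => ?_
          have h1 := norm_sub_lt_of_mem_ball hx.1
          have h0 := norm_nonneg (x - b)
          rw [← ENNReal.ofReal_one, ← ENNReal.ofReal_ofNat 2, ← ENNReal.ofReal_mul (by norm_num)]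
          exact ENNReal.ofReal_le_ofReal (by nlinarith)
      _ ≤ ∫⁻ x in B \ E, 2 * g x :=
          lintegral_mono_set (sdiff_subset_sdiff_left (ball_subset_ball (by norm_num)))
      _ ≤ 2 * (C₁ * d) := by rw [lintegral_const_mul _ hgm]; gcongr
  have hfar : ∫⁻ x in (B \ E) \ ball b ρ, f x ≤ volume (B \ E) + 4 * (C₁ * d) := by
    calc _ ≤ ∫⁻ x in (B \ E) \ ball b ρ, (1 + 4 * g x) := by
          refine setLIntegral_mono' ((hBm.diff hE).diff measurableSet_ball) fun x hx => ?_
          have h1 := norm_sub_lt_of_mem_ball hx.1.1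
          have h2 := le_norm_sub_of_notMem_ball hx.2
          have h3 : (1 / 4 : ℝ) < ‖x - b‖ := hρ.1.trans_le h2
          simp only [hf, hg]
          rw [← ENNReal.ofReal_one, ← ENNReal.ofReal_ofNat 4, ← ENNReal.ofReal_mul (by norm_num),
            ← ENNReal.ofReal_add (by norm_num) (by nlinarith)]
          refine ENNReal.ofReal_le_ofReal ?_
          have h4 : ‖x - b‖ ^ (-s) ≤ ‖x - b‖ ^ (-1 : ℝ) :=
            Real.rpow_le_rpow_of_exponent_ge (by linarith) h1.le (by linarith [hs.2])
          refine h4.trans ?_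
          rw [Real.rpow_neg_one, inv_le_iff_one_le_mul₀ (by linarith)]
          nlinarith [mul_pos (sub_pos.2 h3) (sub_pos.2 h1)]
      _ ≤ ∫⁻ x in B \ E, (1 + 4 * g x) := lintegral_mono_set sdiff_subset
      _ = volume (B \ E) + 4 * ∫⁻ x in B \ E, g x := by
          rw [lintegral_add_left measurable_const, setLIntegral_one, lintegral_const_mul _ hgm]
      _ ≤ _ := by gcongr
  have hvolB : volume (B \ E) = volume (E \ B) := by
    have hB' : volume B = volume (ball (0 : Rn n) 1) := by
      rw [hB, volume_ball_eq b zero_le_one (by omega), one_pow, ENNReal.ofReal_one, one_mul]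
    exact volume_sdiff_eq_sdiff hBm hE (hB'.trans hvol.symm)
      (hvol.trans_ne measure_ball_lt_top.ne)
  have hEB : volume (E \ B) ≤ (∫⁻ x in E \ B, f x) + C₁ * d + C₁ * d := by
    have hsub : E \ B ⊆ (E ∩ D) \ B ∪ E \ D := fun x hx => by
      by_cases h : x ∈ D
      · exact Or.inl ⟨⟨hx.1, h⟩, hx.2⟩
      · exact Or.inr ⟨hx.1, h⟩
    refine (measure_mono hsub).trans ((measure_union_le _ _).trans (add_le_add ?_ hτ))
    calc volume ((E ∩ D) \ B) = ∫⁻ x in (E ∩ D) \ B, 1 := setLIntegral_one _ |>.symm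
      _ ≤ ∫⁻ x in (E ∩ D) \ B, (f x + ENNReal.ofReal (‖x - b‖ ^ 2 - 1)) := by
          refine setLIntegral_mono' ((hE.inter hD).diff hBm) fun x hx => ?_
          have h1 := le_norm_sub_of_notMem_ball hx.2
          simp only [hf]
          rw [← ENNReal.ofReal_one, ← ENNReal.ofReal_add (by positivity) (by nlinarith)]
          refine ENNReal.ofReal_le_ofReal ?_
          have h4 : ‖x - b‖ ^ (-1 : ℝ) ≤ ‖x - b‖ ^ (-s) :=
            Real.rpow_le_rpow_of_exponent_le h1 (by linarith [hs.2])
          have h5 : 2 - ‖x - b‖ ≤ ‖x - b‖ ^ (-1 : ℝ) := by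
            rw [Real.rpow_neg_one, ← one_div, le_div_iff₀ (by linarith)]
            nlinarith [sq_nonneg (‖x - b‖ - 1)]
          nlinarith
      _ = (∫⁻ x in (E ∩ D) \ B, f x) + ∫⁻ x in (E ∩ D) \ B, ENNReal.ofReal (‖x - b‖ ^ 2 - 1) :=
          lintegral_add_left hfm _
      _ ≤ _ := add_le_add
          (lintegral_mono_set (sdiff_subset_sdiff_left inter_subset_left)) hout
  have hBE : ∫⁻ x in B \ E, f x ≤
      (∫⁻ x in E \ B, f x) + (K * (1 + 2 * C₁) + 6 * C₁) * d := by
    have hsub : B \ E ⊆ ball b ρ \ E ∪ (B \ E) \ ball b ρ := fun x hx => by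
      by_cases h : x ∈ ball b ρ
      · exact Or.inl ⟨h, hx.2⟩
      · exact Or.inr ⟨hx, h⟩
    calc _ ≤ (∫⁻ x in ball b ρ \ E, f x) + ∫⁻ x in (B \ E) \ ball b ρ, f x :=
          (lintegral_mono_set hsub).trans (lintegral_union_le _ _ _)
      _ ≤ K * (d + 2 * (C₁ * d)) + ((∫⁻ x in E \ B, f x) + C₁ * d + C₁ * d + 4 * (C₁ * d)) :=
          add_le_add (hh.trans (by gcongr)) (hfar.trans (by rw [hvolB]; gcongr))
      _ = _ := by ring
  refine ⟨b, hin.trans ?_, ?_⟩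
  · gcongr
    calc C₁ = 1 * C₁ := (one_mul _).symm
      _ ≤ 6 * C₁ := by gcongr; norm_num
      _ ≤ _ := le_add_self
  · rw [← rieszAt_ball s b]
    unfold rieszAt
    rw [← lintegral_inter_add_sdiff _ B hE, ← lintegral_inter_add_sdiff _ E hBm, add_assoc,
      Set.inter_comm B E]
    gcongr

lemma rieszAt_le_ball {n : ℕ} (hn : 1 ≤ n) {s : ℝ} (hs : 0 ≤ s) {E : Set (Rn n)}
    (hE : MeasurableSet E) (hvol : volume E = volume (ball (0 : Rn n) 1)) (y : Rn n) :
    rieszAt n s E y ≤ rieszAt n s (ball 0 1) 0 := by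
  have : NeZero n := ⟨by omega⟩
  rw [← rieszAt_ball s y]
  set B := ball y 1 with hB
  have hBm : MeasurableSet B := measurableSet_ball
  have hvolB : volume (E \ B) = volume (B \ E) := by
    have hB' : volume B = volume (ball (0 : Rn n) 1) := by
      rw [hB, volume_ball_eq y zero_le_one hn, one_pow, ENNReal.ofReal_one, one_mul]
    exact volume_sdiff_eq_sdiff hE hBm (hvol.trans hB'.symm)
      (hB'.trans_ne measure_ball_lt_top.ne)
  unfold rieszAt
  rw [← lintegral_inter_add_sdiff _ B hE, ← lintegral_inter_add_sdiff _ E hBm,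
    Set.inter_comm B E]
  gcongr 1
  calc ∫⁻ x in E \ B, ENNReal.ofReal (‖x - y‖ ^ (-s)) ≤ ∫⁻ x in E \ B, 1 := by
        refine setLIntegral_mono' (hE.diff hBm) fun x hx => ?_
        rw [← ENNReal.ofReal_one]
        exact ENNReal.ofReal_le_ofReal (Real.rpow_le_one_of_one_le_of_nonpos
          (le_norm_sub_of_notMem_ball hx.2) (by linarith))
    _ = ∫⁻ x in B \ E, 1 := by rw [setLIntegral_one, setLIntegral_one, hvolB]
    _ ≤ ∫⁻ x in B \ E, ENNReal.ofReal (‖x - y‖ ^ (-s)) := by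
        refine lintegral_mono_ae ((ae_restrict_iff' (hBm.diff hE)).2 ?_)
        filter_upwards [compl_mem_ae_iff.2 (measure_singleton y)] with x hxy hx
        rw [← ENNReal.ofReal_one]
        exact ENNReal.ofReal_le_ofReal (Real.one_le_rpow_of_pos_of_le_one_of_nonpos
          (norm_pos_iff.2 (sub_ne_zero.2 hxy)) (norm_sub_lt_of_mem_ball hx.1).le (by linarith))

lemma Vs_le_ball {n : ℕ} (hn : 1 ≤ n) {s : ℝ} (hs : 0 ≤ s) {E : Set (Rn n)}
    (hE : MeasurableSet E) (hvol : volume E = volume (ball (0 : Rn n) 1)) :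
    Vs n s E ≤ rieszAt n s (ball 0 1) 0 :=
  iSup_le (rieszAt_le_ball hn hs hE hvol)

lemma Vs_ball {n : ℕ} (hn : 1 ≤ n) {s : ℝ} (hs : 0 ≤ s) :
    Vs n s (ball 0 1) = rieszAt n s (ball 0 1) 0 :=
  (Vs_le_ball hn hs measurableSet_ball rfl).antisymm (le_iSup (rieszAt n s (ball 0 1)) 0)

lemma fracPer_ball_le {n : ℕ} (hn : 2 ≤ n) {s : ℝ} (hs : s ∈ Ioo (0 : ℝ) 1) {E : Set (Rn n)}
    (hE : MeasurableSet E) (hvol : volume E = volume (ball (0 : Rn n) 1)) :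
    fracPer n s (ball 0 1) ≤ fracPer n s E := by
  rw [fracPer_eq_inter n s measurableSet_ball, fracPer_eq_inter n s hE]
  exact inter_ball_le hn (measurable_powKer _)
    (fun r t _ h => powKer_anti (by have := hs.1; positivity) h) one_pos hE hvol

/-- The loss of potential is controlled by the deficit, with no smallness assumption. -/
lemma exists_rieszAt_ball_le_Vs_add {n : ℕ} (hn : 2 ≤ n) {s : ℝ} (hs : s ∈ Ioo (0 : ℝ) 1) :
    ∃ C : ℝ≥0∞, C ≠ ⊤ ∧ ∀ E : Set (Rn n), MeasurableSet E →
      volume E = volume (ball (0 : Rn n) 1) → ∀ d,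
      fracPer n s E ≤ fracPer n s (ball 0 1) + d →
        rieszAt n s (ball 0 1) 0 ≤ Vs n s E + C * d := by
  have hn2 : (2 : ℝ) ≤ n := by exact_mod_cast hn
  obtain ⟨C, d₀, hC, hd₀, h⟩ := exists_rieszAt_ball_le hn hs
  have hV : rieszAt n s (ball (0 : Rn n) 1) 0 ≠ ⊤ := by
    have := lintegral_ball_rpow_lt_top (n := n) (by omega) (q := s) (by linarith [hs.2]) 1
    simpa [rieszAt] using this.ne
  have hCt : rieszAt n s (ball (0 : Rn n) 1) 0 / d₀ ≠ ⊤ := ENNReal.div_ne_top hV hd₀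
  refine ⟨C + rieszAt n s (ball 0 1) 0 / d₀, by finiteness, fun E hE hvol d hd => ?_⟩
  rw [add_mul]
  rcases le_or_gt d d₀ with hdd | hdd
  · rw [fracPer_eq_inter n s hE, fracPer_eq_inter n s measurableSet_ball] at hd
    obtain ⟨b, -, hb⟩ := h E hE hvol d hdd hd
    exact hb.trans (add_le_add (le_iSup (rieszAt n s E) b) le_self_add)
  · calc rieszAt n s (ball (0 : Rn n) 1) 0 = rieszAt n s (ball 0 1) 0 / d₀ * d₀ :=
          (ENNReal.div_mul_cancel hd₀ (hdd.trans_le le_top).ne).symm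
      _ ≤ rieszAt n s (ball 0 1) 0 / d₀ * d := by gcongr
      _ ≤ _ := le_add_self.trans le_add_self

/-- The ball is the only minimizer of the fractional perimeter. -/
lemma exists_volume_symmDiff_ball_eq_zero {n : ℕ} (hn : 2 ≤ n) {s : ℝ} (hs : s ∈ Ioo (0 : ℝ) 1)
    {E : Set (Rn n)} (hE : MeasurableSet E) (hvol : volume E = volume (ball (0 : Rn n) 1))
    (h : fracPer n s E ≤ fracPer n s (ball 0 1)) : ∃ x : Rn n, volume (E ∆ ball x 1) = 0 := by
  obtain ⟨C, d₀, -, -, hb⟩ := exists_rieszAt_ball_le hn hs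
  rw [fracPer_eq_inter n s hE, fracPer_eq_inter n s measurableSet_ball] at h
  obtain ⟨b, hb, -⟩ := hb E hE hvol 0 zero_le (by rwa [add_zero])
  rw [mul_zero, nonpos_iff_eq_zero, lintegral_eq_zero_iff (by fun_prop)] at hb
  have h0 : volume (ball b 1 \ E) = 0 := by
    have := (ae_restrict_iff' (measurableSet_ball.diff hE)).1 hb
    refine measure_mono_null (fun x hx => ?_) (ae_iff.1 this)
    rw [mem_ofPred_eq]
    intro hx'
    have h1 := norm_sub_lt_of_mem_ball hx.1
    have h2 := ENNReal.ofReal_eq_zero.1 (hx' hx)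
    nlinarith [norm_nonneg (x - b)]
  have hB' : volume (ball b 1) = volume (ball (0 : Rn n) 1) := by
    rw [volume_ball_eq b zero_le_one (by omega), one_pow, ENNReal.ofReal_one, one_mul]
  have h1 : volume (E \ ball b 1) = 0 :=
    (volume_sdiff_eq_sdiff hE measurableSet_ball (hvol.trans hB'.symm)
      measure_ball_lt_top.ne).trans h0
  refine ⟨b, ?_⟩
  rw [symmDiff_def]
  exact measure_union_null h1 h0

/-- **Rigidity of the ball.** There is `ε₁ > 0` such that for every `ε < ε₁` the unit ball `B₁`
is the unique minimizer (up to translation and sets of measure zero) of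
`min { P_s(E) + ε V_s(E) : E ⊆ ℝⁿ measurable, |E| = ω_n }`. -/
theorem stmt_17 (n : ℕ) (hn : 2 ≤ n) (s : ℝ) (hs : s ∈ Set.Ioo (0 : ℝ) 1) :
    ∃ ε₁ : ℝ, 0 < ε₁ ∧ ∀ ε : ℝ, 0 < ε → ε < ε₁ →
      IsEnergyMin n s ε (ball (0 : Rn n) 1) ∧
      ∀ E : Set (Rn n), IsEnergyMin n s ε E →
        ∃ x : Rn n, volume (E ∆ ball x 1) = 0 := by
  obtain ⟨C, hC, hgap⟩ := exists_rieszAt_ball_le_Vs_add hn hs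
  have hn1 : 1 ≤ n := by omega
  have hVB := Vs_ball hn1 hs.1.le
  refine ⟨1 / (C.toReal + 1), by positivity, fun ε hε hε₁ => ?_⟩
  have hεC : ENNReal.ofReal ε * C < 1 := by
    rw [lt_div_iff₀ (by positivity)] at hε₁
    rw [← ENNReal.ofReal_toReal hC, ← ENNReal.ofReal_mul hε.le, ENNReal.ofReal_lt_one]
    linarith
  have hloss : ∀ E : Set (Rn n), MeasurableSet E → volume E = volume (ball (0 : Rn n) 1) →
      ∀ d, fracPer n s E ≤ fracPer n s (ball 0 1) + d →
      ENNReal.ofReal ε * Vs n s (ball 0 1) ≤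
        ENNReal.ofReal ε * Vs n s E + ENNReal.ofReal ε * C * d := by
    intro E hE hvol d hd
    rw [hVB, mul_assoc, ← mul_add]
    gcongr
    exact hgap E hE hvol d hd
  have hPB : fracPer n s (ball 0 1) ≠ ⊤ := by
    rw [fracPer_eq_inter n s measurableSet_ball]
    exact (inter_powKer_ball_lt_top hn1 hs).ne
  refine ⟨⟨measurableSet_ball, rfl, fun F hF hvol => ?_⟩, fun E ⟨hE, hvol, hmin⟩ => ?_⟩
  · obtain ⟨d, hd⟩ := exists_add_of_le (fracPer_ball_le hn hs hF hvol)
    unfold energy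
    rw [hd, add_right_comm, add_assoc]
    gcongr
    calc _ ≤ ENNReal.ofReal ε * Vs n s F + ENNReal.ofReal ε * C * d := hloss F hF hvol d hd.le
      _ ≤ ENNReal.ofReal ε * Vs n s F + 1 * d := by gcongr
      _ = _ := by rw [one_mul]
  · obtain ⟨d, hd⟩ := exists_add_of_le (fracPer_ball_le hn hs hE hvol)
    have hV : Vs n s (ball (0 : Rn n) 1) ≠ ⊤ := by
      rw [hVB]
      have hsn : s < n := hs.2.trans_le (by exact_mod_cast hn1)
      simpa [rieszAt] using (lintegral_ball_rpow_lt_top hn1 hsn 1).ne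
    have hVE : Vs n s E ≠ ⊤ :=
      ne_top_of_le_ne_top hV ((Vs_le_ball hn1 hs.1.le hE hvol).trans_eq hVB.symm)
    have hEB := hmin (ball 0 1) measurableSet_ball rfl
    unfold energy at hEB
    have hd1 : d ≤ ENNReal.ofReal ε * C * d := by
      rw [hd, add_assoc, ENNReal.add_le_add_iff_left hPB] at hEB
      refine (ENNReal.add_le_add_iff_right
        (ENNReal.mul_ne_top (ENNReal.ofReal_ne_top (r := ε)) hVE)).1 ?_
      exact (hEB.trans (hloss E hE hvol d hd.le)).trans_eq (add_comm _ _)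
    have hdt : d ≠ ⊤ := by
      rintro rfl
      rw [hd, add_top, top_add, top_le_iff] at hEB
      exact (by finiteness : fracPer n s (ball (0 : Rn n) 1) +
        ENNReal.ofReal ε * Vs n s (ball 0 1) ≠ ⊤) hEB
    have hd0 : d = 0 := by
      by_contra h0
      have := ENNReal.mul_lt_mul_left h0 hdt hεC
      rw [one_mul] at this
      exact absurd hd1 (not_le.2 this)
    exact exists_volume_symmDiff_ball_eq_zero hn hs hE hvol (by rw [hd, hd0, add_zero])
end
end

section
/- Let n ≥ 2 and s ∈ (0,1). There exists a constant C = C(n,s) > 0 such that the following holds: if E ⊂ ℝⁿ is a nearly spherical set, i.e. a set with |E| = ω_n, barycenter at the origin (∫_E x dx = 0), and boundary ∂E = { (1 + φ(x)) x : x ∈ ∂B₁ } for a function φ : ∂B₁ → ℝ with ‖φ‖_{C¹(∂B₁)} < 1/2, then V_s(B₁) − V_s(E) ≤ C ‖φ‖²_{L²(∂B₁)}. -/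
open MeasureTheory Metric Set Filter
open scoped ENNReal NNReal symmDiff Topology

noncomputable section

/-- Comparison of the integrals of `g` over two sets of equal measure, when `g` is at most `1 + h`
on one difference and at least `1 - h` on the other. -/
lemma setLIntegral_le_add_symmDiff {α : Type*} [MeasurableSpace α] {μ : Measure α} {A B : Set α}
    (hA : MeasurableSet A) (hB : MeasurableSet B) (hAB : μ A = μ B) (hfin : μ A ≠ ∞)
    {g h : α → ℝ≥0∞} (hg : Measurable g) (hh : Measurable h)
    (h₁ : ∀ᵐ x ∂μ, x ∈ A \ B → g x ≤ 1 + h x) (h₂ : ∀ᵐ x ∂μ, x ∈ B \ A → 1 ≤ g x + h x) :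
    ∫⁻ x in A, g x ∂μ ≤ ∫⁻ x in B, g x ∂μ + ∫⁻ x in A ∆ B, h x ∂μ := by
  have hdiff : μ (A \ B) = μ (B \ A) :=
    measure_sdiff_symm hA.nullMeasurableSet hB.nullMeasurableSet hAB
      (measure_ne_top_of_subset inter_subset_left hfin)
  have e₁ : ∫⁻ x in A \ B, g x ∂μ ≤ μ (A \ B) + ∫⁻ x in A \ B, h x ∂μ := by
    calc ∫⁻ x in A \ B, g x ∂μ ≤ ∫⁻ x in A \ B, (1 + h x) ∂μ :=
          setLIntegral_mono_ae (by fun_prop) h₁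
      _ = _ := by rw [lintegral_add_right _ hh]; simp
  have e₂ : μ (B \ A) ≤ ∫⁻ x in B \ A, g x ∂μ + ∫⁻ x in B \ A, h x ∂μ := by
    calc μ (B \ A) = ∫⁻ x in B \ A, 1 ∂μ := by simp
      _ ≤ ∫⁻ x in B \ A, (g x + h x) ∂μ := setLIntegral_mono_ae (by fun_prop) h₂
      _ = _ := lintegral_add_right _ hh
  have e₃ : ∫⁻ x in A ∆ B, h x ∂μ = ∫⁻ x in A \ B, h x ∂μ + ∫⁻ x in B \ A, h x ∂μ :=
    lintegral_union (hB.diff hA) disjoint_sdiff_sdiff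
  rw [← lintegral_inter_add_sdiff g A hB, ← lintegral_inter_add_sdiff g B hA, e₃, inter_comm B A]
  calc _ ≤ ∫⁻ x in A ∩ B, g x ∂μ + (μ (B \ A) + ∫⁻ x in A \ B, h x ∂μ) := by
        rw [← hdiff]; gcongr
    _ ≤ ∫⁻ x in A ∩ B, g x ∂μ + ((∫⁻ x in B \ A, g x ∂μ + ∫⁻ x in B \ A, h x ∂μ) +
        ∫⁻ x in A \ B, h x ∂μ) := by gcongr
    _ = _ := by ring

/-- Integration in polar coordinates for functions with values in `ℝ≥0∞`. -/
lemma lintegral_eq_lintegral_toSphere {V : Type*} [NormedAddCommGroup V] [NormedSpace ℝ V]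
    [MeasurableSpace V] [BorelSpace V] [FiniteDimensional ℝ V] [Nontrivial V] (μ : Measure V)
    [μ.IsAddHaarMeasure] {f : V → ℝ≥0∞} (hf : Measurable f) :
    ∫⁻ x, f x ∂μ = ∫⁻ θ : sphere (0 : V) 1, (∫⁻ r in Ioi (0 : ℝ),
      ENNReal.ofReal (r ^ (Module.finrank ℝ V - 1)) * f (r • (θ : V))) ∂μ.toSphere := by
  have hm : Measurable fun p : sphere (0 : V) 1 × Ioi (0 : ℝ) => f ((p.2 : ℝ) • (p.1 : V)) := by
    fun_prop
  calc ∫⁻ x, f x ∂μ = ∫⁻ x : ({(0)}ᶜ : Set V), f x ∂(μ.comap (↑)) := by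
        rw [lintegral_subtype_comap (measurableSet_singleton _).compl, restrict_compl_singleton]
    _ = ∫⁻ p : sphere (0 : V) 1 × Ioi (0 : ℝ), f ((p.2 : ℝ) • (p.1 : V))
          ∂(μ.toSphere.prod (.volumeIoiPow (Module.finrank ℝ V - 1))) := by
        rw [← μ.measurePreserving_homeomorphUnitSphereProd.lintegral_comp hm]
        refine lintegral_congr fun x => ?_
        have hx : ‖(x : V)‖ ≠ 0 := norm_ne_zero_iff.2 x.2
        simp [smul_smul, hx]
    _ = _ := by
        rw [lintegral_prod _ hm.aemeasurable]
        refine lintegral_congr fun θ => ?_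
        rw [Measure.volumeIoiPow, lintegral_withDensity_eq_lintegral_mul _ (by fun_prop)
          (by fun_prop)]
        exact lintegral_subtype_comap measurableSet_Ioi
          fun r => ENNReal.ofReal (r ^ (Module.finrank ℝ V - 1)) * f (r • (θ : V))

lemma abs_rpow_neg_sub_one_le {s r : ℝ} (hs₀ : 0 < s) (hs₁ : s < 1) (hr : 1 / 2 ≤ r) :
    |r ^ (-s) - 1| ≤ 2 * |r - 1| := by
  have hr₀ : 0 < r := by linarith
  have hinv : |r ^ (-1 : ℝ) - 1| ≤ 2 * |r - 1| := by
    rw [Real.rpow_neg_one, show r⁻¹ - 1 = r⁻¹ * (1 - r) by field_simp, abs_mul, abs_sub_comm 1 r,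
      abs_of_pos (inv_pos.2 hr₀)]
    gcongr
    rw [inv_le_comm₀ hr₀ two_pos]
    linarith
  refine le_trans ?_ hinv
  rcases le_total r 1 with h | h
  · have h₁ : r ^ (-s) ≤ r ^ (-1 : ℝ) := Real.rpow_le_rpow_of_exponent_ge hr₀ h (by linarith)
    have h₂ : 1 ≤ r ^ (-s) := Real.one_le_rpow_of_pos_of_le_one_of_nonpos hr₀ h (by linarith)
    rw [abs_of_nonneg (by linarith), abs_of_nonneg (by linarith)]
    linarith
  · have h₁ : r ^ (-1 : ℝ) ≤ r ^ (-s) := Real.rpow_le_rpow_of_exponent_le h (by linarith)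
    have h₂ : r ^ (-s) ≤ 1 := Real.rpow_le_one_of_one_le_of_nonpos h (by linarith)
    rw [abs_of_nonpos (by linarith), abs_of_nonpos (by linarith)]
    linarith

/-- The unit ball centered at the origin maximizes the Riesz potential at any point among the sets
of the same volume. -/
lemma rieszAt_le_rieszAt_ball {n : ℕ} (hn : n ≠ 0) {s : ℝ} (hs : 0 < s) {F : Set (Rn n)}
    (hF : MeasurableSet F) (hvol : volume F = volume (ball (0 : Rn n) 1)) (y : Rn n) :
    rieszAt n s F y ≤ rieszAt n s (ball 0 1) 0 := by
  have : Nonempty (Fin n) := ⟨⟨0, Nat.pos_of_ne_zero hn⟩⟩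
  set F' : Set (Rn n) := (fun x => x + y) ⁻¹' F
  have hF' : MeasurableSet F' := hF.preimage (measurable_add_const y)
  have hvol' : volume F' = volume (ball (0 : Rn n) 1) := by
    rw [← hvol]; exact measure_preimage_add_right volume y F
  have htrans : rieszAt n s F y = ∫⁻ x in F', ENNReal.ofReal (‖x‖ ^ (-s)) := by
    rw [rieszAt, ← (measurePreserving_add_right volume y).setLIntegral_comp_preimage hF
      (by fun_prop)]
    simp [F']
  have h := setLIntegral_le_add_symmDiff (μ := (volume : Measure (Rn n))) hF' measurableSet_ball
    hvol' (hvol' ▸ measure_ball_lt_top.ne) (g := fun x => ENNReal.ofReal (‖x‖ ^ (-s)))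
    (h := fun _ => 0) (by fun_prop) measurable_const
    (.of_forall fun x hx => by
      have hx1 : 1 ≤ ‖x‖ := by simpa using hx.2
      simpa using Real.rpow_le_one_of_one_le_of_nonpos hx1 (by linarith))
    (by
      filter_upwards [compl_mem_ae_iff.2 (measure_singleton (μ := volume) (0 : Rn n))] with x h0 hx
      have hx1 : ‖x‖ < 1 := by simpa using hx.1
      simpa using Real.one_le_rpow_of_pos_of_le_one_of_nonpos (norm_pos_iff.2 h0) hx1.le
        (by linarith))
  rw [htrans]
  simpa [rieszAt] using h

lemma Vs_ball_eq {n : ℕ} (hn : n ≠ 0) {s : ℝ} (hs : 0 < s) :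
    Vs n s (ball 0 1) = rieszAt n s (ball 0 1) 0 :=
  le_antisymm (iSup_le fun y => rieszAt_le_rieszAt_ball hn hs measurableSet_ball rfl y)
    (le_iSup (rieszAt n s (ball 0 1)) 0)

/-- A set of finite positive measure, whose boundary is a radial graph over the unit sphere, differs
from the unit ball only in the region between the graph and the sphere. -/
lemma symmDiff_ball_subset_of_frontier_eq {n : ℕ} (hn : 2 ≤ n) {E : Set (Rn n)} {φ : Rn n → ℝ}
    (hE₀ : volume E ≠ 0) (hE : volume E ≠ ∞) (hφ : ContDiff ℝ 1 φ)
    (hφ' : ∀ x ∈ sphere (0 : Rn n) 1, |φ x| < 1 / 2)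
    (hfr : frontier E = (fun x : Rn n => (1 + φ x) • x) '' sphere (0 : Rn n) 1) :
    E ∆ ball 0 1 ⊆ {x | |‖x‖ - 1| ≤ |φ (‖x‖⁻¹ • x)|} := by
  have : Nonempty (Fin n) := ⟨⟨0, by omega⟩⟩
  have hφc : Continuous φ := hφ.continuous
  have hpos : ∀ x ∈ sphere (0 : Rn n) 1, 0 < 1 + φ x := fun x hx => by
    linarith [(abs_lt.1 (hφ' x hx)).1]
  set f : ℝ × Rn n → Rn n := fun p => (p.1 * (1 + φ p.2)) • p.2
  have hf : Continuous f := by fun_prop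
  have hsph : IsPreconnected (sphere (0 : Rn n) 1) :=
    isPreconnected_sphere (by simpa [← Module.finrank_eq_rank] using Nat.lt_of_succ_le hn) 0 1
  obtain ⟨z, hz⟩ : (sphere (0 : Rn n) 1).Nonempty := NormedSpace.sphere_nonempty.2 zero_le_one
  have hz0 : f (0, z) = 0 := by simp [f]
  have hnull : volume (frontier E) = 0 := by
    rw [hfr]
    refine addHaar_image_eq_zero_of_differentiableOn_of_addHaar_eq_zero volume ?_
      (Measure.addHaar_sphere volume 0 1)
    have := hφ.differentiable one_ne_zero
    fun_prop
  have hnorm : ∀ t : ℝ, 0 ≤ t → ∀ x ∈ sphere (0 : Rn n) 1, ‖f (t, x)‖ = t * (1 + φ x) := by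
    intro t ht x hx
    have h1 : ‖x‖ = 1 := by simpa using hx
    simp only [f, norm_smul, h1, mul_one, Real.norm_eq_abs]
    exact abs_of_nonneg (mul_nonneg ht (hpos x hx).le)
  have hdir : ∀ t : ℝ, 0 < t → ∀ x ∈ sphere (0 : Rn n) 1, ‖f (t, x)‖⁻¹ • f (t, x) = x := by
    intro t ht x hx
    rw [hnorm t ht.le x hx, smul_smul, inv_mul_cancel₀ (mul_pos ht (hpos x hx)).ne', one_smul]
  have hdisj : ∀ t : ℝ, 0 ≤ t → t ≠ 1 → ∀ x ∈ sphere (0 : Rn n) 1, f (t, x) ∉ frontier E := by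
    intro t ht ht1 x hx hmem
    rw [hfr] at hmem
    obtain ⟨y, hy, hxy⟩ := hmem
    have hxy' : f (1, y) = f (t, x) := by simpa [f] using hxy
    have hn1 := hnorm t ht x hx
    rw [← hxy', hnorm 1 zero_le_one y hy] at hn1
    have htpos : 0 < t := by
      refine ht.lt_of_ne' fun h => ?_
      subst h
      linarith [hpos y hy]
    have hyx : y = x := by
      rw [← hdir 1 one_pos y hy, ← hdir t htpos x hx, hxy']
    subst hyx
    exact ht1 (mul_right_cancel₀ (hpos y hy).ne' hn1).symm
  have hside : ∀ I : Set ℝ, I.OrdConnected → I ⊆ Ici 0 → 1 ∉ I →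
      f '' (I ×ˢ sphere 0 1) ⊆ E ∨ f '' (I ×ˢ sphere 0 1) ⊆ Eᶜ := by
    intro I hI hI0 hI1
    have hpre : IsPreconnected (f '' (I ×ˢ sphere 0 1)) :=
      (hI.isPreconnected.prod hsph).image f hf.continuousOn
    have hsub : f '' (I ×ˢ sphere 0 1) ⊆ interior E ∪ interior Eᶜ := by
      rintro _ ⟨⟨t, x⟩, ⟨ht, hx⟩, rfl⟩
      have := hdisj t (hI0 ht) (fun h => hI1 (h ▸ ht)) x hx
      by_contra hcon
      rw [interior_compl, mem_union, mem_compl_iff, not_or, not_not] at hcon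
      exact this ⟨hcon.2, hcon.1⟩
    exact (IsPreconnected.subset_or_subset isOpen_interior isOpen_interior
      ((disjoint_compl_right).mono interior_subset interior_subset) hsub hpre).imp
      (·.trans interior_subset) (·.trans interior_subset)
  have hrep : ∀ x : Rn n, x ≠ 0 → ‖x‖⁻¹ • x ∈ sphere (0 : Rn n) 1 ∧
      f (‖x‖ / (1 + φ (‖x‖⁻¹ • x)), ‖x‖⁻¹ • x) = x := by
    intro x hx
    have hx' : ‖x‖ ≠ 0 := norm_ne_zero_iff.2 hx
    have hs : ‖x‖⁻¹ • x ∈ sphere (0 : Rn n) 1 := by simp [norm_smul, hx']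
    refine ⟨hs, ?_⟩
    simp only [f]
    rw [div_mul_cancel₀ _ (hpos _ hs).ne', smul_smul, mul_inv_cancel₀ hx', one_smul]
  have himg : ∀ (I : Set ℝ) (x : Rn n), x ≠ 0 → ‖x‖ / (1 + φ (‖x‖⁻¹ • x)) ∈ I →
      x ∈ f '' (I ×ˢ sphere 0 1) := fun I x hx ht =>
    ⟨(‖x‖ / (1 + φ (‖x‖⁻¹ • x)), ‖x‖⁻¹ • x), ⟨ht, (hrep x hx).1⟩, (hrep x hx).2⟩
  have hout : f '' (Ioi 1 ×ˢ sphere 0 1) ⊆ Eᶜ := by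
    refine (hside (Ioi 1) ordConnected_Ioi (Ioi_subset_Ici zero_le_one)
      (by simp)).resolve_left fun h => hE ?_
    have hcov : (univ : Set (Rn n)) ⊆ E ∪ closedBall 0 2 := by
      intro x _
      by_cases hx : x ∈ closedBall (0 : Rn n) 2
      · exact Or.inr hx
      · have hx2 : 2 < ‖x‖ := by simpa using hx
        have hx0 : x ≠ 0 := norm_pos_iff.1 (by linarith)
        have hs := (hrep x hx0).1
        refine Or.inl (h (himg _ x hx0 ?_))
        have := (abs_lt.1 (hφ' _ hs)).2
        simp only [mem_Ioi]
        rw [lt_div_iff₀ (hpos _ hs)]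
        linarith
    by_contra hne
    have := (measure_mono hcov).trans_lt
      ((measure_union_le (μ := volume) E (closedBall (0 : Rn n) 2)).trans_lt
        (ENNReal.add_lt_top.2 ⟨lt_top_iff_ne_top.2 hne, measure_closedBall_lt_top⟩))
    rw [measure_univ_of_isAddLeftInvariant] at this
    exact lt_irrefl _ this
  have hin : f '' (Ico 0 1 ×ˢ sphere 0 1) ⊆ E := by
    refine (hside (Ico 0 1) ordConnected_Ico (fun t ht => ht.1) (by simp)).resolve_right
      fun h => hE₀ (measure_mono_null ?_ hnull)
    intro x hxE
    by_contra hxf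
    rcases eq_or_ne x 0 with rfl | hx
    · exact h ⟨(0, z), ⟨by simp, hz⟩, hz0⟩ hxE
    · obtain ⟨hs, hfx⟩ := hrep x hx
      rcases lt_trichotomy (‖x‖ / (1 + φ (‖x‖⁻¹ • x))) 1 with ht | ht | ht
      · exact h (himg _ x hx ⟨div_nonneg (norm_nonneg x) (hpos _ hs).le, ht⟩) hxE
      · rw [ht] at hfx
        exact hxf (hfr ▸ ⟨_, hs, by simpa [f] using hfx⟩)
      · exact hout (himg _ x hx ht) hxE
  rintro x (⟨hxE, hxB⟩ | ⟨hxB, hxE⟩)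
  · have hx1 : 1 ≤ ‖x‖ := by simpa using hxB
    have hx0 : x ≠ 0 := norm_pos_iff.1 (by linarith)
    have hs := (hrep x hx0).1
    have hle : ‖x‖ / (1 + φ (‖x‖⁻¹ • x)) ≤ 1 := by
      by_contra! ht
      exact hout (himg _ x hx0 ht) hxE
    rw [div_le_one (hpos _ hs)] at hle
    rw [mem_ofPred_eq, abs_of_nonneg (by linarith)]
    linarith [le_abs_self (φ (‖x‖⁻¹ • x))]
  · have hx1 : ‖x‖ < 1 := by simpa using hxB
    have hx0 : x ≠ 0 := by
      rintro rfl
      exact hxE (hin ⟨(0, z), ⟨by simp, hz⟩, hz0⟩)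
    have hs := (hrep x hx0).1
    have hle : 1 ≤ ‖x‖ / (1 + φ (‖x‖⁻¹ • x)) := by
      by_contra! ht
      exact hxE (hin (himg _ x hx0 ⟨div_nonneg (norm_nonneg x) (hpos _ hs).le, ht⟩))
    rw [one_le_div (hpos _ hs)] at hle
    rw [mem_ofPred_eq, abs_of_nonpos (by linarith)]
    linarith [neg_abs_le (φ (‖x‖⁻¹ • x))]

/-- The Riesz kernel differs from `1` by `O(‖φ‖²)` in mean over the region between the unit sphere
and the radial graph of `φ`. -/
lemma setLIntegral_abs_rpow_neg_sub_one_le {n : ℕ} (hn : n ≠ 0) {s : ℝ} (hs : s ∈ Ioo (0 : ℝ) 1)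
    {φ : Rn n → ℝ} (hφ : Continuous φ) (hφ' : ∀ x ∈ sphere (0 : Rn n) 1, |φ x| < 1 / 2) :
    ∫⁻ x in {x : Rn n | |‖x‖ - 1| ≤ |φ (‖x‖⁻¹ • x)|}, ENNReal.ofReal |‖x‖ ^ (-s) - 1| ≤
      ENNReal.ofReal (4 * (3 / 2) ^ (n - 1) * ∫ θ : sphere (0 : Rn n) 1,
        φ (θ : Rn n) ^ 2 ∂((volume : Measure (Rn n)).toSphere)) := by
  have : Nonempty (Fin n) := ⟨⟨0, Nat.pos_of_ne_zero hn⟩⟩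
  set T : Set (Rn n) := {x | |‖x‖ - 1| ≤ |φ (‖x‖⁻¹ • x)|}
  have hT : MeasurableSet T := by
    have := hφ.measurable
    exact measurableSet_le (by fun_prop) (by fun_prop)
  have hint : Integrable (fun θ : sphere (0 : Rn n) 1 => φ (θ : Rn n) ^ 2)
      (volume : Measure (Rn n)).toSphere := by
    have : Continuous fun θ : sphere (0 : Rn n) 1 => φ (θ : Rn n) ^ 2 := by fun_prop
    exact this.integrable_of_hasCompactSupport (.of_compactSpace _)
  rw [← integral_const_mul, ofReal_integral_eq_lintegral_ofReal (hint.const_mul _)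
    (.of_forall fun θ => by positivity), ← lintegral_indicator hT,
    lintegral_eq_lintegral_toSphere _ ((by fun_prop : Measurable fun x : Rn n =>
      ENNReal.ofReal |‖x‖ ^ (-s) - 1|).indicator hT)]
  refine lintegral_mono fun θ => ?_
  have hθ : ‖(θ : Rn n)‖ = 1 := by simp
  have ha := hφ' θ θ.2
  set a := |φ (θ : Rn n)| with ha_def
  have ha0 : 0 ≤ a := abs_nonneg _
  calc _ ≤ ∫⁻ r in Ioi (0 : ℝ), (Icc (1 - a) (1 + a)).indicator
          (fun _ => ENNReal.ofReal ((3 / 2) ^ (n - 1) * (2 * a))) r := by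
        refine setLIntegral_mono (by fun_prop (disch := measurability)) fun r hr => ?_
        have hr0 : 0 < r := hr
        have hnr : ‖r • (θ : Rn n)‖ = r := by rw [norm_smul, hθ, mul_one, Real.norm_of_nonneg hr0.le]
        by_cases hrT : r • (θ : Rn n) ∈ T
        · have hra : |r - 1| ≤ a := by
            have h := hrT
            simp only [T, mem_ofPred_eq, hnr, smul_smul, inv_mul_cancel₀ hr0.ne', one_smul] at h
            exact h
          have hra' := abs_le.1 hra
          rw [indicator_of_mem hrT, indicator_of_mem
            (show r ∈ Icc (1 - a) (1 + a) from ⟨by linarith, by linarith⟩), hnr,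
            ← ENNReal.ofReal_mul (by positivity), finrank_euclideanSpace_fin]
          refine ENNReal.ofReal_le_ofReal ?_
          have hk := abs_rpow_neg_sub_one_le hs.1 hs.2 (r := r) (by linarith)
          gcongr
          · linarith
          · linarith
        · simp [hrT]
    _ ≤ ∫⁻ r, (Icc (1 - a) (1 + a)).indicator
          (fun _ => ENNReal.ofReal ((3 / 2) ^ (n - 1) * (2 * a))) r :=
        setLIntegral_le_lintegral _ _
    _ = ENNReal.ofReal (4 * (3 / 2) ^ (n - 1) * φ (θ : Rn n) ^ 2) := by
        rw [lintegral_indicator measurableSet_Icc, setLIntegral_const, Real.volume_Icc,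
          ← ENNReal.ofReal_mul (by positivity), ← sq_abs (φ (θ : Rn n)), ← ha_def]
        congr 1
        ring

/-- **Estimate of `V_s(B₁) - V_s(E)` for nearly spherical sets.** There is `C = C(n,s) > 0` such
that if `E ⊆ ℝⁿ` is a nearly spherical set, i.e. `|E| = ω_n`, barycenter at the origin and
`∂E = {(1+φ(x))x : x ∈ ∂B₁}` with `‖φ‖_{C¹(∂B₁)} < 1/2`, then
`V_s(B₁) - V_s(E) ≤ C ‖φ‖²_{L²(∂B₁)}`. -/
theorem stmt_18 (n : ℕ) (hn : 2 ≤ n) (s : ℝ) (hs : s ∈ Set.Ioo (0 : ℝ) 1) :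
    ∃ C : ℝ, 0 < C ∧ ∀ (E : Set (Rn n)) (φ : Rn n → ℝ),
      MeasurableSet E → volume E = volume (ball (0 : Rn n) 1) →
      (∫ x in E, x) = 0 →
      ContDiff ℝ 1 φ →
      (∀ x ∈ sphere (0 : Rn n) 1, |φ x| + ‖fderiv ℝ φ x‖ < 1 / 2) →
      frontier E = (fun x : Rn n => (1 + φ x) • x) '' sphere (0 : Rn n) 1 →
      (Vs n s (ball (0 : Rn n) 1)).toReal - (Vs n s E).toReal ≤
        C * ∫ θ : sphere (0 : Rn n) 1,
          φ (θ : Rn n) ^ 2 ∂((volume : Measure (Rn n)).toSphere) := by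
  refine ⟨4 * (3 / 2) ^ (n - 1), by positivity, fun E φ hEm hvol _ hφ hφb hfr => ?_⟩
  have hn0 : n ≠ 0 := by omega
  have : Nonempty (Fin n) := ⟨⟨0, by omega⟩⟩
  have hφ' : ∀ x ∈ sphere (0 : Rn n) 1, |φ x| < 1 / 2 := fun x hx =>
    (le_add_of_nonneg_right (norm_nonneg _)).trans_lt (hφb x hx)
  set R := 4 * (3 / 2) ^ (n - 1) * ∫ θ : sphere (0 : Rn n) 1,
    φ (θ : Rn n) ^ 2 ∂((volume : Measure (Rn n)).toSphere) with hR
  have hR0 : 0 ≤ R := mul_nonneg (by positivity) (integral_nonneg fun θ => sq_nonneg _)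
  have hball : volume (ball (0 : Rn n) 1) ≠ ∞ := measure_ball_lt_top.ne
  have hsub := symmDiff_ball_subset_of_frontier_eq hn (hvol ▸ (measure_ball_pos _ _ one_pos).ne')
    (hvol ▸ hball) hφ hφ' hfr
  have hcmp : rieszAt n s (ball 0 1) 0 ≤ rieszAt n s E 0 + ENNReal.ofReal R := by
    have h := setLIntegral_le_add_symmDiff (μ := (volume : Measure (Rn n))) measurableSet_ball hEm
      hvol.symm hball (g := fun x => ENNReal.ofReal (‖x‖ ^ (-s)))
      (h := fun x => ENNReal.ofReal |‖x‖ ^ (-s) - 1|) (by fun_prop) (by fun_prop)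
      (.of_forall fun x _ => by
        rw [← ENNReal.ofReal_one, ← ENNReal.ofReal_add zero_le_one (abs_nonneg _)]
        exact ENNReal.ofReal_le_ofReal (by linarith [le_abs_self (‖x‖ ^ (-s) - 1)]))
      (.of_forall fun x _ => by
        rw [← ENNReal.ofReal_one, ← ENNReal.ofReal_add (by positivity) (abs_nonneg _)]
        exact ENNReal.ofReal_le_ofReal (by linarith [neg_abs_le (‖x‖ ^ (-s) - 1)]))
    simp only [rieszAt, sub_zero]
    refine h.trans (add_le_add_right ?_ _)
    rw [symmDiff_comm]
    exact (lintegral_mono_set hsub).trans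
      (setLIntegral_abs_rpow_neg_sub_one_le hn0 hs hφ.continuous hφ')
  have hVE : Vs n s E ≤ rieszAt n s (ball 0 1) 0 :=
    iSup_le fun y => rieszAt_le_rieszAt_ball hn0 hs.1 hEm hvol y
  rw [Vs_ball_eq hn0 hs.1]
  rcases eq_or_ne (rieszAt n s (ball 0 1) 0) ∞ with htop | htop
  · rw [htop, ENNReal.toReal_top]
    linarith [ENNReal.toReal_nonneg (a := Vs n s E)]
  · have hfin : Vs n s E ≠ ∞ := ne_top_of_le_ne_top htop hVE
    have hle : rieszAt n s (ball 0 1) 0 ≤ Vs n s E + ENNReal.ofReal R :=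
      hcmp.trans (add_le_add_left (le_iSup (rieszAt n s E) 0) _)
    have := ENNReal.toReal_mono (ENNReal.add_ne_top.2 ⟨hfin, ENNReal.ofReal_ne_top⟩) hle
    rw [ENNReal.toReal_add hfin ENNReal.ofReal_ne_top, ENNReal.toReal_ofReal hR0] at this
    linarith
end
end

section
/- Let n ≥ 2. For every σ ∈ (0,1) and c₀ > 0 there exists a sequence of bounded measurable sets {Ω_M}_{M∈ℕ} in ℝⁿ and a measurable set Ω_∞ ⊂ ℝⁿ such that: (i) for every s ∈ (0,1) the limit lim_{M→∞} P_s(Ω_M) exists, is finite for s ∈ (0,σ) and equals +∞ for s ∈ [σ,1); (ii) Ω_M → Ω_∞ in L¹ as M → ∞, |Ω_M| ≤ |Ω_∞| < ∞ for every M, and P_s(Ω_∞) < ∞ for s ∈ (0,σ) while P_s(Ω_∞) = +∞ for s ∈ [σ,1); (iii) for every M ∈ ℕ, up to translation, the ball B_{c₀} is contained in Ω_M. -/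
open MeasureTheory Metric Set Filter
open scoped ENNReal NNReal symmDiff Topology

noncomputable section

/-- The fractional interaction `∫_A ∫_B |x-y|^{-(n+s)} dx dy` of two sets. -/
def fracInteraction (n : ℕ) (s : ℝ) (A B : Set (Rn n)) : ℝ≥0∞ :=
  ∫⁻ x in A, ∫⁻ y in B, ENNReal.ofReal (‖x - y‖ ^ (-((n : ℝ) + s)))

theorem measurable_fracKernel (n : ℕ) (s : ℝ) :
    Measurable fun p : Rn n × Rn n => ENNReal.ofReal (‖p.1 - p.2‖ ^ (-((n : ℝ) + s))) := by
  fun_prop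

theorem fracInteraction_mono {n : ℕ} {s : ℝ} {A A' B B' : Set (Rn n)} (hA : A ⊆ A')
    (hB : B ⊆ B') : fracInteraction n s A B ≤ fracInteraction n s A' B' :=
  lintegral_mono' (Measure.restrict_mono hA le_rfl) fun _ => lintegral_mono_set hB

theorem fracInteraction_comm (n : ℕ) (s : ℝ) (A B : Set (Rn n)) :
    fracInteraction n s A B = fracInteraction n s B A := by
  unfold fracInteraction
  rw [lintegral_lintegral_swap (measurable_fracKernel n s).aemeasurable]
  simp_rw [norm_sub_rev]

theorem fracInteraction_union_right_le (n : ℕ) (s : ℝ) (A B C : Set (Rn n)) :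
    fracInteraction n s A (B ∪ C) ≤ fracInteraction n s A B + fracInteraction n s A C := by
  unfold fracInteraction
  rw [← lintegral_add_left (measurable_fracKernel n s).lintegral_prod_right']
  exact lintegral_mono fun x => lintegral_union_le _ _ _

theorem fracInteraction_iUnion_left_le (n : ℕ) (s : ℝ) (E : ℕ → Set (Rn n)) (B : Set (Rn n)) :
    fracInteraction n s (⋃ k, E k) B ≤ ∑' k, fracInteraction n s (E k) B :=
  lintegral_iUnion_le _ _

theorem fracInteraction_iUnion_left {n : ℕ} (s : ℝ) {E : ℕ → Set (Rn n)}
    (hE : ∀ k, MeasurableSet (E k)) (hd : Pairwise (Function.onFun Disjoint E)) (B : Set (Rn n)) :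
    fracInteraction n s (⋃ k, E k) B = ∑' k, fracInteraction n s (E k) B :=
  lintegral_iUnion hE hd _

theorem fracInteraction_biUnion_range_left {n : ℕ} (s : ℝ) {E : ℕ → Set (Rn n)}
    (hE : ∀ k, MeasurableSet (E k)) (hd : Pairwise (Function.onFun Disjoint E)) (B : Set (Rn n))
    (M : ℕ) : fracInteraction n s (⋃ k ∈ Finset.range M, E k) B =
      ∑ k ∈ Finset.range M, fracInteraction n s (E k) B :=
  lintegral_biUnion_finset (fun _ _ _ _ hij => hd hij) (fun k _ => hE k) _

theorem iUnion_diff_biUnion_range_subset {α : Type*} (E : ℕ → Set α) (M : ℕ) :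
    (⋃ k, E k) \ (⋃ k ∈ Finset.range M, E k) ⊆ ⋃ k, E (k + M) := by
  rintro x ⟨hx, hx'⟩
  obtain ⟨k, hk⟩ := mem_iUnion.1 hx
  have hMk : M ≤ k := by
    by_contra! h
    exact hx' (mem_biUnion (Finset.mem_coe.2 (Finset.mem_range.2 h)) hk)
  exact mem_iUnion.2 ⟨k - M, by rwa [Nat.sub_add_cancel hMk]⟩

theorem fracPer_biUnion_range_le {n : ℕ} (s : ℝ) {E : ℕ → Set (Rn n)}
    (hd : Pairwise (Function.onFun Disjoint E)) (M : ℕ) :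
    fracPer n s (⋃ k ∈ Finset.range M, E k) ≤
      fracPer n s (⋃ k, E k) + ∑' k, fracPer n s (E (k + M)) := by
  set A := ⋃ k ∈ Finset.range M, E k with hA
  set U := ⋃ k, E k with hU
  have hAU : A ⊆ U := iUnion₂_subset fun k _ => subset_iUnion E k
  have hAE : ∀ k, A ⊆ (E (k + M))ᶜ := fun k => by
    refine iUnion₂_subset fun j hj => ?_
    have : j ≠ k + M := by have := Finset.mem_range.1 hj; omega
    exact (hd this).subset_compl_right
  calc fracPer n s A = fracInteraction n s A Aᶜ := rfl
    _ ≤ fracInteraction n s A (Uᶜ ∪ ⋃ k, E (k + M)) := by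
      refine fracInteraction_mono le_rfl fun x hx => ?_
      by_cases h : x ∈ U
      · exact Or.inr (iUnion_diff_biUnion_range_subset E M ⟨h, hx⟩)
      · exact Or.inl h
    _ ≤ fracInteraction n s A Uᶜ + fracInteraction n s A (⋃ k, E (k + M)) :=
      fracInteraction_union_right_le _ _ _ _ _
    _ ≤ _ := by
      refine add_le_add (fracInteraction_mono hAU le_rfl) ?_
      rw [fracInteraction_comm]
      refine (fracInteraction_iUnion_left_le _ _ _ _).trans ?_
      exact ENNReal.tsum_le_tsum fun k => fracInteraction_mono le_rfl (hAE k)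

theorem tendsto_fracPer_biUnion_range {n : ℕ} (s : ℝ) {E : ℕ → Set (Rn n)}
    (hE : ∀ k, MeasurableSet (E k)) (hd : Pairwise (Function.onFun Disjoint E))
    (h : ∑' k, fracPer n s (E k) ≠ ⊤ ∨ fracPer n s (⋃ k, E k) = ⊤) :
    Tendsto (fun M => fracPer n s (⋃ k ∈ Finset.range M, E k)) atTop
      (𝓝 (fracPer n s (⋃ k, E k))) := by
  have hlow : Tendsto (fun M => fracInteraction n s (⋃ k ∈ Finset.range M, E k) (⋃ k, E k)ᶜ)
      atTop (𝓝 (fracPer n s (⋃ k, E k))) := by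
    change Tendsto _ _ (𝓝 (fracInteraction n s _ _))
    simp_rw [fracInteraction_biUnion_range_left s hE hd]
    rw [fracInteraction_iUnion_left s hE hd]
    exact ENNReal.tendsto_nat_tsum _
  have hle : ∀ M, fracInteraction n s (⋃ k ∈ Finset.range M, E k) (⋃ k, E k)ᶜ ≤
      fracPer n s (⋃ k ∈ Finset.range M, E k) := fun M =>
    fracInteraction_mono le_rfl
      (compl_subset_compl.2 (iUnion₂_subset fun k _ => subset_iUnion E k))
  rcases h with h | h
  · have hup := (tendsto_const_nhds (x := fracPer n s (⋃ k, E k))).add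
      (ENNReal.tendsto_sum_nat_add _ h)
    rw [add_zero] at hup
    exact tendsto_of_tendsto_of_tendsto_of_le_of_le hlow hup hle
      fun M => fracPer_biUnion_range_le s hd M
  · rw [h] at hlow ⊢
    exact tendsto_of_tendsto_of_tendsto_of_le_of_le hlow tendsto_const_nhds hle fun _ => le_top

theorem setLIntegral_norm_rpow_ball_lt_top {n : ℕ} (hn : 2 ≤ n) {s : ℝ} (hs : s < 1) :
    ∫⁻ h in ball (0 : Rn n) 1, ENNReal.ofReal (‖h‖ ^ (1 - ((n : ℝ) + s))) < ⊤ := by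
  have : Nontrivial (Rn n) := by
    have : Nonempty (Fin n) := ⟨⟨0, by omega⟩⟩
    infer_instance
  have hi : IntegrableOn (fun h : Rn n => ‖h‖ ^ (1 - ((n : ℝ) + s))) (ball 0 1) := by
    rw [integrableOn_fun_norm_addHaar volume (f := fun t : ℝ => t ^ (1 - ((n : ℝ) + s)))]
    have h1 : IntegrableOn (fun t : ℝ => t ^ (-s)) (Ioo 0 1) :=
      (intervalIntegral.integrableOn_Ioo_rpow_iff one_pos).2 (by linarith)
    refine h1.congr_fun (fun t ht => ?_) measurableSet_Ioo
    simp only [finrank_euclideanSpace, Fintype.card_fin, smul_eq_mul]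
    rw [← Real.rpow_natCast, ← Real.rpow_add ht.1]
    congr 1
    push_cast [Nat.cast_sub (show 1 ≤ n by omega)]
    ring
  exact hi.lintegral_lt_top

theorem setLIntegral_norm_rpow_compl_ball_lt_top {n : ℕ} {s : ℝ} (hs : 0 < s) :
    ∫⁻ h in (ball (0 : Rn n) 1)ᶜ, ENNReal.ofReal (‖h‖ ^ (-((n : ℝ) + s))) < ⊤ := by
  have hJ : ∫⁻ h : Rn n, ENNReal.ofReal ((1 + ‖h‖) ^ (-((n : ℝ) + s))) < ⊤ :=
    finite_integral_one_add_norm (by simpa using hs)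
  calc _ ≤ ∫⁻ h in (ball (0 : Rn n) 1)ᶜ, ENNReal.ofReal (2 ^ ((n : ℝ) + s)) *
        ENNReal.ofReal ((1 + ‖h‖) ^ (-((n : ℝ) + s))) := by
        refine setLIntegral_mono' measurableSet_ball.compl fun h hh => ?_
        have h1 : 1 ≤ ‖h‖ := by simpa using hh
        rw [← ENNReal.ofReal_mul (by positivity)]
        refine ENNReal.ofReal_le_ofReal ?_
        have h2 : (2 * ‖h‖) ^ (-((n : ℝ) + s)) ≤ (1 + ‖h‖) ^ (-((n : ℝ) + s)) :=
          Real.rpow_le_rpow_of_nonpos (by positivity) (by linarith)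
            (by have : (0 : ℝ) ≤ n := n.cast_nonneg
                linarith)
        rw [Real.mul_rpow (by norm_num) (by positivity)] at h2
        calc ‖h‖ ^ (-((n : ℝ) + s)) = 2 ^ ((n : ℝ) + s) *
              (2 ^ (-((n : ℝ) + s)) * ‖h‖ ^ (-((n : ℝ) + s))) := by
              rw [← mul_assoc, ← Real.rpow_add (by norm_num)]; simp
          _ ≤ _ := by gcongr
    _ ≤ ENNReal.ofReal (2 ^ ((n : ℝ) + s)) *
        ∫⁻ h : Rn n, ENNReal.ofReal ((1 + ‖h‖) ^ (-((n : ℝ) + s))) := by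
        rw [lintegral_const_mul _ (by fun_prop)]
        gcongr
        exact Measure.restrict_le_self
    _ < ⊤ := ENNReal.mul_lt_top ENNReal.ofReal_lt_top hJ

theorem volume_ball_diff_translate_le {n : ℕ} (hn : 1 ≤ n) (h : Rn n) :
    volume {x : Rn n | x ∈ ball (0 : Rn n) 1 ∧ x - h ∉ ball (0 : Rn n) 1} ≤
      ENNReal.ofReal (n * ‖h‖) * volume (ball (0 : Rn n) 1) := by
  rcases lt_or_ge ‖h‖ 1 with h1 | h1
  · have hsub : {x : Rn n | x ∈ ball (0 : Rn n) 1 ∧ x - h ∉ ball (0 : Rn n) 1} ⊆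
        ball 0 1 \ ball 0 (1 - ‖h‖) := by
      rintro x ⟨hx, hxh⟩
      refine ⟨hx, fun hx' => hxh ?_⟩
      simp only [mem_ball_zero_iff] at *
      linarith [norm_sub_le x h]
    refine (measure_mono hsub).trans ?_
    have h0 : 0 < 1 - ‖h‖ := by linarith
    rw [measure_sdiff (ball_subset_ball (by linarith [norm_nonneg h]))
      measurableSet_ball.nullMeasurableSet measure_ball_lt_top.ne,
      Measure.addHaar_ball_of_pos volume (0 : Rn n) h0, tsub_le_iff_right, ← add_mul,
      ← ENNReal.ofReal_add (by positivity) (by positivity)]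
    refine le_mul_of_one_le_left' ?_
    rw [ENNReal.one_le_ofReal, finrank_euclideanSpace, Fintype.card_fin, sub_eq_add_neg]
    linarith [one_add_mul_le_pow (show -2 ≤ -‖h‖ by linarith) n]
  · refine (measure_mono fun x hx => hx.1).trans (le_mul_of_one_le_left' ?_)
    rw [ENNReal.one_le_ofReal]
    exact one_le_mul_of_one_le_of_one_le (by exact_mod_cast hn) h1

theorem fracPer_unitBall_lt_top {n : ℕ} (hn : 2 ≤ n) {s : ℝ} (hs : s ∈ Ioo (0 : ℝ) 1) :
    fracPer n s (ball (0 : Rn n) 1) < ⊤ := by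
  set B := ball (0 : Rn n) 1 with hB
  have hmB : MeasurableSet B := measurableSet_ball
  let D : Set (Rn n × Rn n) := {p | p.1 ∈ B ∧ p.1 - p.2 ∉ B}
  have hmD : MeasurableSet D :=
    (measurable_fst hmB).inter ((measurable_fst.sub measurable_snd) hmB.compl)
  let k : Rn n → ℝ≥0∞ := fun h => ENNReal.ofReal (‖h‖ ^ (-((n : ℝ) + s)))
  have hmk : Measurable k := by fun_prop
  have hin : ∀ x, B.indicator (fun x => ∫⁻ y in Bᶜ, k (x - y)) x =
      ∫⁻ h, D.indicator (fun p => k p.2) (x, h) := by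
    intro x
    by_cases hx : x ∈ B
    · rw [indicator_of_mem hx, ← lintegral_indicator hmB.compl,
        ← lintegral_sub_left_eq_self _ x]
      refine lintegral_congr fun h => ?_
      by_cases hh : x - h ∈ B
      · simp [D, indicator, hx, hh]
      · simp [D, indicator, hx, hh]
    · rw [indicator_of_notMem hx]
      simp [D, indicator, hx]
  have hsec : ∀ h, ∫⁻ x, D.indicator (fun p => k p.2) (x, h) =
      k h * volume {x : Rn n | x ∈ B ∧ x - h ∉ B} := by
    intro h
    have hm : MeasurableSet {x : Rn n | x ∈ B ∧ x - h ∉ B} := measurable_prodMk_right hmD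
    rw [← lintegral_indicator_const hm]
    exact lintegral_congr fun x => by simp [D, indicator]
  have heq : fracPer n s B = ∫⁻ h, k h * volume {x : Rn n | x ∈ B ∧ x - h ∉ B} := by
    calc fracPer n s B = ∫⁻ x, B.indicator (fun x => ∫⁻ y in Bᶜ, k (x - y)) x :=
          (lintegral_indicator hmB _).symm
      _ = ∫⁻ x, ∫⁻ h, D.indicator (fun p => k p.2) (x, h) := lintegral_congr hin
      _ = ∫⁻ h, ∫⁻ x, D.indicator (fun p => k p.2) (x, h) :=
          lintegral_lintegral_swap ((hmk.comp measurable_snd).indicator hmD).aemeasurable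
      _ = _ := lintegral_congr hsec
  rw [heq, ← lintegral_add_compl _ hmB]
  refine ENNReal.add_lt_top.2 ⟨?_, ?_⟩
  · calc _ ≤ ∫⁻ h in B, (ENNReal.ofReal n * volume B) *
          ENNReal.ofReal (‖h‖ ^ (1 - ((n : ℝ) + s))) := by
          refine lintegral_mono fun h => ?_
          refine (mul_le_mul_right (volume_ball_diff_translate_le (by omega) h) _).trans ?_
          rcases eq_or_ne h 0 with rfl | hh
          · simp
          refine le_of_eq ?_
          rw [sub_eq_add_neg, Real.rpow_add (norm_pos_iff.2 hh), Real.rpow_one,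
            ENNReal.ofReal_mul (norm_nonneg h), ENNReal.ofReal_mul n.cast_nonneg]
          simp only [k]
          ring
      _ = (ENNReal.ofReal n * volume B) *
          ∫⁻ h in B, ENNReal.ofReal (‖h‖ ^ (1 - ((n : ℝ) + s))) :=
          lintegral_const_mul _ (by fun_prop)
      _ < ⊤ := ENNReal.mul_lt_top (ENNReal.mul_lt_top ENNReal.ofReal_lt_top measure_ball_lt_top)
          (setLIntegral_norm_rpow_ball_lt_top hn hs.2)
  · calc _ ≤ ∫⁻ h in Bᶜ, k h * volume B :=
          lintegral_mono fun h => mul_le_mul_right (measure_mono fun x hx => hx.1) _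
      _ = (∫⁻ h in Bᶜ, k h) * volume B := lintegral_mul_const _ hmk
      _ < ⊤ := ENNReal.mul_lt_top (setLIntegral_norm_rpow_compl_ball_lt_top hs.1)
          measure_ball_lt_top

theorem setLIntegral_homothety {n : ℕ} (c : Rn n) {r : ℝ} (hr : 0 < r) {S : Set (Rn n)}
    (hS : MeasurableSet S) {g : Rn n → ℝ≥0∞} (hg : Measurable g) :
    ∫⁻ y in S, g y = ENNReal.ofReal (r ^ n) *
      ∫⁻ y in (fun y => c + r • y) ⁻¹' S, g (c + r • y) := by
  have hm : Measurable fun y : Rn n => c + r • y := by fun_prop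
  have hmap : Measure.map (fun y : Rn n => c + r • y) volume =
      ENNReal.ofReal (r ^ n)⁻¹ • volume := by
    have h1 := Measure.map_addHaar_smul (volume : Measure (Rn n)) hr.ne'
    have : (fun y : Rn n => c + r • y) = (fun y => c + y) ∘ (fun y => r • y) := rfl
    rw [this, ← Measure.map_map (by fun_prop) (by fun_prop), h1, Measure.map_smul,
      map_add_left_eq_self]
    simp [abs_of_pos hr]
  rw [← setLIntegral_map hS hg hm, hmap, Measure.restrict_smul, lintegral_smul_measure,
    smul_eq_mul, ← mul_assoc, ← ENNReal.ofReal_mul (by positivity),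
    mul_inv_cancel₀ (by positivity)]
  simp

theorem fracPer_ball {n : ℕ} (s : ℝ) (c : Rn n) {r : ℝ} (hr : 0 < r) :
    fracPer n s (ball c r) = ENNReal.ofReal (r ^ ((n : ℝ) - s)) * fracPer n s (ball 0 1) := by
  have hpre : (fun y => c + r • y) ⁻¹' ball c r = ball (0 : Rn n) 1 := by
    ext y
    simp [norm_smul, abs_of_pos hr, hr]
  have hk := measurable_fracKernel n s
  unfold fracPer
  rw [setLIntegral_homothety c hr measurableSet_ball hk.lintegral_prod_right', hpre]
  have hin : ∀ x : Rn n, ∫⁻ y in (ball c r)ᶜ,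
      ENNReal.ofReal (‖c + r • x - y‖ ^ (-((n : ℝ) + s))) =
      ENNReal.ofReal (r ^ n) * (ENNReal.ofReal (r ^ (-((n : ℝ) + s))) *
        ∫⁻ y in (ball (0 : Rn n) 1)ᶜ, ENNReal.ofReal (‖x - y‖ ^ (-((n : ℝ) + s)))) := by
    intro x
    rw [setLIntegral_homothety c hr measurableSet_ball.compl (by fun_prop), preimage_compl, hpre,
      ← lintegral_const_mul (ENNReal.ofReal (r ^ (-((n : ℝ) + s)))) (by fun_prop)]
    congr 1
    refine lintegral_congr fun y => ?_
    rw [add_sub_add_left_eq_sub, ← smul_sub, norm_smul, Real.norm_of_nonneg hr.le,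
      Real.mul_rpow hr.le (norm_nonneg _), ENNReal.ofReal_mul (by positivity)]
  simp_rw [hin]
  rw [lintegral_const_mul _ (hk.lintegral_prod_right'.const_mul _),
    lintegral_const_mul _ hk.lintegral_prod_right']
  simp_rw [← mul_assoc]
  rw [← ENNReal.ofReal_mul (by positivity), ← ENNReal.ofReal_mul (by positivity)]
  congr 2
  rw [← Real.rpow_natCast, ← Real.rpow_add hr, ← Real.rpow_add hr]
  congr 1
  ring

theorem ofReal_mul_volume_sq_le_fracInteraction {n : ℕ} (hn : 1 ≤ n) {s : ℝ} (hs : 0 < s)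
    (c : Rn n) {r : ℝ} (hr : 0 < r) {B : Set (Rn n)} (hB : ball c (2 * r) \ ball c r ⊆ B) :
    ENNReal.ofReal (r ^ ((n : ℝ) - s)) *
      (ENNReal.ofReal (3 ^ (-((n : ℝ) + s))) * volume (ball (0 : Rn n) 1) ^ 2) ≤
      fracInteraction n s (ball c r) B := by
  set ω := volume (ball (0 : Rn n) 1) with hω
  have hann : ENNReal.ofReal (r ^ n) * ω ≤ volume (ball c (2 * r) \ ball c r) := by
    refine le_trans ?_ le_measure_sdiff
    rw [Measure.addHaar_ball_of_pos volume c hr,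
      Measure.addHaar_ball_of_pos volume c (show 0 < 2 * r by positivity),
      finrank_euclideanSpace, Fintype.card_fin]
    refine ENNReal.le_sub_of_add_le_right
      (ENNReal.mul_ne_top ENNReal.ofReal_ne_top measure_ball_lt_top.ne) ?_
    rw [← add_mul, ← ENNReal.ofReal_add (by positivity) (by positivity), mul_pow]
    gcongr
    have : (2 : ℝ) ≤ 2 ^ n := by simpa using pow_le_pow_right₀ (one_le_two (α := ℝ)) hn
    nlinarith [pow_pos hr n]
  calc _ = ENNReal.ofReal ((3 * r) ^ (-((n : ℝ) + s))) * (ENNReal.ofReal (r ^ n) * ω) *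
        volume (ball c r) := by
        rw [Measure.addHaar_ball_of_pos volume c hr, finrank_euclideanSpace, Fintype.card_fin,
          Real.mul_rpow (by norm_num) hr.le, ENNReal.ofReal_mul (by positivity),
          show (n : ℝ) - s = -((n : ℝ) + s) + (n : ℝ) + n by ring, Real.rpow_add hr,
          Real.rpow_add hr, Real.rpow_natCast, ENNReal.ofReal_mul (by positivity),
          ENNReal.ofReal_mul (by positivity)]
        ring
    _ ≤ ENNReal.ofReal ((3 * r) ^ (-((n : ℝ) + s))) * volume (ball c (2 * r) \ ball c r) *
        volume (ball c r) := by gcongr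
    _ = ∫⁻ _ in ball c r, ∫⁻ _ in ball c (2 * r) \ ball c r,
        ENNReal.ofReal ((3 * r) ^ (-((n : ℝ) + s))) := by simp only [setLIntegral_const]
    _ ≤ fracInteraction n s (ball c r) (ball c (2 * r) \ ball c r) := by
        refine setLIntegral_mono' measurableSet_ball fun x hx => ?_
        refine setLIntegral_mono' (measurableSet_ball.diff measurableSet_ball) fun y hy => ?_
        have hxy : x ≠ y := fun h => hy.2 (h ▸ hx)
        refine ENNReal.ofReal_le_ofReal (Real.rpow_le_rpow_of_nonpos
          (norm_pos_iff.2 (sub_ne_zero.2 hxy)) ?_ ?_)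
        · have h1 := mem_ball.1 hx
          have h2 := mem_ball.1 hy.1
          rw [← dist_eq_norm]
          linarith [dist_triangle_right x y c]
        · have : (0 : ℝ) ≤ n := n.cast_nonneg
          linarith
    _ ≤ _ := fracInteraction_mono le_rfl hB

theorem fracPer_iUnion_ball_eq_top {n : ℕ} (hn : 1 ≤ n) {s : ℝ} (hs : 0 < s) {c : ℕ → Rn n}
    {r : ℕ → ℝ} (hr : ∀ k, 0 < r k)
    (hd : ∀ j k, j ≠ k → Disjoint (ball (c j) (2 * r j)) (ball (c k) (r k)))
    (hsum : ¬ Summable fun k => r k ^ ((n : ℝ) - s)) :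
    fracPer n s (⋃ k, ball (c k) (r k)) = ⊤ := by
  have hd' : Pairwise (Function.onFun Disjoint fun k => ball (c k) (r k)) := fun j k hjk =>
    (hd j k hjk).mono_left (ball_subset_ball (by linarith [hr j]))
  change fracInteraction n s _ _ = ⊤
  rw [fracInteraction_iUnion_left s (fun _ => measurableSet_ball) hd', eq_top_iff]
  refine le_trans ?_ (ENNReal.tsum_le_tsum fun k =>
    ofReal_mul_volume_sq_le_fracInteraction hn hs (c k) (hr k) (B := (⋃ k, ball (c k) (r k))ᶜ) ?_)
  · rw [ENNReal.tsum_mul_right]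
    have h1 : ∑' k, ENNReal.ofReal (r k ^ ((n : ℝ) - s)) = ⊤ := by
      by_contra h
      refine hsum ?_
      refine (ENNReal.summable_toReal h).congr fun k => ?_
      exact ENNReal.toReal_ofReal (Real.rpow_nonneg (hr k).le _)
    rw [h1, ENNReal.top_mul]
    refine mul_ne_zero ?_ (pow_ne_zero _ (measure_ball_pos _ _ one_pos).ne')
    exact (ENNReal.ofReal_pos.2 (by positivity)).ne'
  · rintro y ⟨hy, hy'⟩ hyU
    obtain ⟨j, hj⟩ := mem_iUnion.1 hyU
    rcases eq_or_ne k j with rfl | hkj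
    · exact hy' hj
    · exact disjoint_left.1 (hd k j hkj) hy hj

theorem tsum_fracPer_ball_ne_top {n : ℕ} (hn : 2 ≤ n) {s : ℝ} (hs : s ∈ Ioo (0 : ℝ) 1)
    (c : ℕ → Rn n) {r : ℕ → ℝ} (hr : ∀ k, 0 < r k)
    (hsum : Summable fun k => r k ^ ((n : ℝ) - s)) :
    ∑' k, fracPer n s (ball (c k) (r k)) ≠ ⊤ := by
  simp_rw [fun k => fracPer_ball s (c k) (hr k)]
  rw [ENNReal.tsum_mul_right]
  exact ENNReal.mul_ne_top hsum.tsum_ofReal_ne_top (fracPer_unitBall_lt_top hn hs).ne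

theorem fracPer_iUnion_le {n : ℕ} (s : ℝ) (E : ℕ → Set (Rn n)) :
    fracPer n s (⋃ k, E k) ≤ ∑' k, fracPer n s (E k) :=
  (fracInteraction_iUnion_left_le n s E _).trans (ENNReal.tsum_le_tsum fun k =>
    fracInteraction_mono le_rfl (compl_subset_compl.2 (subset_iUnion E k)))

theorem summable_mul_rpow_rpow_iff {R p q : ℝ} (hR : 0 < R) :
    Summable (fun k : ℕ => (R * ((k : ℝ) + 1) ^ (-p)) ^ q) ↔ 1 < p * q := by
  have h : ∀ k : ℕ, (R * ((k : ℝ) + 1) ^ (-p)) ^ q = R ^ q * ((k + 1 : ℕ) : ℝ) ^ (-(p * q)) := by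
    intro k
    rw [Real.mul_rpow hR.le (by positivity), ← Real.rpow_mul (by positivity)]
    push_cast
    ring_nf
  simp_rw [h]
  rw [summable_mul_left_iff (Real.rpow_pos_of_pos hR q).ne',
    summable_nat_add_iff (f := fun k : ℕ => (k : ℝ) ^ (-(p * q))) 1, Real.summable_nat_rpow]
  exact neg_lt_neg_iff

/-- **Fractal-type sets with prescribed fractional perimeter behaviour.** For every `σ ∈ (0,1)`
and `c₀ > 0` there are bounded measurable sets `Ω_M ⊆ ℝⁿ` and a measurable set `Ω_∞ ⊆ ℝⁿ` such
that: (i) `lim_M P_s(Ω_M)` exists, is finite for `s ∈ (0,σ)` and is `+∞` for `s ∈ [σ,1)`;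
(ii) `Ω_M → Ω_∞` in `L¹`, `|Ω_M| ≤ |Ω_∞| < ∞`, and `P_s(Ω_∞) < ∞` for `s ∈ (0,σ)` while
`P_s(Ω_∞) = +∞` for `s ∈ [σ,1)`; (iii) up to translation, `B_{c₀} ⊆ Ω_M` for every `M`. -/
theorem stmt_19 (n : ℕ) (hn : 2 ≤ n) (σ : ℝ) (hσ : σ ∈ Set.Ioo (0 : ℝ) 1)
    (c₀ : ℝ) (hc₀ : 0 < c₀) :
    ∃ (Ω : ℕ → Set (Rn n)) (Ωinf : Set (Rn n)),
      (∀ M, MeasurableSet (Ω M) ∧ Bornology.IsBounded (Ω M)) ∧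
      MeasurableSet Ωinf ∧
      (∀ s : ℝ, s ∈ Set.Ioo (0 : ℝ) 1 → ∃ L : ℝ≥0∞,
        Tendsto (fun M => fracPer n s (Ω M)) atTop (𝓝 L) ∧
        (s < σ → L ≠ ⊤) ∧ (σ ≤ s → L = ⊤)) ∧
      (Tendsto (fun M => volume (Ω M ∆ Ωinf)) atTop (𝓝 0) ∧
        (∀ M, volume (Ω M) ≤ volume Ωinf) ∧ volume Ωinf ≠ ⊤ ∧
        ∀ s : ℝ, s ∈ Set.Ioo (0 : ℝ) 1 →
          (s < σ → fracPer n s Ωinf ≠ ⊤) ∧ (σ ≤ s → fracPer n s Ωinf = ⊤)) ∧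
      (∀ M, ∃ x : Rn n, ball x c₀ ⊆ Ω M) := by
  obtain ⟨hσ0, hσ1⟩ := hσ
  have hn' : (2 : ℝ) ≤ n := by exact_mod_cast hn
  set p : ℝ := 1 / ((n : ℝ) - σ) with hp
  have hnσ : 0 < (n : ℝ) - σ := by linarith
  have hp0 : 0 < p := by positivity
  set r : ℕ → ℝ := fun k => c₀ * ((k : ℝ) + 1) ^ (-p) with hr
  have hr0 : ∀ k, 0 < r k := fun k => by positivity
  have hrle : ∀ k, r k ≤ c₀ := fun k => mul_le_of_le_one_right hc₀.le
    (Real.rpow_le_one_of_one_le_of_nonpos (by linarith [k.cast_nonneg (α := ℝ)]) (by linarith))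
  have hsum : ∀ s : ℝ, Summable (fun k => r k ^ ((n : ℝ) - s)) ↔ s < σ := fun s => by
    rw [summable_mul_rpow_rpow_iff hc₀, hp, one_div_mul_eq_div, one_lt_div hnσ]
    constructor <;> intro h <;> linarith
  set c : ℕ → Rn n := fun k => EuclideanSpace.single ⟨0, by omega⟩ (4 * c₀ * k) with hc
  have hdist : ∀ j k, j ≠ k → 4 * c₀ ≤ dist (c j) (c k) := fun j k hjk => by
    rw [hc, PiLp.dist_single_same, Real.dist_eq, ← mul_sub, abs_mul,
      abs_of_pos (by positivity)]
    refine le_mul_of_one_le_right (by positivity) ?_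
    have h : (1 : ℤ) ≤ |(j : ℤ) - k| := Int.one_le_abs (by omega)
    exact_mod_cast h
  have hd2 : ∀ j k, j ≠ k → Disjoint (ball (c j) (2 * r j)) (ball (c k) (r k)) := fun j k hjk =>
    ball_disjoint_ball (by linarith [hdist j k hjk, hrle j, hrle k])
  set E : ℕ → Set (Rn n) := fun k => ball (c k) (r k) with hE
  have hmE : ∀ k, MeasurableSet (E k) := fun _ => measurableSet_ball
  have hdE : Pairwise (Function.onFun Disjoint E) := fun j k hjk =>
    (hd2 j k hjk).mono_left (ball_subset_ball (by linarith [hr0 j]))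
  have hvol : ∑' k, volume (E k) ≠ ⊤ := by
    have h : ∀ k, volume (E k) =
        ENNReal.ofReal (r k ^ ((n : ℝ) - 0)) * volume (ball (0 : Rn n) 1) := fun k => by
      rw [hE, Measure.addHaar_ball_of_pos volume (c k) (hr0 k), finrank_euclideanSpace,
        Fintype.card_fin, sub_zero, Real.rpow_natCast]
    simp_rw [h]
    rw [ENNReal.tsum_mul_right]
    exact ENNReal.mul_ne_top ((hsum 0).2 hσ0).tsum_ofReal_ne_top measure_ball_lt_top.ne
  have hfin : ∀ s ∈ Ioo (0 : ℝ) 1, s < σ → ∑' k, fracPer n s (E k) ≠ ⊤ := fun s hs h =>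
    tsum_fracPer_ball_ne_top hn hs c hr0 ((hsum s).2 h)
  have hfin' : ∀ s ∈ Ioo (0 : ℝ) 1, s < σ → fracPer n s (⋃ k, E k) ≠ ⊤ := fun s hs h =>
    ne_top_of_le_ne_top (hfin s hs h) (fracPer_iUnion_le s E)
  have htop : ∀ s ∈ Ioo (0 : ℝ) 1, σ ≤ s → fracPer n s (⋃ k, E k) = ⊤ := fun s hs h =>
    fracPer_iUnion_ball_eq_top (by omega) hs.1 hr0 hd2 fun h' => ((hsum s).1 h').not_ge h
  have hsub : ∀ M, ⋃ k ∈ Finset.range (M + 1), E k ⊆ ⋃ k, E k := fun M =>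
    iUnion₂_subset fun k _ => subset_iUnion E k
  refine ⟨fun M => ⋃ k ∈ Finset.range (M + 1), E k, ⋃ k, E k, fun M => ⟨?_, ?_⟩,
    MeasurableSet.iUnion hmE, fun s hs => ⟨fracPer n s (⋃ k, E k), ?_, hfin' s hs, htop s hs⟩,
    ⟨?_, fun M => measure_mono (hsub M), ?_, fun s hs => ⟨hfin' s hs, htop s hs⟩⟩,
    fun M => ⟨c 0, ?_⟩⟩
  · exact Finset.measurableSet_biUnion _ fun k _ => hmE k
  · exact (Bornology.isBounded_biUnion_finset _).2 fun k _ => isBounded_ball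
  · refine (tendsto_add_atTop_iff_nat 1).2 (tendsto_fracPer_biUnion_range s hmE hdE ?_)
    exact (lt_or_ge s σ).imp (hfin s hs) (htop s hs)
  · refine tendsto_of_tendsto_of_tendsto_of_le_of_le tendsto_const_nhds
      ((tendsto_add_atTop_iff_nat 1).2 (ENNReal.tendsto_sum_nat_add _ hvol))
      (fun _ => zero_le) fun M => ?_
    rw [symmDiff_of_le (hsub M)]
    exact (measure_mono (iUnion_diff_biUnion_range_subset E (M + 1))).trans (measure_iUnion_le _)
  · exact ne_top_of_le_ne_top hvol (measure_iUnion_le _)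
  · have h0 : r 0 = c₀ := by simp [hr]
    have : E 0 ⊆ ⋃ k ∈ Finset.range (M + 1), E k :=
      subset_biUnion_of_mem (u := E) (Finset.mem_coe.2 (Finset.mem_range.2 M.succ_pos))
    rwa [hE, ← h0]
end
end
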